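/- Let f = (f_1,…,f_p) with f_i ∈ ℂ[z_1,…,z_n] be a dominant polynomial mapping (in particular p ≤ n) and let d = max_{1 ≤ i ≤ p} deg f_i. Then there exists a nonzero polynomial g ∈ ℂ[c_1,…,c_p] of total degree at most p^{n−p+1}·(d−1)^{n−p}·(d+1)^{p} such that K_∞(f) ⊆ { c ∈ ℂ^p : g(c) = 0 }; that is, the asymptotic critical values of f are contained in a hypersurface of degree at most p^{n−p+1}(d−1)^{n−p}(d+1)^{p}. -/

import Mathlib

open MvPolynomial Filter

/-- Euclidean norm on `ℂ^m`. -/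
noncomputable def eucNorm {m : ℕ} (v : Fin m → ℂ) : ℝ :=
  Real.sqrt (∑ k, ‖v k‖ ^ 2)

/-- The differential of `f_j` at `x` applied to `v`. -/
noncomputable def pdiff {n p : ℕ} (f : Fin p → MvPolynomial (Fin n) ℂ)
    (x : Fin n → ℂ) (j : Fin p) (v : Fin n → ℂ) : ℂ :=
  ∑ k, MvPolynomial.eval x (MvPolynomial.pderiv k (f j)) * v k

/-- Operator norm of `w_j(x)`, the restriction of `df_j(x)` to the kernel of
`v ↦ (df_i(x) v)_{i ≠ j}`. -/
noncomputable def wNorm {n p : ℕ} (f : Fin p → MvPolynomial (Fin n) ℂ)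
    (x : Fin n → ℂ) (j : Fin p) : ℝ :=
  sSup { r : ℝ | ∃ v : Fin n → ℂ,
    (∀ i : Fin p, i ≠ j → pdiff f x i v = 0) ∧ eucNorm v ≤ 1 ∧ r = ‖pdiff f x j v‖ }

/-- The Kuo distance `κ(df(x)) = min_{1 ≤ j ≤ p} ‖w_j(x)‖`. -/
noncomputable def kuoDist {n p : ℕ} (f : Fin p → MvPolynomial (Fin n) ℂ)
    (x : Fin n → ℂ) : ℝ :=
  ⨅ j : Fin p, wNorm f x j

/-- The set of asymptotic critical values of the polynomial map `f : ℂ^n → ℂ^p`. -/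
def Kinf {n p : ℕ} (f : Fin p → MvPolynomial (Fin n) ℂ) : Set (Fin p → ℂ) :=
  { c | ∃ x : ℕ → (Fin n → ℂ),
      Tendsto (fun t => eucNorm (x t)) atTop atTop ∧
      Tendsto (fun t j => MvPolynomial.eval (x t) (f j)) atTop (nhds c) ∧
      Tendsto (fun t => eucNorm (x t) * kuoDist f (x t)) atTop (nhds 0) }

universe u

/-- In characteristic zero a derivation may be prescribed on an algebraically independent
family. -/
theorem AlgebraicIndependent.exists_derivation {k K ι : Type*} [Field k] [CharZero k] [Field K]
    [Algebra k K] {v : ι → K} (hv : AlgebraicIndependent k v) (c : ι → K) :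
    ∃ D : Derivation k K K, ∀ i, D (v i) = c i := by
  classical
  obtain ⟨s, hvs, hs⟩ := exists_isTranscendenceBasis_superset hv.coe_range
  have hinj := hv.injective
  let c' : s → K := fun y => if h : ∃ i, v i = (y : K) then c h.choose else 0
  let S := MvPolynomial s k
  let : Algebra S K := (aeval ((↑) : s → K)).toAlgebra
  have hmap : ∀ P : S, algebraMap S K P = aeval ((↑) : s → K) P := fun P => rfl
  have : IsScalarTower k S K := .of_algebraMap_eq fun r => by simp [hmap, S]
  have : FaithfulSMul S K := (faithfulSMul_iff_algebraMap_injective S K).2 hs.1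
  let := FractionRing.liftAlgebra S K
  have : Algebra.IsAlgebraic S K := by
    have hr : Algebra.adjoin k (Set.range ((↑) : s → K)) = (aeval ((↑) : s → K)).range :=
      Algebra.adjoin_range_eq_range_aeval _ _
    have := hs.isAlgebraic
    rw [hr] at this
    constructor
    intro x
    obtain ⟨q, hq0, hq⟩ := this.isAlgebraic x
    let φ : S →+* (aeval ((↑) : s → K) : S →ₐ[k] K).range :=
      (aeval ((↑) : s → K) : S →ₐ[k] K).rangeRestrict.toRingHom
    have hφ : Function.Surjective φ := AlgHom.rangeRestrict_surjective _
    obtain ⟨r, rfl⟩ := Polynomial.map_surjective φ hφ q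
    refine ⟨r, fun h => hq0 (by simp [h]), ?_⟩
    rw [Polynomial.aeval_def, Polynomial.eval₂_map] at hq
    exact hq
  have : Algebra.IsAlgebraic (FractionRing S) K := 
    (IsFractionRing.comap_isAlgebraic_iff (A := S) (K := FractionRing S) (C := K)).1 inferInstance
  have : CharZero K := charZero_of_injective_algebraMap (algebraMap k K).injective
  have : CharZero (FractionRing S) := charZero_of_injective_algebraMap (IsFractionRing.injective S (FractionRing S))
  have : Algebra.FormallyEtale S (FractionRing S) := .of_isLocalization (nonZeroDivisors _)
  have : Algebra.FormallyEtale (FractionRing S) K := .of_isSeparable _ _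
  have : Algebra.FormallyEtale S K := .comp _ (FractionRing S) _
  let d : Derivation k S K := mkDerivation k c'
  let e := KaehlerDifferential.tensorKaehlerEquivOfFormallyEtale k S K
  let L : (Ω[K⁄k]) →ₗ[K] K := (d.liftKaehlerDifferential.liftBaseChange K) ∘ₗ e.symm.toLinearMap
  refine ⟨L.compDer (KaehlerDifferential.D k K), fun i => ?_⟩
  have hi : v i = algebraMap S K (X ⟨v i, hvs ⟨i, rfl⟩⟩) := by simp [hmap]
  have : ∃ l, v l = v i := ⟨i, rfl⟩
  have h2 : c' ⟨v i, hvs ⟨i, rfl⟩⟩ = c i := by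
    simp only [c', dif_pos this]
    exact congrArg c (hinj this.choose_spec)
  have h3 : L (KaehlerDifferential.D k K (algebraMap S K (X ⟨v i, hvs ⟨i, rfl⟩⟩))) = c i := by
    simp only [L, LinearMap.comp_apply, e, LinearEquiv.coe_coe]
    rw [KaehlerDifferential.tensorKaehlerEquivOfFormallyEtale_symm_D_algebraMap]
    rw [LinearMap.liftBaseChange_tmul, Derivation.liftKaehlerDifferential_comp_D, one_smul]
    exact (mkDerivation_X k c' _).trans h2
  rw [← hi] at h3
  exact h3

/-- A derivation vanishing on a transcendence basis vanishes. -/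
theorem IsTranscendenceBasis.derivation_eq_zero {k K ι : Type*} [Field k] [CharZero k] [Field K]
    [Algebra k K] {v : ι → K} (hv : IsTranscendenceBasis k v) (D : Derivation k K K)
    (h : ∀ i, D (v i) = 0) : D = 0 := by
  let E := IntermediateField.adjoin k (Set.range v)
  have : Algebra.IsAlgebraic E K := hv.isAlgebraic_field
  have hE : ∀ y : E, D (y : K) = 0 := by
    rintro ⟨y, hy⟩
    induction hy using IntermediateField.adjoin_induction with
    | mem x hx => obtain ⟨i, rfl⟩ := hx; exact h i
    | algebraMap x => exact D.map_algebraMap x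
    | add x y _ _ hx hy => simpa using by simp_all
    | inv x _ hx => simp_all [Derivation.leibniz_inv]
    | mul x y _ _ hx hy => simp_all
  let D' : Derivation E K K :=
    { toFun := D
      map_add' := D.map_add
      map_smul' := fun a x => by
        simp [Algebra.smul_def, hE a] 
      map_one_eq_zero' := D.map_one_eq_zero
      leibniz' := D.leibniz }
  have : CharZero K := charZero_of_injective_algebraMap (algebraMap k K).injective
  have : CharZero E := charZero_of_injective_algebraMap (algebraMap k E).injective
  have : Algebra.FormallyEtale E K := .of_isSeparable _ _
  have h0 : D' = 0 := by
    have : Subsingleton (Ω[K⁄E]) := inferInstance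
    rw [← D'.liftKaehlerDifferential_comp]
    ext x
    simp [Subsingleton.elim (KaehlerDifferential.D E K x) 0]
  ext x
  exact congrArg (fun d : Derivation E K K => d x) h0

section LogDerivation

open IsLocalRing

/-- A nonzero element killed by a homomorphism, together with a lift of an algebraically independent
family, is algebraically independent. -/
theorem AlgebraicIndependent.option_of_map_eq_zero {k O B ι : Type*} [Field k] [CommRing O]
    [IsDomain O] [Algebra k O] [CommRing B] [Algebra k B] (φ : O →ₐ[k] B) {t : O} (ht0 : t ≠ 0)
    (ht : φ t = 0) {b : ι → O} (hb : AlgebraicIndependent k fun i => φ (b i)) :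
    AlgebraicIndependent k (fun o : Option ι => o.elim t b) := by
  have hb' : AlgebraicIndependent k b := AlgebraicIndependent.of_comp φ hb
  rw [hb'.option_iff_transcendental]
  rintro ⟨q, hq0, hq⟩
  obtain ⟨r, hr, hrn⟩ := Polynomial.exists_eq_pow_rootMultiplicity_mul_and_not_dvd q hq0 0
  rw [map_zero, sub_zero] at hr hrn
  have hrt : Polynomial.aeval t r = 0 := by
    rw [hr, map_mul, map_pow, Polynomial.aeval_X] at hq
    exact (mul_eq_zero.1 hq).resolve_left (pow_ne_zero _ ht0)
  refine hrn (Polynomial.X_dvd_iff.2 ?_)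
  have h1 : φ (r.coeff 0 : O) = 0 := by
    rw [← Polynomial.divX_mul_X_add r] at hrt
    simp only [map_add, map_mul, Polynomial.aeval_X, Polynomial.aeval_C] at hrt
    have h2 : ((r.coeff 0 : Algebra.adjoin k (Set.range b)) : O) = - Polynomial.aeval t r.divX * t := by
      change algebraMap (Algebra.adjoin k (Set.range b)) O (r.coeff 0) = _
      linear_combination hrt
    rw [h2, map_mul, ht, mul_zero]
  obtain ⟨P, hP⟩ : ∃ P : MvPolynomial ι k, aeval b P = (r.coeff 0 : O) := by
    exact (Algebra.adjoin_range_eq_range_aeval k b).le (r.coeff 0).2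
  have hP0 : P = 0 := by
    rw [← hP, ← AlgHom.comp_apply, comp_aeval] at h1
    exact (algebraicIndependent_iff.1 hb) P h1
  ext
  rw [← hP, hP0]; simp

/-- In a discrete valuation ring essentially of finite type in characteristic zero, values of a
derivation with logarithmic pole can be prescribed on elements with algebraically independent
residues. -/
theorem IsDiscreteValuationRing.exists_log_derivation {k O K : Type*} [Field k] [CommRing O]
    [IsDomain O] [IsDiscreteValuationRing O] [Algebra k O] [Field K] [Algebra O K]
    [IsFractionRing O K] [Algebra k K] [IsScalarTower k O K] [CharZero k] [Algebra.EssFiniteType k O]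
    {ι : Type*} (f : ι → O) (hf : AlgebraicIndependent k fun i => residue O (f i)) (c : ι → k) :
    ∃ D : Derivation k K K, (∀ i, D (algebraMap O K (f i)) = algebraMap k K (c i)) ∧
      ∀ x : O, ∃ y : O, D (algebraMap O K x) = algebraMap O K (x * y) := by
  classical
  obtain ⟨t, ht⟩ := IsDiscreteValuationRing.exists_irreducible O
  let res : O →ₐ[k] ResidueField O := Algebra.algHom k O (ResidueField O)
  have hres : ∀ x, res x = residue O x := fun x => rfl
  have hressurj : Function.Surjective res := residue_surjective
  have hinjK : Function.Injective (algebraMap O K) := IsFractionRing.injective O K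
  have ht0 : algebraMap O K t ≠ 0 := fun h => ht.ne_zero (hinjK (by simpa using h))
  obtain ⟨s, hfs, hs⟩ := exists_isTranscendenceBasis_superset hf.coe_range
  have hinj := hf.injective
  have hb : ∀ y : s, ∃ b : O, residue O b = y ∧ ∀ i, residue O (f i) = y → b = f i := by
    intro y
    by_cases h : ∃ i, residue O (f i) = y
    · obtain ⟨i, hi⟩ := h
      exact ⟨f i, hi, fun j hj => congrArg f (hinj (hi.trans hj.symm))⟩
    · obtain ⟨b, hb⟩ := residue_surjective (y : ResidueField O)
      exact ⟨b, hb, fun i hi => (h ⟨i, hi⟩).elim⟩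
  choose b hbres hbf using hb
  have hbi : AlgebraicIndependent k fun i => residue O (b i) := by
    simp_rw [hbres]; exact hs.1
  have hopt := AlgebraicIndependent.option_of_map_eq_zero res ht.ne_zero
    (by rw [hres, residue_eq_zero_iff]; exact ht.not_isUnit) hbi
  have hoptK : AlgebraicIndependent k 
      (fun o : Option s => algebraMap O K (o.elim t b)) :=
    hopt.map' (f := Algebra.algHom k O K) hinjK
  let cs : s → k := fun y => if h : ∃ i, residue O (f i) = y then c h.choose else 0
  have hcs : ∀ i, cs ⟨residue O (f i), hfs ⟨i, rfl⟩⟩ = c i := by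
    intro i
    have h : ∃ l, residue O (f l) = residue O (f i) := ⟨i, rfl⟩
    simp only [cs, dif_pos h]
    exact congrArg c (hinj h.choose_spec)
  obtain ⟨D, hD⟩ := hoptK.exists_derivation
    (fun o : Option s => o.elim 0 (fun y => algebraMap k K (cs y)))
  have hDt : D (algebraMap O K t) = 0 := hD none
  have hDb : ∀ y : s, D (algebraMap O K (b y)) = algebraMap k K (cs y) := fun y => hD (some y)
  have hDf : ∀ i, D (algebraMap O K (f i)) = algebraMap k K (c i) := by
    intro i
    rw [← hcs i, ← hDb, hbf ⟨residue O (f i), hfs ⟨i, rfl⟩⟩ i rfl]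
  -- clearing denominators
  have hden : ∀ z : K, ∃ N : ℕ, ∀ M, N ≤ M → ∃ y : O,
      algebraMap O K t ^ M * z = algebraMap O K y := by
    intro z
    obtain ⟨a, d, hd, rfl⟩ := IsFractionRing.div_surjective (A := O) z
    have hd0 : d ≠ 0 := nonZeroDivisors.ne_zero hd
    obtain ⟨N, u, hu⟩ := IsDiscreteValuationRing.eq_unit_mul_pow_irreducible hd0 ht
    refine ⟨N, fun M hM => ⟨t ^ (M - N) * a * ↑u⁻¹, ?_⟩⟩
    have hu0 : algebraMap O K (u : O) ≠ 0 := fun h => by simp at h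
    have hui : algebraMap O K ((u⁻¹ : Oˣ) : O) * algebraMap O K u = 1 := by
      rw [← map_mul]; simp
    obtain ⟨e, rfl⟩ := Nat.exists_eq_add_of_le hM
    rw [hu, map_mul, map_mul, map_mul, map_pow, map_pow, Nat.add_sub_cancel_left, pow_add]
    field_simp
    linear_combination (-(algebraMap O K) a) * hui
  let good : ℕ → Prop := fun N => ∀ x : O, ∃ y : O,
    algebraMap O K t ^ N * D (algebraMap O K x) = algebraMap O K y
  have hgood : ∃ N, good N := by
    obtain ⟨σ, hσ⟩ := (Algebra.essFiniteType_iff k O).1 inferInstance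
    choose N hN using fun x : O => hden (D (algebraMap O K x))
    refine ⟨σ.sup N, ?_⟩
    have h1 : ∀ x ∈ Algebra.adjoin k (σ : Set O), ∃ y : O,
        algebraMap O K t ^ (σ.sup N) * D (algebraMap O K x) = algebraMap O K y := by
      intro x hx
      induction hx using Algebra.adjoin_induction with
      | mem x hx => exact hN x _ (Finset.le_sup (f := N) (by exact hx))
      | algebraMap r =>
        refine ⟨0, ?_⟩
        rw [← IsScalarTower.algebraMap_apply, D.map_algebraMap]; simp
      | add x y _ _ hx hy =>
        obtain ⟨a, ha⟩ := hx
        obtain ⟨b, hb⟩ := hy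
        exact ⟨a + b, by rw [map_add, map_add, map_add, mul_add, ha, hb]⟩
      | mul x y _ _ hx hy =>
        obtain ⟨a, ha⟩ := hx
        obtain ⟨b, hb⟩ := hy
        refine ⟨x * b + y * a, ?_⟩
        simp only [map_add, map_mul, D.leibniz, smul_eq_mul, ← ha, ← hb]
        ring
    intro x
    obtain ⟨r, hr, hru, hxr⟩ := hσ x
    obtain ⟨a, ha⟩ := h1 _ hr
    obtain ⟨e, he⟩ := h1 _ hxr
    obtain ⟨u, rfl⟩ := hru
    refine ⟨(e - x * a) * ↑u⁻¹, ?_⟩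
    have hui : algebraMap O K (u : O) * algebraMap O K ((u⁻¹ : Oˣ) : O) = 1 := by
      rw [← map_mul]; simp
    rw [map_mul, D.leibniz, smul_eq_mul, smul_eq_mul] at he
    rw [map_mul, map_sub, map_mul, ← he, ← ha]
    linear_combination (-algebraMap O K t ^ (σ.sup N) * D (algebraMap O K x)) * hui
  have hg0 : good 0 := by
    by_contra hcon
    have hpos : Nat.find hgood ≠ 0 := fun h => hcon (h ▸ Nat.find_spec hgood)
    obtain ⟨N, hN⟩ := Nat.exists_eq_succ_of_ne_zero hpos
    have hG := Nat.find_spec hgood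
    have hmin := Nat.find_min hgood (m := N) (by omega)
    rw [hN] at hG
    choose g hg using hG
    have hsm : ∀ (a : k) (x : O), algebraMap O K (a • x) = algebraMap k K a * algebraMap O K x := by
      intro a x
      rw [Algebra.smul_def, map_mul, ← IsScalarTower.algebraMap_apply]
    let gl : O →ₗ[k] O :=
      { toFun := g
        map_add' := fun x y => hinjK (by
          rw [map_add, ← hg, ← hg, ← hg, map_add, map_add, mul_add])
        map_smul' := fun a x => hinjK (by
          rw [RingHom.id_apply, hsm, ← hg, ← hg, hsm, D.leibniz, D.map_algebraMap]
          simp only [smul_eq_mul]; ring) }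
    let δ : Derivation k O O := Derivation.mk' gl fun x y => hinjK (by
      change algebraMap O K (g (x * y)) = algebraMap O K (x • g y + y • g x)
      rw [smul_eq_mul, smul_eq_mul, map_add, map_mul, map_mul, ← hg, ← hg, ← hg, map_mul, D.leibniz]
      simp only [smul_eq_mul]; ring)
    have hδ : ∀ x, algebraMap O K (δ x) = algebraMap O K t ^ (N + 1) * D (algebraMap O K x) :=
      fun x => (hg x).symm
    have hrest : res t = 0 := by
      rw [hres, residue_eq_zero_iff]; exact ht.not_isUnit
    have hker : ∀ x, res x = 0 → res (δ x) = 0 := by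
      intro x hx
      rw [hres, residue_eq_zero_iff, Irreducible.maximalIdeal_eq ht, Ideal.mem_span_singleton] at hx
      obtain ⟨y, rfl⟩ := hx
      have : δ t = 0 := hinjK (by rw [hδ, hDt, mul_zero, map_zero])
      rw [Derivation.leibniz, this, smul_zero, add_zero, smul_eq_mul, map_mul, hrest, zero_mul]
    let δ' : Derivation k (ResidueField O) (ResidueField O) :=
      Derivation.liftOfSurjective hressurj (d := δ) hker
    have hδ' : ∀ x, δ' (res x) = res (δ x) := fun x =>
      Derivation.liftOfSurjective_apply hressurj hker x
    have h0 : δ' = 0 := by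
      refine hs.derivation_eq_zero δ' fun y => ?_
      have : (y : ResidueField O) = res (b y) := (hbres y).symm
      rw [this, hδ']
      have h2 : δ (b y) = t * (t ^ N * algebraMap k O (cs y)) := hinjK (by
        rw [hδ, hDb, map_mul, map_mul, map_pow, ← IsScalarTower.algebraMap_apply]; ring)
      rw [h2, map_mul, hrest, zero_mul]
    refine hmin fun x => ?_
    have h3 : res (δ x) = 0 := by rw [← hδ', h0]; rfl
    rw [hres, residue_eq_zero_iff, Irreducible.maximalIdeal_eq ht, Ideal.mem_span_singleton] at h3
    obtain ⟨y, hy⟩ := h3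
    refine ⟨y, mul_left_cancel₀ ht0 ?_⟩
    rw [← map_mul, ← hy, hδ]; ring
  refine ⟨D, hDf, fun x => ?_⟩
  by_cases hx : x = 0
  · exact ⟨0, by simp [hx]⟩
  obtain ⟨e, u, rfl⟩ := IsDiscreteValuationRing.eq_unit_mul_pow_irreducible hx ht
  obtain ⟨y, hy⟩ := hg0 (u : O)
  rw [pow_zero, one_mul] at hy
  refine ⟨↑u⁻¹ * y, ?_⟩
  have hui : algebraMap O K (u : O) * algebraMap O K ((u⁻¹ : Oˣ) : O) = 1 := by
    rw [← map_mul]; simp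
  have h4 : D (algebraMap O K (t ^ e)) = 0 := by
    rw [map_pow, D.leibniz_pow, hDt]; simp
  rw [map_mul, D.leibniz, h4, hy]
  simp only [smul_eq_mul, map_mul, map_pow]
  linear_combination (-algebraMap O K t ^ e * algebraMap O K y) * hui

end LogDerivation

/-- Every prime of a domain is the centre of a valuation subring of its fraction field. -/
theorem Ideal.exists_valuationSubring_center {A K : Type*} [CommRing A] [IsDomain A] [Field K]
    [Algebra A K] [IsFractionRing A K] (𝔮 : Ideal A) [𝔮.IsPrime] :
    ∃ V : ValuationSubring K, (∀ a : A, V.valuation (algebraMap A K a) ≤ 1) ∧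
      ∀ a : A, V.valuation (algebraMap A K a) < 1 ↔ a ∈ 𝔮 := by
  have hunit : ∀ y : 𝔮.primeCompl, IsUnit (algebraMap A K y) := by
    intro y
    refine isUnit_iff_ne_zero.2 fun h => y.2 ?_
    rw [(map_eq_zero_iff _ (IsFractionRing.injective A K)).1 h]
    exact 𝔮.zero_mem
  let φ : Localization.AtPrime 𝔮 →+* K := IsLocalization.lift hunit
  have hφ : ∀ a, φ (algebraMap A _ a) = algebraMap A K a := fun a => IsLocalization.lift_eq _ _
  obtain ⟨V, hV, hloc⟩ := IsLocalRing.exists_factor_valuationRing φ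
  have hmem : ∀ a : A, algebraMap A K a ∈ V := fun a => by rw [← hφ]; exact hV _
  refine ⟨V, fun a => (V.valuation_le_one_iff _).2 (hmem a), fun a => ?_⟩
  have h1 : V.valuation (algebraMap A K a) < 1 ↔ ¬ IsUnit (⟨algebraMap A K a, hmem a⟩ : V) := by
    rw [← V.valuation_lt_one_iff ⟨_, hmem a⟩, IsLocalRing.mem_maximalIdeal, mem_nonunits_iff]
  rw [h1, ← not_iff_comm]
  change a ∈ 𝔮.primeCompl ↔ _
  rw [← IsLocalization.AtPrime.isUnit_to_map_iff (Localization.AtPrime 𝔮) 𝔮]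
  rw [show (⟨algebraMap A K a, hmem a⟩ : V) = φ.codRestrict V.toSubring hV (algebraMap A _ a) from
    Subtype.ext (hφ a).symm]
  rw [isUnit_map_iff (φ.codRestrict V.toSubring hV)]

/-- A minimal prime over a nonzero principal ideal of a normal noetherian domain has a discrete
valuation ring as localization. -/
theorem IsIntegrallyClosed.isDiscreteValuationRing_of_mem_minimalPrimes {B : Type*} [CommRing B]
    [IsDomain B] [IsNoetherianRing B] [IsIntegrallyClosed B] {a : B} (ha : a ≠ 0) {𝔟 : Ideal B}
    [𝔟.IsPrime] (h : 𝔟 ∈ (Ideal.span {a}).minimalPrimes) :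
    IsDiscreteValuationRing (Localization.AtPrime 𝔟) := by
  have ht : 𝔟.height ≤ 1 := Ideal.height_le_one_of_isPrincipal_of_mem_minimalPrimes _ _ h
  have hab : a ∈ 𝔟 := h.1.2 (Ideal.mem_span_singleton_self a)
  have hne : ¬ IsField (Localization.AtPrime 𝔟) := by
    intro hf
    have := IsLocalization.AtPrime.not_isField B (P := 𝔟) (by rintro rfl; exact ha hab)
      (Localization.AtPrime 𝔟)
    exact this hf
  have : IsNoetherianRing (Localization.AtPrime 𝔟) := 
    IsLocalization.isNoetherianRing 𝔟.primeCompl _ inferInstance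
  have hic : IsIntegrallyClosed (Localization.AtPrime 𝔟) :=
    isIntegrallyClosed_of_isLocalization _ 𝔟.primeCompl 𝔟.primeCompl_le_nonZeroDivisors
  have hdim : Ring.KrullDimLE 1 (Localization.AtPrime 𝔟) := by
    rw [Ring.krullDimLE_iff, IsLocalization.AtPrime.ringKrullDim_eq_height 𝔟]
    exact_mod_cast ht
  have : Ring.DimensionLEOne (Localization.AtPrime 𝔟) := ⟨fun {I} h0 hI => 
    Ring.krullDimLE_one_iff_of_isPrime_bot.1 hdim I h0 hI⟩
  refine ((IsDiscreteValuationRing.TFAE _ hne).out 0 2).2 ?_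
  exact {}

/-- In characteristic zero, a field of fractions `K` of an algebra of finite type over a field,
contained in a valuation ring `V`: there is a normal subalgebra of finite type between the algebra
and `V`, again with fraction field `K`. -/
theorem exists_normal_le_valuationSubring {k A K : Type*} [Field k] [CharZero k] [CommRing A]
    [IsDomain A] [Algebra k A] [Algebra.FiniteType k A] [Field K] [Algebra A K]
    [IsFractionRing A K] [Algebra k K] [IsScalarTower k A K] (V : ValuationSubring K)
    (hV : ∀ a : A, algebraMap A K a ∈ V) :
    ∃ B : Subalgebra k K, Algebra.FiniteType k B ∧ IsFractionRing B K ∧ IsIntegrallyClosed B ∧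
      (∀ a : A, algebraMap A K a ∈ B) ∧ ∀ x ∈ B, x ∈ V := by
  obtain ⟨n, g, hgi, hgf⟩ := exists_finite_inj_algHom_of_fg k A
  let R := MvPolynomial (Fin n) k
  let : Algebra R A := g.toRingHom.toAlgebra
  let : Algebra R K := ((algebraMap A K).comp g.toRingHom).toAlgebra
  have : IsScalarTower R A K := .of_algebraMap_eq fun _ => rfl
  have hg : ∀ P, algebraMap R A P = g P := fun _ => rfl
  have : IsScalarTower k R A := .of_algebraMap_eq fun r => by rw [hg]; simp [R]
  have hgK : ∀ P, algebraMap R K P = algebraMap A K (g P) := fun _ => rfl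
  have : IsScalarTower k R K := .of_algebraMap_eq fun r => by
    rw [hgK, IsScalarTower.algebraMap_apply k A K]; simp [R]
  have : Module.Finite R A := hgf
  have : FaithfulSMul R A := (faithfulSMul_iff_algebraMap_injective R A).2 hgi
  have : FaithfulSMul R K := (faithfulSMul_iff_algebraMap_injective R K).2 
    ((IsFractionRing.injective A K).comp hgi)
  let := FractionRing.liftAlgebra R K
  have : Algebra.IsAlgebraic A K := IsLocalization.isAlgebraic _ (nonZeroDivisors A)
  have : Algebra.IsAlgebraic R K := Algebra.IsAlgebraic.trans R A K
  have : Algebra.IsAlgebraic (FractionRing R) K := 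
    (IsFractionRing.comap_isAlgebraic_iff (A := R) (K := FractionRing R) (C := K)).1 inferInstance
  have : Algebra.EssFiniteType A K := Algebra.EssFiniteType.of_isLocalization _ (nonZeroDivisors A)
  have : Algebra.EssFiniteType R K := Algebra.EssFiniteType.comp R A K
  have : Algebra.EssFiniteType (FractionRing R) K := Algebra.EssFiniteType.of_comp R _ K
  have : FiniteDimensional (FractionRing R) K := Algebra.finite_of_essFiniteType_of_isAlgebraic
  have : CharZero R := charZero_of_injective_algebraMap (algebraMap k R).injective
  have : CharZero (FractionRing R) :=
    charZero_of_injective_algebraMap (IsFractionRing.injective R (FractionRing R))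
  let C := integralClosure R K
  have hCf : IsFractionRing C K := integralClosure.isFractionRing_of_algebraic fun x hx => by
    simpa using hx
  have hCi : IsIntegrallyClosed C := 
    integralClosure.isIntegrallyClosedOfFiniteExtension (FractionRing R)
  have hfin : Module.Finite R C := IsIntegralClosure.finite R (FractionRing R) K C
  have : Algebra.FiniteType k C := .trans (S := R) inferInstance inferInstance
  refine ⟨C.restrictScalars k, this, hCf, hCi, fun a => ?_, fun x hx => ?_⟩
  · exact (Algebra.IsIntegral.isIntegral (R := R) a).algebraMap
  · have hx : IsIntegral R x := hx
    refine V.valuation_le_one_iff x |>.1 ?_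
    let : Algebra R V := (((algebraMap A K).codRestrict V.toSubring hV).comp g.toRingHom).toAlgebra
    have : IsScalarTower R V K := .of_algebraMap_eq fun _ => rfl
    have hxV : IsIntegral V x := hx.tower_top
    obtain ⟨y, rfl⟩ := (isIntegrallyClosed_iff K).1 inferInstance hxV
    exact (V.valuation_le_one_iff _).2 y.2

/-- Logarithmic derivations centred at a prime of a domain of finite type over a field of
characteristic zero: values on elements which are algebraically independent modulo the prime may be
prescribed. -/
theorem Ideal.exists_log_derivation {k A K ι : Type*} [Field k] [CharZero k] [CommRing A]
    [IsDomain A] [Algebra k A] [Algebra.FiniteType k A] [Field K] [Algebra A K]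
    [IsFractionRing A K] [Algebra k K] [IsScalarTower k A K] (𝔮 : Ideal A) [𝔮.IsPrime]
    (f : ι → A) (hf : AlgebraicIndependent k fun i => Ideal.Quotient.mk 𝔮 (f i))
    (s : Finset A) (hs : ∀ a ∈ s, a ∈ 𝔮) (hs0 : ∃ a ∈ s, a ≠ 0) (c : ι → k) :
    ∃ (D : Derivation k K K) (O : Subring K) (M : AddSubgroup K),
      (∀ i, D (algebraMap A K (f i)) = algebraMap k K (c i)) ∧ (∀ a : A, algebraMap A K a ∈ O) ∧
      (∀ a ∈ s, algebraMap A K a ∈ M) ∧ (∀ x ∈ O, ∀ y ∈ M, x * y ∈ M) ∧ (1 : K) ∉ M ∧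
      ∀ x ∈ O, ∃ y ∈ O, D x = x * y := by
  classical
  have hinj : Function.Injective (algebraMap A K) := IsFractionRing.injective A K
  obtain ⟨V, hV1, hVq⟩ := Ideal.exists_valuationSubring_center (K := K) 𝔮
  obtain ⟨a, has, hamax⟩ := s.exists_max_image (fun a => V.valuation (algebraMap A K a))
    (let ⟨a, h, _⟩ := hs0; ⟨a, h⟩)
  have ha0 : a ≠ 0 := by
    rintro rfl
    obtain ⟨b, hb, hb0⟩ := hs0
    have := hamax b hb
    rw [map_zero, map_zero, le_zero_iff, map_eq_zero, map_eq_zero_iff _ hinj] at this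
    exact hb0 this
  have haK : algebraMap A K a ≠ 0 := fun h => ha0 (hinj (by simpa using h))
  let A' : Subalgebra A K :=
    Algebra.adjoin A ((s.image fun b => algebraMap A K b / algebraMap A K a : Finset K) : Set K)
  have hA'V : ∀ x : A', algebraMap A' K x ∈ V := by
    rintro ⟨x, hx⟩
    change x ∈ V
    induction hx using Algebra.adjoin_induction with
    | mem x hx =>
      simp only [Finset.coe_image, Set.mem_image, Finset.mem_coe] at hx
      obtain ⟨b, hb, rfl⟩ := hx
      rw [← V.valuation_le_one_iff, map_div₀]
      exact div_le_one_of_le₀ (hamax b hb) zero_le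
    | algebraMap r => exact (V.valuation_le_one_iff _).1 (hV1 r)
    | add x y _ _ hx hy => exact V.add_mem _ _ hx hy
    | mul x y _ _ hx hy => exact V.mul_mem _ _ hx hy
  have : Algebra.FiniteType A A' := (Subalgebra.fg_iff_finiteType A').1 (Subalgebra.fg_adjoin_finset _)
  have : Algebra.FiniteType k A' := .trans (S := A) inferInstance inferInstance
  have : IsFractionRing A' K := by
    refine IsFractionRing.of_field _ _ fun z => ?_
    obtain ⟨x, y, -, rfl⟩ := IsFractionRing.div_surjective (A := A) z
    exact ⟨algebraMap A A' x, algebraMap A A' y, rfl⟩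
  obtain ⟨B, hBft, hBK, hBi, hAB, hBV⟩ := exists_normal_le_valuationSubring (k := k) (A := A') V hA'V
  have : IsNoetherianRing B := Algebra.FiniteType.isNoetherianRing k B
  have hAB' : ∀ x : A, algebraMap A K x ∈ B := fun x => hAB (algebraMap A A' x)
  let aB : B := ⟨algebraMap A K a, hAB' a⟩
  have haB : aB ≠ 0 := fun h => haK (congrArg Subtype.val h)
  let incl : B →+* V := 
    { toFun := fun x => ⟨x, hBV x x.2⟩
      map_one' := rfl
      map_mul' := fun _ _ => rfl
      map_zero' := rfl
      map_add' := fun _ _ => rfl }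
  let 𝔮B : Ideal B := (IsLocalRing.maximalIdeal V).comap incl
  have h𝔮B : ∀ x : B, x ∈ 𝔮B ↔ V.valuation (x : K) < 1 := fun x => by
    rw [Ideal.mem_comap, V.valuation_lt_one_iff]; rfl
  obtain ⟨𝔟, h𝔟, h𝔟q⟩ := Ideal.exists_minimalPrimes_le (I := Ideal.span {aB}) (J := 𝔮B) (by
    rw [Ideal.span_singleton_le_iff_mem, h𝔮B]
    exact (hVq a).2 (hs a has))
  have : 𝔟.IsPrime := h𝔟.1.1
  have haB𝔟 : aB ∈ 𝔟 := h𝔟.1.2 (Ideal.mem_span_singleton_self aB)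
  have := IsIntegrallyClosed.isDiscreteValuationRing_of_mem_minimalPrimes haB h𝔟
  let O := Localization.AtPrime 𝔟
  have hunit : ∀ y : 𝔟.primeCompl, IsUnit (algebraMap B K y) := by
    intro y
    refine isUnit_iff_ne_zero.2 fun h => y.2 ?_
    rw [(map_eq_zero_iff _ (IsFractionRing.injective B K)).1 h]
    exact 𝔟.zero_mem
  let : Algebra O K := (IsLocalization.lift hunit : O →+* K).toAlgebra
  have : IsScalarTower B O K := .of_algebraMap_eq fun x => (IsLocalization.lift_eq hunit x).symm
  have : IsScalarTower k O K := .of_algebraMap_eq fun x => by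
    rw [IsScalarTower.algebraMap_apply k B K, IsScalarTower.algebraMap_apply k B O,
      ← IsScalarTower.algebraMap_apply B O K]
  have : IsFractionRing O K := 
    IsFractionRing.isFractionRing_of_isDomain_of_isLocalization 𝔟.primeCompl O K
  have : Algebra.EssFiniteType B O := Algebra.EssFiniteType.of_isLocalization _ 𝔟.primeCompl
  have : Algebra.EssFiniteType k O := Algebra.EssFiniteType.comp k B O
  let toB : A → B := fun x => ⟨algebraMap A K x, hAB' x⟩
  have htoB : ∀ x : A, algebraMap O K (algebraMap B O (toB x)) = algebraMap A K x := fun x =>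
    (IsScalarTower.algebraMap_apply B O K _).symm
  have hres : AlgebraicIndependent k
      fun i => IsLocalRing.residue O (algebraMap B O (toB (f i))) := by
    rw [algebraicIndependent_iff]
    intro P hP
    refine (algebraicIndependent_iff.1 hf) P ?_
    let φ : B →ₐ[k] IsLocalRing.ResidueField O :=
      (Algebra.algHom k O (IsLocalRing.ResidueField O)).comp (Algebra.algHom k B O)
    have h1 : φ (aeval (fun i => toB (f i)) P) = 0 := by
      rw [← AlgHom.comp_apply, comp_aeval]; exact hP
    have h2 : aeval (fun i => toB (f i)) P ∈ 𝔟 := by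
      have : algebraMap B O (aeval (fun i => toB (f i)) P) ∈ IsLocalRing.maximalIdeal O :=
        (IsLocalRing.residue_eq_zero_iff _).1 h1
      exact (IsLocalization.AtPrime.to_map_mem_maximal_iff O 𝔟 _).1 this
    have h3 := (h𝔮B _).1 (h𝔟q h2)
    have h4 : ((aeval (fun i => toB (f i)) P : B) : K) = algebraMap A K (aeval f P) := by
      have e1 : ((aeval (fun i => toB (f i)) P : B) : K) = B.val (aeval (fun i => toB (f i)) P) := rfl
      have e2 : algebraMap A K (aeval f P) = Algebra.algHom k A K (aeval f P) := rfl
      rw [e1, e2, ← AlgHom.comp_apply, ← AlgHom.comp_apply, comp_aeval, comp_aeval]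
      rfl
    rw [h4, hVq] at h3
    have h5 : aeval (fun i => Ideal.Quotient.mk 𝔮 (f i)) P = Ideal.Quotient.mkₐ k 𝔮 (aeval f P) := by
      rw [← AlgHom.comp_apply, comp_aeval]; rfl
    rw [h5]
    exact Ideal.Quotient.eq_zero_iff_mem.2 h3
  obtain ⟨D, hDf, hD⟩ := IsDiscreteValuationRing.exists_log_derivation (K := K) _ hres c
  refine ⟨D, (algebraMap O K).range,
    (IsLocalRing.maximalIdeal O).toAddSubgroup.map (algebraMap O K).toAddMonoidHom, ?_, ?_, ?_, ?_,
    ?_, ?_⟩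
  · intro i
    rw [← hDf, htoB]
  · exact fun x => ⟨_, htoB x⟩
  · intro b hb
    refine ⟨algebraMap B O (toB b), ?_, htoB b⟩
    have hq : algebraMap A K b / algebraMap A K a ∈ B := 
      hAB ⟨_, Algebra.subset_adjoin (by
        rw [Finset.coe_image]; exact ⟨b, hb, rfl⟩)⟩
    have : toB b = aB * ⟨_, hq⟩ := Subtype.ext (by
      change algebraMap A K b = algebraMap A K a * (algebraMap A K b / algebraMap A K a)
      field_simp)
    refine (IsLocalization.AtPrime.to_map_mem_maximal_iff O 𝔟 _).2 ?_
    rw [this]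
    exact 𝔟.mul_mem_right _ haB𝔟
  · rintro _ ⟨x, rfl⟩ _ ⟨y, hy, rfl⟩
    exact ⟨x * y, Ideal.mul_mem_left _ x hy, map_mul (algebraMap O K) _ _⟩
  · rintro ⟨x, hx, h1⟩
    have : x = 1 := IsFractionRing.injective O K (by rw [map_one]; exact h1)
    subst this
    exact (Ideal.ne_top_iff_one _).1 (IsLocalRing.maximalIdeal.isMaximal O).ne_top hx
  · rintro _ ⟨x, rfl⟩
    obtain ⟨y, hy⟩ := hD x
    exact ⟨algebraMap O K y, ⟨y, rfl⟩, by rw [hy, map_mul]⟩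

/-- The transcendence degree as a natural number. -/
noncomputable def trd (k A : Type*) [CommRing k] [CommRing A] [Algebra k A] : ℕ :=
  (Algebra.trdeg k A).toNat

theorem AlgebraicIndependent.card_le_trd {k A ι : Type*} [Field k] [CommRing A] [Algebra k A]
    [Algebra.FiniteType k A] [Finite ι] {x : ι → A} (hx : AlgebraicIndependent k x) :
    Nat.card ι ≤ trd k A := by
  have h := Cardinal.toNat_le_toNat hx.lift_cardinalMk_le_trdeg
    (by simpa using trdeg_lt_aleph0_of_finiteType)
  simpa [trd, Nat.card] using h

theorem IsTranscendenceBasis.card_eq_trd {k A ι : Type*} [Field k] [CommRing A] [IsDomain A]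
    [Algebra k A] {x : ι → A} (hx : IsTranscendenceBasis k x) : Nat.card ι = trd k A := by
  have h := congrArg Cardinal.toNat hx.lift_cardinalMk_eq_trdeg
  simpa [trd, Nat.card] using h

/-- There is a transcendence basis indexed by `Fin (trd k A)`. -/
theorem exists_isTranscendenceBasis_fin (k A : Type*) [Field k] [CommRing A] [IsDomain A]
    [Algebra k A] [Algebra.FiniteType k A] :
    ∃ x : Fin (trd k A) → A, IsTranscendenceBasis k x := by
  obtain ⟨s, hs⟩ := exists_isTranscendenceBasis k A
  have h1 := hs.lift_cardinalMk_eq_trdeg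
  have hfin : Finite s := by
    rw [← Cardinal.lt_aleph0_iff_finite, ← Cardinal.lift_lt_aleph0, h1, Cardinal.lift_lt_aleph0]
    exact trdeg_lt_aleph0_of_finiteType
  have e : Fin (trd k A) ≃ s := by
    rw [← hs.card_eq_trd]; exact (Finite.equivFin s).symm
  exact ⟨_, hs.comp_equiv e⟩

theorem trd_le_of_injective {k A B : Type*} [Field k] [CommRing A] [IsDomain A] [Algebra k A]
    [Algebra.FiniteType k A] [CommRing B] [Algebra k B] [Algebra.FiniteType k B]
    (φ : A →ₐ[k] B) (hφ : Function.Injective φ) : trd k A ≤ trd k B := by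
  obtain ⟨x, hx⟩ := exists_isTranscendenceBasis_fin k A
  simpa using (hx.1.map' hφ).card_le_trd

theorem trd_lt_of_surjective {k A B : Type*} [Field k] [CommRing A] [IsDomain A] [Algebra k A]
    [Algebra.FiniteType k A] [CommRing B] [IsDomain B] [Algebra k B]
    (φ : A →ₐ[k] B) (hφ : Function.Surjective φ) {t : A} (ht0 : t ≠ 0) (ht : φ t = 0) :
    trd k B < trd k A := by
  have : Algebra.FiniteType k B := .of_surjective φ hφ
  obtain ⟨x, hx⟩ := exists_isTranscendenceBasis_fin k B
  choose b hb using fun i => hφ (x i)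
  have := (AlgebraicIndependent.option_of_map_eq_zero φ ht0 ht (b := b)
    (by simp_rw [hb]; exact hx.1)).card_le_trd
  simpa using this

theorem MvPolynomial.trd_eq (k ι : Type*) [Field k] [Finite ι] :
    trd k (MvPolynomial ι k) = Nat.card ι := by
  rw [trd, trdeg_of_isDomain]; simp [Nat.card]

/-- Modulo a nonzero principal prime ideal of a polynomial ring the transcendence degree drops by at
most one. -/
theorem MvPolynomial.card_le_trd_quotient_add_one {k ι : Type*} [Field k] [Finite ι]
    {g : MvPolynomial ι k} [hp : (Ideal.span {g}).IsPrime] :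
    Nat.card ι ≤ trd k (MvPolynomial ι k ⧸ Ideal.span {g}) + 1 := by
  classical
  by_cases hg0 : g = 0
  · refine le_trans ?_ (Nat.le_succ _)
    have := MvPolynomial.algebraicIndependent_X ι k
    refine AlgebraicIndependent.card_le_trd (x := fun i => Ideal.Quotient.mkₐ k (Ideal.span {g}) (X i)) 
      (this.map' ?_)
    intro x y hxy
    have := Ideal.Quotient.eq.1 hxy
    rw [hg0, Ideal.mem_span_singleton, zero_dvd_iff, sub_eq_zero] at this
    exact this
  obtain ⟨i, hi⟩ : ∃ i, g.degreeOf i ≠ 0 := by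
    by_contra! hcon
    have h0 : g.totalDegree = 0 := by
      rw [totalDegree_eq_zero_iff]
      intro m hm x
      have := monomial_le_degreeOf x hm
      rw [hcon x] at this
      omega
    rw [totalDegree_eq_zero_iff_eq_C] at h0
    have hc : g.coeff 0 ≠ 0 := fun h => hg0 (by rw [h0, h, map_zero])
    apply hp.ne_top
    rw [Ideal.span_singleton_eq_top, h0]
    exact (isUnit_iff_ne_zero.2 hc).map C
  have hind : AlgebraicIndependent k
      fun j : {j // j ≠ i} => Ideal.Quotient.mkₐ k (Ideal.span {g}) (X (j : ι)) := by
    rw [algebraicIndependent_iff]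
    intro Q hQ
    have h1 : aeval (fun j : {j // j ≠ i} => Ideal.Quotient.mkₐ k (Ideal.span {g}) (X (j : ι))) Q
        = Ideal.Quotient.mkₐ k (Ideal.span {g}) (rename ((↑) : {j // j ≠ i} → ι) Q) := by
      rw [rename_eq_aeval, ← AlgHom.comp_apply, comp_aeval]; rfl
    rw [h1] at hQ
    have h2 := Ideal.Quotient.eq_zero_iff_mem.1 hQ
    obtain ⟨q, hq⟩ := Ideal.mem_span_singleton.1 h2
    by_contra hQ0
    have hr0 : rename ((↑) : {j // j ≠ i} → ι) Q ≠ 0 := fun h => 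
      hQ0 (rename_injective _ Subtype.val_injective (by rw [h, map_zero]))
    have hq0 : q ≠ 0 := by rintro rfl; simp at hq; exact hQ0 hq
    have hd := congrArg (degreeOf i) hq
    rw [degreeOf_mul_eq hg0 hq0] at hd
    have : degreeOf i (rename ((↑) : {j // j ≠ i} → ι) Q) = 0 := by
      by_contra hv
      rw [← ne_eq, ← mem_vars_iff_degreeOf_ne_zero] at hv
      obtain ⟨j, -, hj⟩ := Finset.mem_image.1 (vars_rename _ _ hv)
      exact j.2 hj
    omega
  have := hind.card_le_trd
  have h3 : Nat.card ι = Nat.card {j // j ≠ i} + 1 := by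
    have : Fintype ι := Fintype.ofFinite ι
    rw [Nat.card_eq_fintype_card, Nat.card_eq_fintype_card, Fintype.card_subtype_compl]
    have : 0 < Fintype.card ι := Fintype.card_pos_iff.2 ⟨i⟩
    simp; omega
  omega

/-- Krull's principal ideal theorem in terms of transcendence degrees. -/
theorem trd_le_of_ker_mem_minimalPrimes {k A B : Type*} [Field k] [CommRing A] [IsDomain A]
    [Algebra k A] [Algebra.FiniteType k A] [CommRing B] [IsDomain B] [Algebra k B]
    (φ : A →ₐ[k] B) (hφ : Function.Surjective φ) (a : A)
    (h : RingHom.ker φ ∈ (Ideal.span {a}).minimalPrimes) : trd k A ≤ trd k B + 1 := by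
  have : Algebra.FiniteType k B := .of_surjective φ hφ
  have : IsNoetherianRing A := Algebra.FiniteType.isNoetherianRing k A
  obtain ⟨n, g, hgi, hgf⟩ := exists_finite_inj_algHom_of_fg k A
  let R := MvPolynomial (Fin n) k
  let : Algebra R A := g.toRingHom.toAlgebra
  have hg : ∀ P, algebraMap R A P = g P := fun _ => rfl
  have : IsScalarTower k R A := .of_algebraMap_eq fun r => by rw [hg]; simp [R]
  have : Module.Finite R A := hgf
  have : FaithfulSMul R A := (faithfulSMul_iff_algebraMap_injective R A).2 hgi
  have htA : trd k A = n := by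
    have h1 := lift_trdeg_add_eq k R A
    rw [trdeg_eq_zero (R := R) (A := A)] at h1
    have h2 := congrArg Cardinal.toNat h1
    have h3 : Cardinal.toNat (Algebra.trdeg k R) = Nat.card (Fin n) := MvPolynomial.trd_eq k (Fin n)
    simp only [Cardinal.lift_zero, add_zero, Cardinal.toNat_lift] at h2
    rw [trd, ← h2, h3]
    simp
  have : (RingHom.ker φ).IsPrime := h.1.1
  let P : Ideal R := (RingHom.ker φ).comap (algebraMap R A)
  have : (RingHom.ker φ).LiesOver P := ⟨rfl⟩
  have hP1 : P.height ≤ 1 := by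
    have h1 := Ideal.height_eq_height_add_of_liesOver_of_hasGoingDown P (RingHom.ker φ)
    have h2 := Ideal.height_le_one_of_isPrincipal_of_mem_minimalPrimes _ _ h
    rw [h1] at h2
    exact le_self_add.trans h2
  obtain ⟨q, hq⟩ : ∃ q, P = Ideal.span {q} := by
    rcases hP1.lt_or_eq with h0 | h1
    · rw [Order.lt_one_iff, Ideal.height_eq_zero_iff_eq_bot] at h0
      exact ⟨0, by rw [h0]; simp⟩
    · exact (UniqueFactorizationMonoid.isPrincipal_of_height_eq_one h1).principal
  have hPp : P.IsPrime := inferInstance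
  rw [hq] at hPp
  have h4 := MvPolynomial.card_le_trd_quotient_add_one (g := q)
  rw [Nat.card_eq_fintype_card, Fintype.card_fin] at h4
  rw [htA]
  refine h4.trans (Nat.add_le_add_right ?_ 1)
  have hker : ∀ r ∈ Ideal.span {q}, (φ.comp g) r = 0 := fun r hr => by
    rw [← hq] at hr; exact hr
  refine trd_le_of_injective (Ideal.Quotient.liftₐ (Ideal.span {q}) (φ.comp g) hker) ?_
  rw [injective_iff_map_eq_zero]
  intro x hx
  obtain ⟨r, rfl⟩ := Ideal.Quotient.mk_surjective x
  have hx' : φ (g r) = 0 := hx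
  rw [Ideal.Quotient.eq_zero_iff_mem, ← hq]
  exact hx'

theorem trd_quotient_lt {k A : Type*} [Field k] [CommRing A] [Algebra k A]
    [Algebra.FiniteType k A] {𝔮 𝔮' : Ideal A} [𝔮.IsPrime] [𝔮'.IsPrime] (h : 𝔮 < 𝔮') :
    trd k (A ⧸ 𝔮') < trd k (A ⧸ 𝔮) := by
  obtain ⟨a, ha, ha'⟩ := SetLike.exists_of_lt h
  refine trd_lt_of_surjective (Ideal.Quotient.factorₐ k h.le)
    (Ideal.Quotient.factor_surjective h.le) (t := Ideal.Quotient.mk 𝔮 a) ?_ ?_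
  · rwa [ne_eq, Ideal.Quotient.eq_zero_iff_mem]
  · exact Ideal.Quotient.eq_zero_iff_mem.2 ha

theorem trd_quotient_le {k A : Type*} [Field k] [CommRing A] [Algebra k A]
    [Algebra.FiniteType k A] {𝔮 𝔮' : Ideal A} [𝔮.IsPrime] [𝔮'.IsPrime] (h : 𝔮 ≤ 𝔮') :
    trd k (A ⧸ 𝔮') ≤ trd k (A ⧸ 𝔮) := by
  rcases h.eq_or_lt with rfl | h
  · exact le_rfl
  · exact (trd_quotient_lt h).le

/-- Krull's height theorem in terms of transcendence degrees. -/
theorem trd_quotient_le_of_mem_minimalPrimes {k A : Type*} [Field k] [CommRing A] [Algebra k A]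
    [Algebra.FiniteType k A] (s : Finset A) (𝔮 𝔮' : Ideal A) [𝔮.IsPrime] [𝔮'.IsPrime]
    (h : 𝔮' ∈ (𝔮 ⊔ Ideal.span (s : Set A)).minimalPrimes) :
    trd k (A ⧸ 𝔮) ≤ trd k (A ⧸ 𝔮') + s.card := by
  classical
  induction s using Finset.induction_on generalizing 𝔮 with
  | empty =>
      have h2 : 𝔮' ≤ 𝔮 := h.2 ⟨inferInstance, by simp⟩ (le_sup_left.trans h.1.2)
      exact trd_quotient_le h2
  | insert a s ha ih =>
    rw [Finset.coe_insert, Ideal.span_insert, ← sup_assoc] at h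
    obtain ⟨𝔮₁, h1, h1'⟩ := Ideal.exists_minimalPrimes_le (le_sup_left.trans h.1.2)
    have : 𝔮₁.IsPrime := h1.1.1
    have h2 := ih 𝔮₁ ⟨⟨inferInstance, sup_le h1' (le_sup_right.trans h.1.2)⟩, fun J hJ hJ' =>
      h.2 ⟨hJ.1, sup_le (h1.1.2.trans (le_sup_left.trans hJ.2)) (le_sup_right.trans hJ.2)⟩ hJ'⟩
    have h3 : 𝔮 ≤ 𝔮₁ := le_sup_left.trans h1.1.2
    have h4 : trd k (A ⧸ 𝔮) ≤ trd k (A ⧸ 𝔮₁) + 1 := by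
      refine trd_le_of_ker_mem_minimalPrimes (Ideal.Quotient.factorₐ k h3)
        (Ideal.Quotient.factor_surjective h3) (Ideal.Quotient.mk 𝔮 a) ?_
      refine ⟨⟨RingHom.ker_isPrime _, ?_⟩, fun J hJ hJ' => ?_⟩
      · rw [Ideal.span_singleton_le_iff_mem]
        exact Ideal.Quotient.eq_zero_iff_mem.2 (h1.1.2 (Ideal.mem_sup_right
          (Ideal.mem_span_singleton_self a)))
      · have h5 : ∀ b, Ideal.Quotient.mk 𝔮 b ∈ J → b ∈ 𝔮₁ := fun b hb =>
          Ideal.Quotient.eq_zero_iff_mem.1 (hJ' hb)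
        have : J.IsPrime := hJ.1
        have h6 : 𝔮₁ ≤ J.comap (Ideal.Quotient.mk 𝔮) := by
          refine h1.2 ⟨inferInstance, sup_le ?_ ?_⟩ h5
          · intro b hb
            rw [Ideal.mem_comap, Ideal.Quotient.eq_zero_iff_mem.2 hb]
            exact J.zero_mem
          · rw [Ideal.span_singleton_le_iff_mem]
            exact hJ.2 (Ideal.mem_span_singleton_self _)
        intro b hb
        obtain ⟨b, rfl⟩ := Ideal.Quotient.mk_surjective b
        exact h6 (Ideal.Quotient.eq_zero_iff_mem.1 hb)
    rw [Finset.card_insert_of_notMem ha]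
    omega

/-- The exponent vectors of total degree at most `M`. -/
def expBox (σ : Type*) [Fintype σ] [DecidableEq σ] (M : ℕ) : Finset (σ → ℕ) :=
  (Fintype.piFinset fun _ : σ => Finset.range (M + 1)).filter fun β => ∑ i, β i ≤ M

theorem mem_expBox {σ : Type*} [Fintype σ] [DecidableEq σ] {M : ℕ} {β : σ → ℕ} :
    β ∈ expBox σ M ↔ ∑ i, β i ≤ M := by
  simp only [expBox, Finset.mem_filter, Fintype.mem_piFinset, Finset.mem_range,
    and_iff_right_iff_imp]
  exact fun h i => Nat.lt_succ_of_le ((Finset.single_le_sum (fun _ _ => Nat.zero_le _)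
    (Finset.mem_univ i)).trans h)

theorem card_expBox_le {σ : Type*} [Fintype σ] [DecidableEq σ] (M : ℕ) :
    (expBox σ M).card ≤ (M + 1) ^ Fintype.card σ := by
  refine (Finset.card_filter_le _ _).trans ?_
  simp

theorem exists_card_expBox_add_mul_lt (σ : Type*) [Fintype σ] [DecidableEq σ] (D s : ℕ) :
    ∃ M, D * (expBox σ (M + s)).card < (D + 1) * (expBox σ M).card := by
  by_contra! hcon
  have hpos : 0 < (expBox σ 0).card := Finset.card_pos.2 ⟨0, mem_expBox.2 (by simp)⟩
  rcases Nat.eq_zero_or_pos D with rfl | hD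
  · have := hcon 0; omega
  have hDR : (0 : ℝ) < D := by exact_mod_cast hD
  let r : ℝ := (D + 1) / D
  have hr : 1 < r := by
    rw [lt_div_iff₀ hDR]; linarith
  have h1 : ∀ j : ℕ, r ^ j ≤ (expBox σ (j * s)).card := by
    intro j
    induction j with
    | zero => simpa [Nat.one_le_iff_ne_zero] using hpos.ne'
    | succ j ih =>
      have h2 : ((D : ℝ) + 1) * (expBox σ (j * s)).card ≤ D * (expBox σ (j * s + s)).card := by
        exact_mod_cast hcon (j * s)
      rw [Nat.succ_mul, pow_succ]
      calc r ^ j * r ≤ (expBox σ (j * s)).card * r := by gcongr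
        _ = ((D : ℝ) + 1) * (expBox σ (j * s)).card / D := by simp only [r]; ring
        _ ≤ _ := by rw [div_le_iff₀ hDR]; linarith
  let n := Fintype.card σ
  have h2 : ∀ j : ℕ, 1 ≤ j → r ^ j ≤ ((s + 1) ^ n : ℝ) * (j : ℝ) ^ n := by
    intro j hj
    refine (h1 j).trans ?_
    rw [← mul_pow]
    have h3 : (expBox σ (j * s)).card ≤ (j * s + 1) ^ n := card_expBox_le _
    have h4 : j * s + 1 ≤ (s + 1) * j := by nlinarith
    exact_mod_cast h3.trans (Nat.pow_le_pow_left h4 n)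
  have h3 := (tendsto_pow_const_div_const_pow_of_one_lt n hr).const_mul ((s + 1) ^ n : ℝ)
  rw [mul_zero] at h3
  obtain ⟨j, hj1, hj2⟩ := ((h3.eventually_lt_const one_pos).and (eventually_ge_atTop 1)).exists
  have h4 := h2 j hj2
  have h5 : 0 < r ^ j := by positivity
  rw [← mul_div_assoc, div_lt_one h5] at hj1
  linarith

/-- The exponent vectors of weighted degree at most `M`. -/
def weightedBox {σ : Type*} [Fintype σ] [DecidableEq σ] (w : σ → ℕ) (M : ℕ) : Finset (σ → ℕ) :=
  (expBox σ M).filter fun α => ∑ i, w i * α i ≤ M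

theorem card_expBox_le_mul_card_weightedBox {σ : Type*} [Fintype σ] [DecidableEq σ] (w : σ → ℕ)
    (hw : ∀ i, 1 ≤ w i) (M : ℕ) :
    (expBox σ M).card ≤ (∏ i, w i) * (weightedBox w M).card := by
  have h : (expBox σ M).card ≤
      ((Fintype.piFinset fun i => Finset.range (w i)) ×ˢ weightedBox w M).card := by
    refine Finset.card_le_card_of_injOn (fun β => (fun i => β i % w i, fun i => β i / w i)) ?_ ?_
    · intro β hβ
      have hβ' := mem_expBox.1 hβ
      simp only [Finset.coe_product, Set.mem_prod, Finset.mem_coe, Fintype.mem_piFinset,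
        Finset.mem_range, weightedBox, Finset.mem_filter, mem_expBox]
      refine ⟨fun i => Nat.mod_lt _ (hw i), ?_, ?_⟩
      · exact (Finset.sum_le_sum fun i _ => Nat.div_le_self _ _).trans hβ'
      · exact (Finset.sum_le_sum fun i _ => Nat.mul_div_le _ _).trans hβ'
    · intro β _ β' _ hb
      simp only [Prod.mk.injEq, funext_iff] at hb
      funext i
      rw [← Nat.div_add_mod (β i) (w i), hb.1 i, hb.2 i, Nat.div_add_mod]
  simpa using h

/-- A form of Perron's theorem: `n + 1` polynomials in `n` variables satisfy an algebraic relation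
whose degree in one of them is at most the product of the degrees of the others. -/
theorem exists_relation_le_prod {E σ : Type*} [Field E] [Fintype σ]
    (P : σ → MvPolynomial σ E) (w : σ → ℕ) (hw : ∀ i, 1 ≤ w i)
    (hP : ∀ i, (P i).totalDegree ≤ w i) (F : MvPolynomial σ E) :
    ∃ a : ((σ →₀ ℕ) × ℕ) →₀ E, a ≠ 0 ∧ (∀ m ∈ a.support, m.2 ≤ ∏ i, w i) ∧
      (a.sum fun m c => C c * (∏ i, P i ^ m.1 i) * F ^ m.2) = 0 := by
  classical
  set D := ∏ i, w i with hD
  let s := F.totalDegree * D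
  obtain ⟨M, hM⟩ := exists_card_expBox_add_mul_lt σ D s
  let I := (weightedBox w M) ×ˢ Finset.range (D + 1)
  let J := expBox σ (M + s)
  have hcard : J.card < I.card := by
    have h1 := card_expBox_le_mul_card_weightedBox w hw M
    rw [← hD] at h1
    have h2 : I.card = (weightedBox w M).card * (D + 1) := by simp [I]
    have hDpos : 0 < D := Finset.prod_pos fun i _ => hw i
    have h3 : D * J.card < D * I.card := by
      rw [h2]
      calc _ < _ := hM
        _ ≤ (D + 1) * (D * (weightedBox w M).card) := Nat.mul_le_mul_left _ h1
        _ = _ := by ring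
    exact Nat.lt_of_mul_lt_mul_left h3
  let v : (σ → ℕ) × ℕ → MvPolynomial σ E := fun m => (∏ i, P i ^ m.1 i) * F ^ m.2
  let Φ : (I → E) →ₗ[E] (J → E) :=
    LinearMap.pi fun β => (lcoeff E (Finsupp.equivFunOnFinite.symm (β : σ → ℕ))).comp
      (Fintype.linearCombination E fun m : I => v m)
  have hker : Φ.ker ≠ ⊥ := LinearMap.ker_ne_bot_of_finrank_lt (by simpa using hcard)
  obtain ⟨b, hb, hb0⟩ := Submodule.exists_mem_ne_zero_of_ne_bot hker
  have hdeg : ∀ m ∈ I, (v m).totalDegree ≤ M + s := by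
    intro m hm
    simp only [I, Finset.mem_product, Finset.mem_range, weightedBox, Finset.mem_filter] at hm
    refine (totalDegree_mul _ _).trans (add_le_add ?_ ?_)
    · refine (totalDegree_finsetProd _ _).trans (le_trans (Finset.sum_le_sum fun i _ => ?_) hm.1.2)
      refine (totalDegree_pow _ _).trans ?_
      rw [mul_comm]
      exact Nat.mul_le_mul_right _ (hP i)
    · refine (totalDegree_pow _ _).trans ?_
      rw [mul_comm]
      exact Nat.mul_le_mul_left _ (by omega)
  have hsum : ∑ m : I, b m • v m = 0 := by
    ext β
    by_cases hβ : (β : σ → ℕ) ∈ J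
    · have := congrFun (LinearMap.mem_ker.1 hb) ⟨β, hβ⟩
      simpa [Φ, Fintype.linearCombination_apply, coeff_sum] using this
    · rw [coeff_zero]
      by_contra hne
      apply hβ
      rw [mem_expBox, ← Finsupp.degree_eq_sum]
      refine (le_totalDegree (mem_support_iff.2 hne)).trans ?_
      refine totalDegree_finsetSum_le fun m _ => (totalDegree_smul_le _ _).trans (hdeg m m.2)
  let e : I ↪ (σ →₀ ℕ) × ℕ :=
    ⟨fun m => (Finsupp.equivFunOnFinite.symm m.1.1, m.1.2), fun m m' h => by
      simp only [Prod.mk.injEq, EmbeddingLike.apply_eq_iff_eq] at h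
      exact Subtype.ext (Prod.ext h.1 h.2)⟩
  refine ⟨(Finsupp.equivFunOnFinite.symm b).embDomain e, ?_, ?_, ?_⟩
  · rw [ne_eq, Finsupp.embDomain_eq_zero]
    exact fun h => hb0 (funext fun i => DFunLike.congr_fun h i)
  · intro m hm
    rw [Finsupp.support_embDomain, Finset.mem_map] at hm
    obtain ⟨m, -, rfl⟩ := hm
    have := m.2
    simp only [I, Finset.mem_product, Finset.mem_range] at this
    exact Nat.lt_succ_iff.1 this.2
  · rw [Finsupp.sum_embDomain, Finsupp.sum_fintype _ _ (by simp), ← hsum]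
    refine Finset.sum_congr rfl fun m _ => ?_
    simp only [v, smul_eq_C_mul, mul_assoc]
    rfl

theorem MvPolynomial.coeff_one_aeval_line {E K σ : Type*} [Field E] [Field K] [Algebra E K]
    [Fintype σ] (x ξ : σ → K) (P : MvPolynomial σ E) :
    (aeval (fun j => Polynomial.C (x j) + Polynomial.X * Polynomial.C (ξ j)) P).coeff 0 =
      aeval x P ∧
    (aeval (fun j => Polynomial.C (x j) + Polynomial.X * Polynomial.C (ξ j)) P).coeff 1 =
      ∑ j, aeval x (pderiv j P) * ξ j := by
  classical
  induction P using MvPolynomial.induction_on with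
  | C a =>
    simp [Polynomial.algebraMap_apply, Polynomial.coeff_C]
  | add p q hp hq =>
    simp only [map_add, Polynomial.coeff_add, hp.1, hp.2, hq.1, hq.2, add_mul,
      Finset.sum_add_distrib, and_self]
  | mul_X p i hp =>
    constructor
    · rw [map_mul, Polynomial.mul_coeff_zero, hp.1]
      simp
    · rw [map_mul, aeval_X, mul_add, Polynomial.coeff_add, Polynomial.coeff_mul_C, hp.2,
        mul_left_comm, Polynomial.coeff_X_mul, Polynomial.coeff_mul_C, hp.1]
      have h : ∀ j, aeval x (pderiv j (p * X i)) * ξ j =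
          x i * (aeval x (pderiv j p) * ξ j) + if j = i then ξ i * aeval x p else 0 := by
        intro j
        rw [Derivation.leibniz, pderiv_X]
        rcases eq_or_ne j i with rfl | hji
        · simp; ring
        · simp [hji, hji.symm]; ring
      simp only [h, Finset.sum_add_distrib, ← Finset.mul_sum, Finset.sum_ite_eq',
        Finset.mem_univ, if_true]
      ring

/-- The lowest order part of a polynomial relation along a curve is a relation. -/
theorem MvPolynomial.coeff_zero_eval₂_homogeneousComponent {S K α : Type*} [CommRing S]
    [CommRing K] (H : MvPolynomial α S) (φ : S →+* Polynomial K) (g : α → Polynomial K)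
    (hH : eval₂ φ (fun l => Polynomial.X * g l) H = 0) (m₀ : ℕ)
    (hm : ∀ m < m₀, homogeneousComponent m H = 0) :
    (eval₂ φ g (homogeneousComponent m₀ H)).coeff 0 = 0 := by
  have h1 : ∀ m, eval₂ φ (fun l => Polynomial.X * g l) (homogeneousComponent m H) =
      Polynomial.X ^ m * eval₂ φ g (homogeneousComponent m H) := by
    intro m
    rw [eval₂_eq, eval₂_eq, Finset.mul_sum]
    refine Finset.sum_congr rfl fun s hs => ?_
    have hs' := homogeneousComponent_isHomogeneous m H (mem_support_iff.1 hs)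
    rw [Finsupp.weight_apply, Finsupp.sum] at hs'
    simp only [Pi.one_apply, smul_eq_mul, mul_one] at hs'
    simp_rw [mul_pow]
    rw [Finset.prod_mul_distrib, Finset.prod_pow_eq_pow_sum, hs']
    ring
  by_cases hlt : m₀ ≤ H.totalDegree
  · rw [← sum_homogeneousComponent H, eval₂_sum] at hH
    have h2 := congrArg (Polynomial.coeff · m₀) hH
    simp only [Polynomial.finsetSum_coeff, Polynomial.coeff_zero] at h2
    rw [Finset.sum_eq_single_of_mem m₀ (Finset.mem_range.2 (by omega))] at h2
    · simpa [h1, Polynomial.coeff_X_pow_mul'] using h2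
    · intro m _ hne
      rw [h1, Polynomial.coeff_X_pow_mul']
      split_ifs with hle
      · rw [hm m (by omega)]; simp
      · rfl
  · rw [homogeneousComponent_eq_zero _ _ (by omega)]
    simp

theorem exists_relation_of_jacobian {E K σ α β : Type*} [Field E] [Infinite E] [Field K]
    [Algebra E K] [Fintype σ] [Fintype α] [Fintype β] (e : σ ≃ α ⊕ β) (x : σ → K)
    (G : α → MvPolynomial σ E) (w : α → ℕ) (hw : ∀ l, 1 ≤ w l)
    (hG : ∀ l, (G l).totalDegree ≤ w l) (hGx : ∀ l, aeval x (G l) = 0)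
    (hJ : ∀ ζ : α → K, ∃ ξ : σ → K, ∀ l, ∑ j, aeval x (pderiv j (G l)) * ξ j = ζ l)
    (F : β → MvPolynomial σ E) (d : ℕ) (hd : 1 ≤ d) (hF : ∀ b, (F b).totalDegree ≤ d)
    (F₀ : MvPolynomial σ E) :
    ∃ Q : Polynomial (MvPolynomial β E), Q ≠ 0 ∧
      Q.natDegree ≤ (∏ l, w l) * d ^ Fintype.card β ∧
      Q.eval₂ (aeval fun b => aeval x (F b) : MvPolynomial β E →ₐ[E] K).toRingHom
        (aeval x F₀) = 0 := by
  classical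
  obtain ⟨a, ha0, haD, ha⟩ := exists_relation_le_prod (fun i => Sum.elim G F (e i))
    (fun i => Sum.elim w (fun _ => d) (e i))
    (fun i => by rcases e i with l | b; exacts [hw l, hd])
    (fun i => by rcases e i with l | b; exacts [hG l, hF b]) F₀
  have hD : ∏ i, Sum.elim w (fun _ => d) (e i) = (∏ l, w l) * d ^ Fintype.card β := by
    rw [Equiv.prod_comp e (Sum.elim w (fun _ => d)), Fintype.prod_sum_type]
    simp
  rw [hD] at haD
  let θ : (σ →₀ ℕ) ≃ (α →₀ ℕ) × (β →₀ ℕ) :=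
    (Finsupp.domCongr e).toEquiv.trans Finsupp.sumFinsuppEquivProdFinsupp
  have hθ1 : ∀ u l, (θ u).1 l = u (e.symm (Sum.inl l)) := fun u l => rfl
  have hθ2 : ∀ u l, (θ u).2 l = u (e.symm (Sum.inr l)) := fun u l => rfl
  let H : MvPolynomial α (Polynomial (MvPolynomial β E)) := a.sum fun m c =>
    monomial (θ m.1).1 (Polynomial.monomial m.2 (monomial (θ m.1).2 c))
  have hcoeff : ∀ u v k, ((H.coeff u).coeff k).coeff v = a (θ.symm (u, v), k) := by
    intro u v k
    simp only [H, Finsupp.sum, coeff_sum, Polynomial.finsetSum_coeff]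
    rw [Finset.sum_eq_single (θ.symm (u, v), k)]
    · simp
    · intro m hm hne
      rw [coeff_monomial]
      split_ifs with h1
      · rw [Polynomial.coeff_monomial]
        split_ifs with h2
        · rw [coeff_monomial, if_neg]
          intro h3
          apply hne
          refine Prod.ext ?_ h2
          rw [Equiv.eq_symm_apply]
          exact Prod.ext h1 h3
        · simp
      · simp
    · intro hm
      simp [Finsupp.notMem_support_iff.1 hm]
  have hH0 : H ≠ 0 := by
    intro h
    apply ha0
    ext ⟨u, k⟩
    have := hcoeff (θ u).1 (θ u).2 k
    rw [h] at this
    simpa using this.symm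
  have hHdeg : ∀ u, (H.coeff u).natDegree ≤ (∏ l, w l) * d ^ Fintype.card β := by
    intro u
    rw [Polynomial.natDegree_le_iff_coeff_eq_zero]
    intro k hk
    ext v
    rw [hcoeff, coeff_zero]
    by_contra hne
    have := haD _ (Finsupp.mem_support_iff.2 hne)
    simp only at this
    omega
  have hex : ∃ m, homogeneousComponent m H ≠ 0 := by
    by_contra! h
    apply hH0
    rw [← sum_homogeneousComponent H]
    exact Finset.sum_eq_zero fun m _ => h m
  let m₀ := Nat.find hex
  have hm₀ : homogeneousComponent m₀ H ≠ 0 := Nat.find_spec hex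
  have hlt : ∀ m < m₀, homogeneousComponent m H = 0 := fun m hm => by
    simpa using Nat.find_min hex hm
  obtain ⟨z, hz, hz0⟩ : ∃ z ∈ Set.univ.pi fun _ : α =>
      Set.range (algebraMap E (Polynomial (MvPolynomial β E))),
      eval z (homogeneousComponent m₀ H) ≠ 0 := by
    by_contra! hcon
    exact hm₀ (MvPolynomial.funext_set _
      (fun _ => Set.infinite_range_of_injective (algebraMap E _).injective)
      (fun z hz => by rw [hcon z hz, map_zero]))
  choose ζ hζ using fun l => hz l (Set.mem_univ l)
  obtain ⟨ξ, hξ⟩ := hJ fun l => algebraMap E K (ζ l)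
  let ev : MvPolynomial σ E →ₐ[E] Polynomial K :=
    aeval (fun j => Polynomial.C (x j) + Polynomial.X * Polynomial.C (ξ j))
  have hg : ∀ l, ∃ g : Polynomial K, ev (G l) = Polynomial.X * g := fun l =>
    Polynomial.X_dvd_iff.2 ((coeff_one_aeval_line x ξ (G l)).1.trans (hGx l))
  choose g hg using hg
  have hg0 : ∀ l, (g l).coeff 0 = algebraMap E K (ζ l) := fun l => by
    rw [← hξ l, ← (coeff_one_aeval_line x ξ (G l)).2]
    change _ = (ev (G l)).coeff 1
    rw [hg, Polynomial.coeff_X_mul]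
  let φ : Polynomial (MvPolynomial β E) →+* Polynomial K := Polynomial.eval₂RingHom
    (aeval fun b => ev (F b) : MvPolynomial β E →ₐ[E] Polynomial K).toRingHom (ev F₀)
  have hφH : eval₂ φ (fun l => Polynomial.X * g l) H = 0 := by
    have h1 := congrArg ev ha
    rw [map_zero, Finsupp.sum, map_sum] at h1
    rw [← h1]
    simp only [H, Finsupp.sum, eval₂_sum]
    refine Finset.sum_congr rfl fun m _ => ?_
    rw [eval₂_monomial, Finsupp.prod_fintype _ _ (by simp), map_mul, map_mul, map_prod]
    rw [← Equiv.prod_comp e.symm, Fintype.prod_sum_type]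
    simp only [φ, Polynomial.coe_eval₂RingHom, Polynomial.eval₂_monomial, AlgHom.toRingHom_eq_coe,
      RingHom.coe_coe, aeval_monomial, map_pow, Equiv.apply_symm_apply, Sum.elim_inl, Sum.elim_inr,
      algHom_C, hθ1, hg]
    rw [Finsupp.prod_fintype _ _ (by simp)]
    simp only [hθ2]
    ring
  have hfin := coeff_zero_eval₂_homogeneousComponent H φ g hφH m₀ hlt
  let φ₀ : Polynomial (MvPolynomial β E) →+* K := Polynomial.eval₂RingHom
    (aeval fun b => aeval x (F b) : MvPolynomial β E →ₐ[E] K).toRingHom (aeval x F₀)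
  have hφ₀ : Polynomial.constantCoeff.comp φ = φ₀ := by
    refine Polynomial.ringHom_ext' (MvPolynomial.ringHom_ext ?_ ?_) ?_
    · intro c
      simp [φ, φ₀]
    · intro b
      have h1 : φ (Polynomial.C (X b)) = ev (F b) := by simp [φ]
      have h2 : φ₀ (Polynomial.C (X b)) = aeval x (F b) := by simp [φ₀]
      change (φ (Polynomial.C (X b))).coeff 0 = φ₀ (Polynomial.C (X b))
      rw [h1, h2]
      exact (coeff_one_aeval_line x ξ _).1
    · have h1 : φ Polynomial.X = ev F₀ := by simp [φ]
      have h2 : φ₀ Polynomial.X = aeval x F₀ := by simp [φ₀]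
      change (φ Polynomial.X).coeff 0 = φ₀ Polynomial.X
      rw [h1, h2]
      exact (coeff_one_aeval_line x ξ _).1
  refine ⟨eval z (homogeneousComponent m₀ H), hz0, ?_, ?_⟩
  · rw [eval_eq]
    refine Polynomial.natDegree_sum_le_of_forall_le _ _ fun u _ => ?_
    refine Polynomial.natDegree_mul_le.trans ?_
    have h1 : (∏ i ∈ u.support, z i ^ u i).natDegree = 0 := by
      refine Nat.le_zero.1 ((Polynomial.natDegree_prod_le _ _).trans ?_)
      refine (Finset.sum_eq_zero fun i _ => ?_).le
      rw [← hζ i, ← map_pow]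
      exact Polynomial.natDegree_C _
    rw [h1, add_zero, coeff_homogeneousComponent]
    split_ifs
    · exact hHdeg u
    · simp
  · change φ₀ _ = 0
    rw [← hfin]
    change _ = Polynomial.constantCoeff (eval₂ φ g (homogeneousComponent m₀ H))
    rw [hom_eval₂, hφ₀, eval, coe_eval₂Hom, hom_eval₂]
    congr 1
    · funext l
      simp only [Polynomial.constantCoeff_apply, hg0, ← hζ]
      simp [φ₀, Polynomial.algebraMap_apply]

/-- The change of variables `T_b ↦ T_b + c_b T`. -/
noncomputable def shear {E β : Type*} [Field E] (c : β → E) :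
    MvPolynomial (Option β) E →ₐ[E] Polynomial (MvPolynomial β E) :=
  aeval fun o => o.elim Polynomial.X fun b =>
    Polynomial.C (X b) + Polynomial.C (C (c b)) * Polynomial.X

theorem natDegree_shear_monomial {E β : Type*} [Field E] [Fintype β] (c : β → E)
    (s : Option β →₀ ℕ) (a : E) :
    (shear c (monomial s a)).natDegree ≤ s.degree ∧
      (shear c (monomial s a)).coeff s.degree =
        C (eval (fun o => o.elim 1 c) (monomial s a)) := by
  have h1 : ∀ o : Option β, (shear c (X o)).natDegree ≤ 1 := by
    rintro (_ | b)
    · simp [shear]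
    · simp only [shear, aeval_X, Option.elim]
      refine (Polynomial.natDegree_add_le _ _).trans (max_le (by simp) ?_)
      exact (Polynomial.natDegree_mul_le).trans (by simp)
  have h2 : ∀ o : Option β, (shear c (X o)).coeff 1 = C ((o.elim 1 c : E)) := by
    rintro (_ | b)
    · simp [shear]
    · simp [shear, Polynomial.coeff_C]
  have h3 : ∀ (u : Finset (Option β)), (∏ o ∈ u, shear c (X o) ^ s o).natDegree ≤ ∑ o ∈ u, s o ∧
      (∏ o ∈ u, shear c (X o) ^ s o).coeff (∑ o ∈ u, s o) = C (∏ o ∈ u, (o.elim 1 c : E) ^ s o) := by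
    classical
    intro u
    induction u using Finset.induction_on with
    | empty => simp
    | insert o u ho ih =>
      have hp : (shear c (X o) ^ s o).natDegree ≤ s o := by
        simpa using Polynomial.natDegree_pow_le_of_le (s o) (h1 o)
      have hc : (shear c (X o) ^ s o).coeff (s o) = C ((o.elim 1 c : E) ^ s o) := by
        have := Polynomial.coeff_pow_of_natDegree_le (m := s o) (h1 o)
        rw [mul_one] at this
        rw [this, h2, map_pow]
      simp only [Finset.prod_insert ho, Finset.sum_insert ho]
      refine ⟨Polynomial.natDegree_mul_le.trans (add_le_add hp ih.1), ?_⟩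
      rw [Polynomial.coeff_mul_add_eq_of_natDegree_le hp ih.1, hc, ih.2, map_mul]
  have h4 : shear c (monomial s a) = Polynomial.C (C a) * ∏ o, shear c (X o) ^ s o := by
    rw [monomial_eq, map_mul, Finsupp.prod_fintype _ _ (by simp), map_prod, ← algebraMap_eq,
      AlgHom.commutes]
    simp only [map_pow]
    rfl
  have h5 := h3 Finset.univ
  rw [Finsupp.degree_eq_sum, h4, Polynomial.coeff_C_mul, h5.2, eval_monomial,
    Finsupp.prod_fintype _ _ (by simp), map_mul]
  exact ⟨(Polynomial.natDegree_C_mul_le _ _).trans h5.1, rfl⟩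

theorem natDegree_shear {E β : Type*} [Field E] [Fintype β] (c : β → E)
    (P : MvPolynomial (Option β) E) :
    (shear c P).natDegree ≤ P.totalDegree ∧ (shear c P).coeff P.totalDegree =
      C (eval (fun o => o.elim 1 c) (homogeneousComponent P.totalDegree P)) := by
  have hs : ∀ s ∈ P.support, s.degree ≤ P.totalDegree := fun s hs => le_totalDegree hs
  have hP : shear c P = ∑ s ∈ P.support, shear c (monomial s (P.coeff s)) := by
    conv_lhs => rw [P.as_sum, map_sum]
  constructor
  · rw [hP]
    exact Polynomial.natDegree_sum_le_of_forall_le _ _ fun s h =>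
      (natDegree_shear_monomial c s _).1.trans (hs s h)
  · rw [hP, Polynomial.finsetSum_coeff, homogeneousComponent_apply, map_sum, map_sum,
      Finset.sum_filter]
    refine Finset.sum_congr rfl fun s h => ?_
    split_ifs with hd
    · rw [← hd]; exact (natDegree_shear_monomial c s _).2
    · exact Polynomial.coeff_eq_zero_of_natDegree_lt
        ((natDegree_shear_monomial c s _).1.trans_lt (lt_of_le_of_ne (hs s h) hd))

/-- The inverse of `shear`. -/
noncomputable def unshear {E β : Type*} [Field E] (c : β → E) :
    Polynomial (MvPolynomial β E) →+* MvPolynomial (Option β) E :=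
  Polynomial.eval₂RingHom (aeval fun b => X (some b) - C (c b) * X none :
    MvPolynomial β E →ₐ[E] MvPolynomial (Option β) E).toRingHom (X none)

theorem unshear_shear {E β : Type*} [Field E] (c : β → E) (P : MvPolynomial (Option β) E) :
    unshear c (shear c P) = P := by
  have : (unshear c).comp (shear c).toRingHom = RingHom.id _ := by
    refine MvPolynomial.ringHom_ext (fun r => ?_) ?_
    · simp [shear, unshear, Polynomial.algebraMap_apply, algebraMap_eq]
    · rintro (_ | b) <;> simp [shear, unshear, algebraMap_eq]
  exact RingHom.congr_fun this P

theorem shear_unshear {E β : Type*} [Field E] (c : β → E) (P : Polynomial (MvPolynomial β E)) :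
    shear c (unshear c P) = P := by
  have : (shear c).toRingHom.comp (unshear c) = RingHom.id _ := by
    refine Polynomial.ringHom_ext' (MvPolynomial.ringHom_ext (fun r => ?_) ?_) ?_
    · simp [shear, unshear, Polynomial.algebraMap_apply, algebraMap_eq]
    · simp [shear, unshear, Polynomial.algebraMap_apply, algebraMap_eq]
    · simp [shear, unshear]
  exact RingHom.congr_fun this P

theorem eval_smul_of_isHomogeneous {σ R : Type*} [CommSemiring R] {P : MvPolynomial σ R} {m : ℕ}
    (hP : P.IsHomogeneous m) (a : R) (z : σ → R) : eval (a • z) P = a ^ m * eval z P := by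
  rw [eval_eq, eval_eq, Finset.mul_sum]
  refine Finset.sum_congr rfl fun s hs => ?_
  have hs' := hP (mem_support_iff.1 hs)
  rw [Finsupp.weight_apply, Finsupp.sum] at hs'
  simp only [Pi.smul_apply, smul_eq_mul, mul_pow, Finset.prod_mul_distrib,
    Finset.prod_pow_eq_pow_sum, Pi.one_apply, mul_one] at hs' ⊢
  rw [hs']
  ring

theorem exists_totalDegree_le_of_relations {E K β : Type*} [Field E] [Infinite E] [Field K]
    [Algebra E K] [Fintype β] (t : Option β → K)
    (ht : IsTranscendenceBasis E fun b => t (some b)) (D : ℕ)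
    (hQ : ∀ c : β → E, ∃ Q : Polynomial (MvPolynomial β E), Q ≠ 0 ∧ Q.natDegree ≤ D ∧
      Q.eval₂ (aeval fun b => t (some b) - algebraMap E K (c b) * t none :
        MvPolynomial β E →ₐ[E] K).toRingHom (t none) = 0) :
    ∃ P : MvPolynomial (Option β) E, P ≠ 0 ∧ P.totalDegree ≤ D ∧ aeval t P = 0 := by
  classical
  have hev : ∀ c : β → E, ∀ P, (shear c P).eval₂ (aeval fun b => t (some b) -
      algebraMap E K (c b) * t none : MvPolynomial β E →ₐ[E] K).toRingHom (t none) = aeval t P := by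
    intro c P
    have : (Polynomial.eval₂RingHom (aeval fun b => t (some b) - algebraMap E K (c b) * t none :
        MvPolynomial β E →ₐ[E] K).toRingHom (t none)).comp (shear c).toRingHom =
        (aeval t : MvPolynomial _ E →ₐ[E] K).toRingHom := by
      refine MvPolynomial.ringHom_ext (fun r => ?_) ?_
      · simp [shear, Polynomial.algebraMap_apply, algebraMap_eq]
      · rintro (_ | b) <;> simp [shear]
    exact RingHom.congr_fun this P
  have hex : ∃ δ, ∃ P : MvPolynomial (Option β) E, P ≠ 0 ∧ P.totalDegree = δ ∧ aeval t P = 0 := by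
    obtain ⟨Q, hQ0, -, hQ⟩ := hQ 0
    refine ⟨_, unshear 0 Q, fun h => hQ0 ?_, rfl, ?_⟩
    · rw [← shear_unshear 0 Q, h, map_zero]
    · rw [← hev 0, shear_unshear, hQ]
  obtain ⟨P, hP0, hPδ, hPt⟩ := Nat.find_spec hex
  have hmin : ∀ P' : MvPolynomial (Option β) E, P' ≠ 0 → aeval t P' = 0 →
      P.totalDegree ≤ P'.totalDegree := fun P' h1 h2 => by
    rw [hPδ]; exact Nat.find_min' hex ⟨P', h1, rfl, h2⟩
  refine ⟨P, hP0, ?_, hPt⟩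
  have htop : homogeneousComponent P.totalDegree P ≠ 0 := by
    intro h
    obtain ⟨s, hs, hsd⟩ := Finset.exists_mem_eq_sup P.support (support_nonempty.2 hP0)
      fun s => s.sum fun _ e => e
    have := congrArg (coeff s) h
    rw [coeff_homogeneousComponent, if_pos] at this
    · exact mem_support_iff.1 hs this
    · exact hsd.symm
  obtain ⟨c, hc⟩ : ∃ c : β → E,
      eval (fun o => o.elim 1 c) (homogeneousComponent P.totalDegree P) ≠ 0 := by
    by_contra! hcon
    apply htop
    refine MvPolynomial.funext_set (fun _ => {a | a ≠ 0}) (fun _ => ?_) fun z hz => ?_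
    · exact (Set.finite_singleton (0 : E)).infinite_compl
    · have hz0 : z none ≠ 0 := hz none (Set.mem_univ _)
      have h1 : z = z none • fun o : Option β => o.elim 1 fun b => (z none)⁻¹ * z (some b) := by
        funext o
        rcases o with _ | b
        · simp
        · simp [hz0]
      rw [h1, eval_smul_of_isHomogeneous (homogeneousComponent_isHomogeneous _ P), hcon]
      simp
  obtain ⟨hd1, hd2⟩ := natDegree_shear c P
  set a := eval (fun o => o.elim 1 c) (homogeneousComponent P.totalDegree P) with ha
  have hnd : (shear c P).natDegree = P.totalDegree := by
    refine le_antisymm hd1 (Polynomial.le_natDegree_of_ne_zero ?_)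
    rw [hd2]; simpa using hc
  let R := MvPolynomial β E
  let ρ : R →ₐ[E] K := aeval fun b => t (some b) - algebraMap E K (c b) * t none
  let : Algebra R K := ρ.toAlgebra
  have hInt : IsIntegral R (t none) := by
    refine ⟨Polynomial.C (C a⁻¹) * shear c P, ?_, ?_⟩
    · rw [Polynomial.Monic, Polynomial.leadingCoeff_mul, Polynomial.leadingCoeff_C,
        Polynomial.leadingCoeff, hnd, hd2, ← map_mul, inv_mul_cancel₀ hc, map_one]
    · rw [Polynomial.eval₂_mul]
      have : (shear c P).eval₂ (algebraMap R K) (t none) = 0 := (hev c P).trans hPt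
      rw [this, mul_zero]
  have hind : IsTranscendenceBasis E fun b => t (some b) - algebraMap E K (c b) * t none := by
    have halg : Algebra.IsAlgebraic (Algebra.adjoin E (Set.range fun b =>
        t (some b) - algebraMap E K (c b) * t none)) K := by
      have h0 := ht.isAlgebraic
      set S := Algebra.adjoin E (Set.range fun b =>
        t (some b) - algebraMap E K (c b) * t none) with hS
      have hSr : ρ.range = S := by rw [hS, Algebra.adjoin_range_eq_range_aeval]
      have hn : IsAlgebraic S (t none) := by
        have h1 : IsIntegral ρ.range (t none) := by
          obtain ⟨q, hq1, hq2⟩ := hInt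
          refine ⟨q.map ρ.rangeRestrict.toRingHom, hq1.map _, ?_⟩
          rw [Polynomial.eval₂_map]
          exact hq2
        rw [hSr] at h1
        exact h1.isAlgebraic
      constructor
      intro z
      refine (h0.isAlgebraic z).adjoin_of_forall_isAlgebraic ?_
      rintro _ ⟨⟨b, rfl⟩, -⟩
      have h2 : t (some b) = (t (some b) - algebraMap E K (c b) * t none) +
          algebraMap E K (c b) * t none := by ring
      have h3 : IsAlgebraic S ((t (some b) - algebraMap E K (c b) * t none) +
          algebraMap E K (c b) * t none) :=
        (isAlgebraic_algebraMap (⟨_, Algebra.subset_adjoin ⟨b, rfl⟩⟩ : S)).add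
          ((isAlgebraic_algebraMap (⟨_, S.algebraMap_mem (c b)⟩ : S)).mul hn)
      rwa [← h2] at h3
    exact Algebra.IsAlgebraic.isTranscendenceBasis_of_lift_le_trdeg_of_finite _ _
      ht.lift_cardinalMk_eq_trdeg.le
  have hinj : Function.Injective (algebraMap R K) := hind.1
  have : FaithfulSMul R K := (faithfulSMul_iff_algebraMap_injective R K).2 hinj
  obtain ⟨Q, hQ0, hQd, hQt⟩ := hQ c
  have hdvQ : minpoly R (t none) ∣ Q := minpoly.isIntegrallyClosed_dvd hInt hQt
  obtain ⟨ν, hν⟩ : minpoly R (t none) ∣ shear c P :=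
    minpoly.isIntegrallyClosed_dvd hInt ((hev c P).trans hPt)
  have hμ := Polynomial.natDegree_le_of_dvd hdvQ hQ0
  set μ := minpoly R (t none) with hμdef
  have hPf : P = unshear c μ * unshear c ν := by
    rw [← map_mul, ← hν, unshear_shear]
  have hM0 : unshear c μ ≠ 0 := fun h => hP0 (by rw [hPf, h, zero_mul])
  have hN0 : unshear c ν ≠ 0 := fun h => hP0 (by rw [hPf, h, mul_zero])
  have hM : aeval t (unshear c μ) = 0 := by
    rw [← hev c, shear_unshear]
    exact minpoly.aeval R (t none)
  have hle := hmin _ hM0 hM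
  have hdeg := totalDegree_mul_of_isDomain hM0 hN0
  rw [← hPf] at hdeg
  have hN1 : (unshear c ν).totalDegree = 0 := by omega
  have hν0 : ν.natDegree = 0 := by
    have := (natDegree_shear c (unshear c ν)).1
    rw [shear_unshear, hN1] at this
    omega
  rw [← hnd, hν]
  refine Polynomial.natDegree_mul_le.trans ?_
  omega

theorem Derivation.map_mvPolynomial_aeval {k K σ : Type*} [CommRing k] [CommRing K] [Algebra k K]
    [Fintype σ] (D : Derivation k K K) (x : σ → K) (P : MvPolynomial σ k) :
    D (aeval x P) = ∑ j, aeval x (pderiv j P) * D (x j) := by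
  classical
  induction P using MvPolynomial.induction_on with
  | C a => simp
  | add P Q hP hQ => simp [hP, hQ, add_mul, Finset.sum_add_distrib]
  | mul_X P i hP =>
    simp only [map_mul, aeval_X, D.leibniz, hP, pderiv_mul, map_add, add_mul,
      Finset.sum_add_distrib, smul_eq_mul, pderiv_X, Pi.single_apply]
    rw [Finset.mul_sum, add_comm]
    congr 1
    · exact Finset.sum_congr rfl fun j _ => by ring
    · rw [Finset.sum_eq_single i]
      · simp
      · intro j _ hj
        simp [Ne.symm hj]
      · simp

theorem Subalgebra.adjoin_range_sumElim_le_restrictScalars {k E K α β : Type*} [Field k] [Field E]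
    [Field K] [Algebra k E] [Algebra E K] [Algebra k K] [IsScalarTower k E K] (S : Subalgebra E K)
    (V : α → E) (t : β → K) (ht : ∀ i, t i ∈ S) :
    Algebra.adjoin k (Set.range (Sum.elim (fun l => algebraMap E K (V l)) t)) ≤
      S.restrictScalars k := by
  rw [Algebra.adjoin_le_iff, Set.Sum.elim_range, Set.union_subset_iff]
  constructor
  · rintro _ ⟨i, rfl⟩
    exact S.algebraMap_mem (V i)
  · rintro _ ⟨i, rfl⟩
    exact ht i

theorem IsTranscendenceBasis.of_sumElim {k E K α β : Type*} [Field k] [Field E] [Field K]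
    [Algebra k E] [Algebra E K] [Algebra k K] [IsScalarTower k E K] {V : α → E} {t : β → K}
    (h : IsTranscendenceBasis k (Sum.elim (fun l => algebraMap E K (V l)) t))
    (ht : AlgebraicIndependent E t) : IsTranscendenceBasis E t := by
  rw [ht.isTranscendenceBasis_iff_isAlgebraic]
  have h0 := h.isAlgebraic
  set S := Algebra.adjoin E (Set.range t)
  have hle := S.adjoin_range_sumElim_le_restrictScalars (k := k) V t
    fun i => Algebra.subset_adjoin (Set.mem_range_self i)
  refine ⟨fun z => ?_⟩
  obtain ⟨q, hq0, hq⟩ := h0.isAlgebraic z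
  let g : Algebra.adjoin k (Set.range (Sum.elim (fun l => algebraMap E K (V l)) t)) →+* S :=
    (Subalgebra.inclusion hle).toRingHom
  have hg : Function.Injective g := Subalgebra.inclusion_injective hle
  refine ⟨q.map g, (Polynomial.map_ne_zero_iff hg).2 hq0, ?_⟩
  rw [Polynomial.aeval_def, Polynomial.eval₂_map]
  exact hq

theorem exists_eval₂_relation_of_constraints {k E K σ α β : Type*} [Field k] [CharZero k] [Field E]
    [Field K] [Algebra k E] [Algebra E K] [Algebra k K] [IsScalarTower k E K] [Fintype σ]
    [Fintype α] [Fintype β] (e : σ ≃ α ⊕ β) (x : σ → K) (V : α → E)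
    (hv : AlgebraicIndependent k fun l => algebraMap E K (V l))
    (a b : α → MvPolynomial σ k) (hb : ∀ l, aeval x (b l) ≠ 0)
    (hab : ∀ l, algebraMap E K (V l) * aeval x (b l) = aeval x (a l)) (w : α → ℕ)
    (hw : ∀ l, 1 ≤ w l) (haw : ∀ l, (a l).totalDegree ≤ w l) (hbw : ∀ l, (b l).totalDegree ≤ w l)
    (F : Option β → MvPolynomial σ k) (d : ℕ) (hd : 1 ≤ d) (hF : ∀ o, (F o).totalDegree ≤ d)
    (c : β → E) :
    ∃ Q : Polynomial (MvPolynomial β E), Q ≠ 0 ∧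
      Q.natDegree ≤ (∏ l, w l) * d ^ Fintype.card β ∧
      Q.eval₂ (aeval fun o => aeval x (F (some o)) - algebraMap E K (c o) * aeval x (F none) :
        MvPolynomial β E →ₐ[E] K).toRingHom (aeval x (F none)) = 0 := by
  have : CharZero E := charZero_of_injective_algebraMap (algebraMap k E).injective
  let G : α → MvPolynomial σ E := fun l =>
    map (algebraMap k E) (a l) - C (V l) * map (algebraMap k E) (b l)
  have hmap : ∀ P : MvPolynomial σ k, aeval x (map (algebraMap k E) P) = aeval x P := fun P =>
    aeval_map_algebraMap E x P
  have hdeg : ∀ (P : MvPolynomial σ k) (N : ℕ), P.totalDegree ≤ N →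
      (map (algebraMap k E) P).totalDegree ≤ N := fun P N h => by
    exact (Finset.sup_mono (support_map_subset _ _)).trans h
  have hCdeg : ∀ (z : E) (P : MvPolynomial σ k) (N : ℕ), P.totalDegree ≤ N →
      (C z * map (algebraMap k E) P).totalDegree ≤ N := fun z P N h =>
    (totalDegree_mul _ _).trans (by simpa using hdeg P N h)
  have hG : ∀ l, aeval x (G l) = 0 := fun l => by
    simp only [G, map_sub, map_mul, hmap, algHom_C, ← hab]
    ring
  have hJ : ∀ ζ : α → K, ∃ ξ : σ → K, ∀ l, ∑ j, aeval x (pderiv j (G l)) * ξ j = ζ l := by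
    intro ζ
    obtain ⟨D, hD⟩ := hv.exists_derivation fun l => ζ l / aeval x (b l)
    refine ⟨fun j => D (x j), fun l => ?_⟩
    have h1 : ∀ j, aeval x (pderiv j (G l)) * D (x j) = aeval x (pderiv j (a l)) * D (x j) -
        algebraMap E K (V l) * (aeval x (pderiv j (b l)) * D (x j)) := by
      intro j
      simp only [G, map_sub, pderiv_C_mul, pderiv_map, map_mul, algHom_C, hmap]
      rw [sub_mul, mul_assoc]
    simp only [h1, Finset.sum_sub_distrib, ← Finset.mul_sum]
    rw [← D.map_mvPolynomial_aeval, ← D.map_mvPolynomial_aeval, ← hab, D.leibniz, hD]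
    simp only [smul_eq_mul]
    have := hb l
    field_simp
    ring
  obtain ⟨Q, hQ0, hQd, hQ⟩ := exists_relation_of_jacobian e x G w hw
    (fun l => (totalDegree_sub _ _).trans (max_le (hdeg _ _ (haw l)) (hCdeg _ _ _ (hbw l))))
    hG hJ
    (fun o => map (algebraMap k E) (F (some o)) - C (c o) * map (algebraMap k E) (F none)) d hd
    (fun o => (totalDegree_sub _ _).trans (max_le (hdeg _ _ (hF _)) (hCdeg _ _ _ (hF _))))
    (map (algebraMap k E) (F none))
  refine ⟨Q, hQ0, hQd, ?_⟩
  simp only [map_sub, map_mul, hmap, algHom_C] at hQ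
  exact hQ

theorem exists_relation_of_constraints {k E K σ α β : Type*} [Field k] [CharZero k] [Field E]
    [Field K] [Algebra k E] [Algebra E K] [Algebra k K] [IsScalarTower k E K] [Fintype σ]
    [Fintype α] [Fintype β] (e : σ ≃ α ⊕ β) (x : σ → K) (V : α → E)
    (a b : α → MvPolynomial σ k) (hb : ∀ l, aeval x (b l) ≠ 0)
    (hab : ∀ l, algebraMap E K (V l) * aeval x (b l) = aeval x (a l)) (w : α → ℕ)
    (hw : ∀ l, 1 ≤ w l) (haw : ∀ l, (a l).totalDegree ≤ w l) (hbw : ∀ l, (b l).totalDegree ≤ w l)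
    (F : Option β → MvPolynomial σ k) (d : ℕ) (hd : 1 ≤ d) (hF : ∀ o, (F o).totalDegree ≤ d)
    (ht : IsTranscendenceBasis k
      (Sum.elim (fun l => algebraMap E K (V l)) fun b => aeval x (F (some b))))
    (htE : AlgebraicIndependent E fun b => aeval x (F (some b))) :
    ∃ P : MvPolynomial (Option β) E, P ≠ 0 ∧
      P.totalDegree ≤ (∏ l, w l) * d ^ Fintype.card β ∧ aeval (fun o => aeval x (F o)) P = 0 := by
  have hv : AlgebraicIndependent k fun l => algebraMap E K (V l) := by
    have h := ht.1.comp Sum.inl Sum.inl_injective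
    rwa [Sum.elim_comp_inl] at h
  have : CharZero E := charZero_of_injective_algebraMap (algebraMap k E).injective
  have hE := ht.of_sumElim htE
  refine exists_totalDegree_le_of_relations (fun o => aeval x (F o)) hE _ fun c => ?_
  have := exists_eval₂_relation_of_constraints e x V hv a b hb hab w hw haw hbw F d hd hF c
  exact this

theorem AlgebraicIndependent.exists_maximal_sumElim {k K α ι : Type*} [Field k] [Field K]
    [Algebra k K] [Finite ι] {φ : α → K} (hφ : AlgebraicIndependent k φ) (x : ι → K) :
    ∃ T : Set ι, AlgebraicIndependent k (Sum.elim φ fun i : T => x i) ∧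
      ∀ i, IsAlgebraic (Algebra.adjoin k (Set.range (Sum.elim φ fun i : T => x i))) (x i) := by
  classical
  let Z : Set (Set ι) := {T | AlgebraicIndependent k (Sum.elim φ fun i : T => x i)}
  have hZ : (∅ : Set ι) ∈ Z :=
    (algebraicIndependent_equiv' (Equiv.sumEmpty α (∅ : Set ι)).symm
      (by funext i; rfl)).1 hφ
  obtain ⟨T, hT⟩ := (Set.toFinite Z).exists_maximal ⟨_, hZ⟩
  refine ⟨T, hT.prop, fun i => ?_⟩
  by_contra htr
  by_cases hi : i ∈ T
  · exact htr (isAlgebraic_algebraMap (⟨x i, Algebra.subset_adjoin ⟨Sum.inr ⟨i, hi⟩, rfl⟩⟩ :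
      Algebra.adjoin k (Set.range (Sum.elim φ fun i : T => x i))))
  · have hind := (AlgebraicIndependent.option_iff_transcendental hT.prop (x i)).2 htr
    let g : α ⊕ (insert i T : Set ι) → Option (α ⊕ T) := Sum.elim (fun l => some (Sum.inl l))
      fun j => if h : (j : ι) ∈ T then some (Sum.inr ⟨j, h⟩) else none
    have hg : Function.Injective g := by
      rintro (l | ⟨j, hj⟩) (l' | ⟨j', hj'⟩) h
      · simpa [g] using h
      · simp only [g, Sum.elim_inl, Sum.elim_inr] at h
        split_ifs at h
        simp at h
      · simp only [g, Sum.elim_inl, Sum.elim_inr] at h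
        split_ifs at h
        simp at h
      · simp only [g, Sum.elim_inr] at h
        split_ifs at h with h1 h2 h2
        · simpa using h
        · have e1 := hj.resolve_right h1
          have e2 := hj'.resolve_right h2
          simp [e1, e2]
    have h2 := hind.comp g hg
    have h3 : insert i T ∈ Z := by
      show AlgebraicIndependent k _
      convert h2 using 1
      funext s
      rcases s with l | ⟨j, hj⟩
      · rfl
      · simp only [g, Sum.elim_inr, Function.comp]
        split_ifs with h
        · rfl
        · rw [hj.resolve_right h]
          rfl
    exact hi (hT.le_of_ge h3 (Set.subset_insert i T) (Set.mem_insert i T))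

attribute [local instance] MvPolynomial.algebraMvPolynomial in
theorem MvPolynomial.exists_map_eq_C_mul {R E β : Type*} [CommRing R] [IsDomain R] [CommRing E]
    [IsDomain E] [Algebra R E] (M : Submonoid R) (hM : M ≤ nonZeroDivisors R) [IsLocalization M E]
    (P : MvPolynomial β E) (hP : P ≠ 0) :
    ∃ (Q : MvPolynomial β R) (e : E), Q ≠ 0 ∧ Q.totalDegree ≤ P.totalDegree ∧
      map (algebraMap R E) Q = C e * P := by
  obtain ⟨⟨Q, ⟨_, s, hs, rfl⟩⟩, hQ⟩ := IsLocalization.surj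
    (M.map (C : R →+* MvPolynomial β R)) P
  have hinj : Function.Injective (algebraMap R E) := IsLocalization.injective E hM
  have hs0 : algebraMap R E s ≠ 0 :=
    (map_ne_zero_iff _ hinj).2 (nonZeroDivisors.ne_zero (hM hs))
  have h1 : map (algebraMap R E) Q = C (algebraMap R E s) * P := by
    have : P * map (algebraMap R E) (C s) = map (algebraMap R E) Q := hQ
    rw [← this, map_C, mul_comm]
  refine ⟨Q, algebraMap R E s, fun h => ?_, ?_, h1⟩
  · rw [h, map_zero] at h1
    exact mul_ne_zero ((map_ne_zero_iff _ (C_injective _ _)).2 hs0) hP h1.symm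
  · have h2 : (map (algebraMap R E) Q).totalDegree = Q.totalDegree := by
      rw [totalDegree, totalDegree, support_map_of_injective _ hinj]
    rw [← h2, h1]
    exact (totalDegree_mul _ _).trans (by simp)

theorem MvPolynomial.exists_aeval_sumElim_ne_zero {k α τ : Type*} [Field k] [Infinite k]
    (q : MvPolynomial (α ⊕ τ) k) (hq : q ≠ 0) :
    ∃ z : τ → k, aeval (Sum.elim X fun i => C (z i) : α ⊕ τ → MvPolynomial α k) q ≠ 0 := by
  obtain ⟨z, hz⟩ : ∃ z, eval z q ≠ 0 := by
    by_contra! h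
    exact hq (MvPolynomial.funext fun z => by rw [h, map_zero])
  refine ⟨fun i => z (Sum.inr i), fun h => hz ?_⟩
  have h2 := congrArg (eval fun l => z (Sum.inl l)) h
  rw [map_zero] at h2
  rw [← h2]
  have : (eval fun l => z (Sum.inl l)).comp (aeval (Sum.elim X fun i => C (z (Sum.inr i)) :
      α ⊕ τ → MvPolynomial α k)).toRingHom = eval z := by
    refine MvPolynomial.ringHom_ext (fun r => by simp [algebraMap_eq]) ?_
    rintro (i | i) <;> simp
  exact (RingHom.congr_fun this q).symm

theorem exists_polynomial_relation_of_constraints {k K σ α β : Type*} [Field k] [CharZero k]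
    [Field K] [Algebra k K] [Fintype σ] [Fintype α] [Fintype β] (e : σ ≃ α ⊕ β) (x : σ → K)
    (v : α → K) (a b : α → MvPolynomial σ k) (hb : ∀ l, aeval x (b l) ≠ 0)
    (hab : ∀ l, v l * aeval x (b l) = aeval x (a l)) (w : α → ℕ)
    (hw : ∀ l, 1 ≤ w l) (haw : ∀ l, (a l).totalDegree ≤ w l) (hbw : ∀ l, (b l).totalDegree ≤ w l)
    (F : Option β → MvPolynomial σ k) (d : ℕ) (hd : 1 ≤ d) (hF : ∀ o, (F o).totalDegree ≤ d)
    (ht : IsTranscendenceBasis k (Sum.elim v fun b => aeval x (F (some b)))) :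
    ∃ P : MvPolynomial (Option β) (MvPolynomial α k), P ≠ 0 ∧
      P.totalDegree ≤ (∏ l, w l) * d ^ Fintype.card β ∧
      P.eval₂ (aeval v : MvPolynomial α k →ₐ[k] K).toRingHom (fun o => aeval x (F o)) = 0 := by
  have hv : AlgebraicIndependent k v := by
    have h := ht.1.comp Sum.inl Sum.inl_injective
    rwa [Sum.elim_comp_inl] at h
  let R := MvPolynomial α k
  let E := FractionRing R
  let : Algebra R K := (aeval v : MvPolynomial α k →ₐ[k] K).toRingHom.toAlgebra
  have : FaithfulSMul R K := (faithfulSMul_iff_algebraMap_injective R K).2 hv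
  have : IsScalarTower k R K := IsScalarTower.of_algebraMap_eq fun r => (aeval_C v r).symm
  let : Algebra E K := FractionRing.liftAlgebra R K
  have : IsScalarTower R E K := FractionRing.isScalarTower_liftAlgebra R K
  have : IsScalarTower k E K := IsScalarTower.of_algebraMap_eq fun r => by
    rw [IsScalarTower.algebraMap_apply k R E, ← IsScalarTower.algebraMap_apply R E K,
      ← IsScalarTower.algebraMap_apply k R K]
  have hV : ∀ l, algebraMap E K (algebraMap R E (X l)) = v l := fun l => by
    rw [← IsScalarTower.algebraMap_apply R E K]
    exact aeval_X v l
  have htR : AlgebraicIndependent R fun b => aeval x (F (some b)) := by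
    have h1 : AlgebraicIndependent k (Sum.elim (fun b => aeval x (F (some b))) v) := by
      have := (algebraicIndependent_equiv' (Equiv.sumComm β α)
        (f := Sum.elim v fun b => aeval x (F (some b)))
        (g := Sum.elim (fun b => aeval x (F (some b))) v)
        (by funext i; rcases i with i | i <;> rfl)).2 ht.1
      exact this
    refine (AlgebraicIndependent.sumElim_iff.1 h1).2.of_ringHom_of_comp_eq
      (hv.aevalEquiv : R →+* Algebra.adjoin k (Set.range v)) (RingHom.id K)
      hv.aevalEquiv.injective ?_
    refine RingHom.ext fun r => ?_
    exact hv.algebraMap_aevalEquiv r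
  have : Algebra.IsAlgebraic R E := IsLocalization.isAlgebraic _ (nonZeroDivisors R)
  obtain ⟨P, hP0, hPd, hP⟩ := exists_relation_of_constraints e x (fun l => algebraMap R E (X l))
    a b hb (fun l => by rw [hV, hab]) w hw haw hbw F d hd hF (by simpa only [hV] using ht)
    (htR.extendScalars E)
  obtain ⟨Q, r, hQ0, hQd, hQ⟩ := MvPolynomial.exists_map_eq_C_mul (nonZeroDivisors R) le_rfl
    P hP0
  refine ⟨Q, hQ0, hQd.trans hPd, ?_⟩
  have h1 := congrArg (aeval fun o => aeval x (F o) : MvPolynomial (Option β) E →ₐ[E] K) hQ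
  rw [map_mul, hP, mul_zero, aeval_map_algebraMap] at h1
  exact h1

theorem IsTranscendenceBasis.of_forall_isAlgebraic {k K σ α : Type*} [Field k] [Field K]
    [Algebra k K] {x : σ → K} (hx : IsTranscendenceBasis k x) {v : α → K}
    (hv : AlgebraicIndependent k v)
    (h : ∀ i, IsAlgebraic (Algebra.adjoin k (Set.range v)) (x i)) : IsTranscendenceBasis k v := by
  rw [hv.isTranscendenceBasis_iff_isAlgebraic]
  refine ⟨fun z => ?_⟩
  refine IsAlgebraic.adjoin_of_forall_isAlgebraic ?_ (hx.isAlgebraic.isAlgebraic z)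
  rintro _ ⟨⟨i, rfl⟩, -⟩
  exact h i

/-- A polynomial relation persists when variables `y` that are algebraically independent over a
field containing the coefficients are specialised. -/
theorem AlgebraicIndependent.eval₂_specialize {k K α τ ι : Type*} [Field k] [Field K]
    [Algebra k K] (B : Subalgebra k K) {φ : α → K} {y : τ → K} {f : ι → K}
    (hy : AlgebraicIndependent B y) (hφ : ∀ l, φ l ∈ B) (hf : ∀ i, f i ∈ B)
    (P : MvPolynomial ι (MvPolynomial (α ⊕ τ) k))
    (hP : P.eval₂ (aeval (Sum.elim φ y) : MvPolynomial (α ⊕ τ) k →ₐ[k] K).toRingHom f = 0)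
    (z : τ → k) :
    (MvPolynomial.map (aeval (Sum.elim X fun i => C (z i)) :
      MvPolynomial (α ⊕ τ) k →ₐ[k] MvPolynomial α k).toRingHom P).eval₂
      (aeval φ : MvPolynomial α k →ₐ[k] K).toRingHom f = 0 := by
  let φ' : α → B := fun l => ⟨φ l, hφ l⟩
  let f' : ι → B := fun i => ⟨f i, hf i⟩
  let ρ : MvPolynomial (α ⊕ τ) k →ₐ[k] MvPolynomial τ B :=
    aeval (Sum.elim (fun l => C (φ' l)) X)
  let Θ : MvPolynomial ι (MvPolynomial (α ⊕ τ) k) →+* MvPolynomial τ B :=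
    eval₂Hom ρ.toRingHom fun i => C (f' i)
  have h1 : (aeval y : MvPolynomial τ B →ₐ[B] K).toRingHom.comp Θ =
      eval₂Hom (aeval (Sum.elim φ y) : MvPolynomial (α ⊕ τ) k →ₐ[k] K).toRingHom f := by
    refine MvPolynomial.ringHom_ext (fun q => ?_) fun i => ?_
    · have : ((aeval y : MvPolynomial τ B →ₐ[B] K).restrictScalars k).comp ρ =
          aeval (Sum.elim φ y) := by
        refine MvPolynomial.algHom_ext ?_
        rintro (l | i)
        · simp [ρ, φ']
        · simp [ρ]
      simpa [Θ] using AlgHom.congr_fun this q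
    · simp [Θ, f']
  have h2 : Θ P = 0 := by
    refine hy ?_
    rw [map_zero]
    exact (RingHom.congr_fun h1 P).trans hP
  have h3 : (B.val : B →ₐ[k] K).toRingHom.comp ((eval fun i => algebraMap k B (z i)).comp Θ) =
      (eval₂Hom (aeval φ : MvPolynomial α k →ₐ[k] K).toRingHom f).comp
      (MvPolynomial.map (aeval (Sum.elim X fun i => C (z i)) :
        MvPolynomial (α ⊕ τ) k →ₐ[k] MvPolynomial α k).toRingHom) := by
    refine MvPolynomial.ringHom_ext (fun q => ?_) fun i => ?_
    · have : B.val.comp (((aeval fun i => algebraMap k B (z i) :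
          MvPolynomial τ B →ₐ[B] B).restrictScalars k).comp ρ) =
          (aeval φ : MvPolynomial α k →ₐ[k] K).comp (aeval (Sum.elim X fun i => C (z i))) := by
        refine MvPolynomial.algHom_ext ?_
        rintro (l | i)
        · simp [ρ, φ']
        · simp [ρ]
      simpa [Θ, coe_aeval_eq_eval] using AlgHom.congr_fun this q
    · simp [Θ, f']
  have h4 := RingHom.congr_fun h3 P
  simp only [RingHom.comp_apply, h2, map_zero] at h4
  exact h4.symm

theorem exists_relation_of_card_eq {k K σ α ι : Type*} [Field k] [CharZero k] [Field K]
    [Algebra k K] [Fintype σ] [Fintype α] [Fintype ι] {x : σ → K} (hx : IsTranscendenceBasis k x)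
    {φ : α → K} (hφ : AlgebraicIndependent k φ) (a b : α → MvPolynomial σ k)
    (hb : ∀ l, aeval x (b l) ≠ 0) (hab : ∀ l, φ l * aeval x (b l) = aeval x (a l)) (w : α → ℕ)
    (hw : ∀ l, 1 ≤ w l) (haw : ∀ l, (a l).totalDegree ≤ w l) (hbw : ∀ l, (b l).totalDegree ≤ w l)
    (F : ι → MvPolynomial σ k) (d : ℕ) (hd : 1 ≤ d) (hF : ∀ o, (F o).totalDegree ≤ d)
    (hcard : Fintype.card α + Fintype.card ι = Fintype.card σ + 1) :
    ∃ P : MvPolynomial ι (MvPolynomial α k), P ≠ 0 ∧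
      P.totalDegree ≤ (∏ l, w l) * d ^ (Fintype.card ι - 1) ∧
      P.eval₂ (aeval φ : MvPolynomial α k →ₐ[k] K).toRingHom (fun o => aeval x (F o)) = 0 := by
  classical
  set f : ι → K := fun o => aeval x (F o) with hf
  obtain ⟨S, hS, hSf⟩ := hφ.exists_maximal_sumElim f
  obtain ⟨T, hT, hTx⟩ := hS.exists_maximal_sumElim x
  have hB := hx.of_forall_isAlgebraic hT hTx
  have hcT : Fintype.card σ = (Fintype.card α + Fintype.card T) + Fintype.card S := by
    have h1 := hB.card_eq_trd.trans hx.card_eq_trd.symm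
    simp only [Nat.card_eq_fintype_card, Fintype.card_sum] at h1
    omega
  obtain ⟨i₀, hi₀⟩ : ∃ i₀, i₀ ∉ S := by
    by_contra! h
    have : Fintype.card S = Fintype.card ι := Fintype.card_congr (Equiv.subtypeUnivEquiv h)
    omega
  let v : α ⊕ T → K := Sum.elim φ fun i => x i
  have e : σ ≃ (α ⊕ T) ⊕ S := Fintype.equivOfCardEq (by simpa using hcT)
  have ht : IsTranscendenceBasis k (Sum.elim v fun i : S => f i) :=
    (isTranscendenceBasis_equiv' ((Equiv.sumAssoc α T S).trans
      (((Equiv.refl α).sumCongr (Equiv.sumComm T S)).trans (Equiv.sumAssoc α S T).symm))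
      (by funext i; rcases i with (i | i) | i <;> rfl)).2 hB
  obtain ⟨P, hP0, hPd, hP⟩ := exists_polynomial_relation_of_constraints e x v
    (Sum.elim a fun i => X i) (Sum.elim b fun _ => 1) (by rintro (l | i) <;> simp [hb])
    (by rintro (l | i) <;> simp [hab, v]) (Sum.elim w fun _ => 1)
    (by rintro (l | i) <;> simp [hw]) (by rintro (l | i) <;> simp [haw])
    (by rintro (l | i) <;> simp [hbw]) (fun o : Option S => F (o.elim i₀ fun i => i)) d hd
    (fun _ => hF _) ht
  obtain ⟨s, hs⟩ := support_nonempty.2 hP0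
  obtain ⟨z, hz⟩ := exists_aeval_sumElim_ne_zero _ (mem_support_iff.1 hs)
  let A := Algebra.adjoin k (Set.range (Sum.elim φ fun i : S => f i))
  have hyA : AlgebraicIndependent A fun i : T => x i :=
    (AlgebraicIndependent.sumElim_iff.1 ((algebraicIndependent_equiv' (Equiv.sumComm T (α ⊕ S))
      (by funext i; rcases i with i | i <;> rfl)).2 hT)).2
  let B : Subalgebra k K := (Subalgebra.algebraicClosure A K).restrictScalars k
  have hyB : AlgebraicIndependent B fun i : T => x i := hyA.subalgebraAlgebraicClosure
  have hPz := hyB.eval₂_specialize B (φ := φ) (f := fun o : Option S => f (o.elim i₀ fun i => i))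
    (fun l => isAlgebraic_algebraMap
      (⟨φ l, Algebra.subset_adjoin ⟨Sum.inl l, rfl⟩⟩ : A)) (fun o => hSf _) P hP z
  set P' := MvPolynomial.map (aeval (Sum.elim X fun i => C (z i)) :
      MvPolynomial (α ⊕ T) k →ₐ[k] MvPolynomial α k).toRingHom P
  have hP'0 : P' ≠ 0 := fun h => hz (by
    have := congrArg (coeff s) h
    rwa [coeff_map, coeff_zero] at this)
  have hg : Function.Injective fun o : Option S => (o.elim i₀ fun i => i : ι) := by
    rintro (_ | i) (_ | j) h
    · rfl
    · exact (hi₀ (by rw [show i₀ = j from h]; exact j.2)).elim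
    · exact (hi₀ (by rw [← show (i : ι) = i₀ from h]; exact i.2)).elim
    · exact congrArg some (Subtype.ext h)
  refine ⟨rename _ P', (map_ne_zero_iff _ (rename_injective _ hg)).2 hP'0, ?_, ?_⟩
  · refine (totalDegree_rename_le _ _).trans ?_
    refine ((Finset.sup_mono (support_map_subset _ _)).trans hPd).trans ?_
    rw [Fintype.prod_sum_type]
    simp only [Sum.elim_inl, Sum.elim_inr, Finset.prod_const_one, mul_one]
    exact Nat.mul_le_mul_left _ (Nat.pow_le_pow_right hd (by omega))
  · rw [eval₂_rename]
    exact hPz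

/-- Substitution of powers of one variable for all variables outside `κ`. -/
noncomputable def powSubst (k : Type*) {μ μ' κ : Type*} [CommRing k] (N : μ ⊕ μ' → ℕ) :
    MvPolynomial (μ ⊕ (Option μ' ⊕ κ)) k →ₐ[k] Polynomial (MvPolynomial κ k) :=
  aeval (Sum.elim (fun l => Polynomial.X ^ N (Sum.inl l))
    (Sum.elim (fun o => o.elim Polynomial.X fun l => Polynomial.X ^ N (Sum.inr l))
      fun i => Polynomial.C (X i)))

theorem exists_powSubst_ne_zero {k μ μ' κ : Type*} [Field k] [Finite μ] [Finite μ']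
    (q : MvPolynomial (μ ⊕ (Option μ' ⊕ κ)) k) (hq : q ≠ 0) :
    ∃ N : μ ⊕ μ' → ℕ, (∀ l, 2 ≤ N l) ∧ powSubst k N q ≠ 0 := by
  let B := Polynomial (MvPolynomial κ k)
  let Φ : MvPolynomial (μ ⊕ (Option μ' ⊕ κ)) k →ₐ[k] MvPolynomial (μ ⊕ μ') B :=
    aeval (Sum.elim (fun l => X (Sum.inl l))
      (Sum.elim (fun o => o.elim (C Polynomial.X) fun l => X (Sum.inr l))
        fun i => C (Polynomial.C (X i))))
  let ρ : B →+* MvPolynomial (μ ⊕ (Option μ' ⊕ κ)) k :=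
    Polynomial.eval₂RingHom (rename fun i => Sum.inr (Sum.inr i) :
      MvPolynomial κ k →ₐ[k] _).toRingHom (X (Sum.inr (Sum.inl none)))
  let Ψ : MvPolynomial (μ ⊕ μ') B →+* MvPolynomial (μ ⊕ (Option μ' ⊕ κ)) k :=
    eval₂Hom ρ (Sum.elim (fun l => X (Sum.inl l)) fun l => X (Sum.inr (Sum.inl (some l))))
  have hρX : ρ Polynomial.X = X (Sum.inr (Sum.inl none)) := Polynomial.eval₂_X _ _
  have hρC : ∀ b, ρ (Polynomial.C b) = rename (fun i => Sum.inr (Sum.inr i)) b :=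
    fun b => Polynomial.eval₂_C _ _
  have hΨ : Ψ.comp Φ.toRingHom = RingHom.id _ := by
    refine MvPolynomial.ringHom_ext (fun r => ?_) ?_
    · simp [Φ, Ψ, ρ, MvPolynomial.algebraMap_apply, Polynomial.algebraMap_apply, algebraMap_eq, B]
    · rintro (l | ((_ | l) | i))
      · simp [Φ, Ψ]
      · simp [Φ, Ψ, hρX]
      · simp [Φ, Ψ]
      · simp [Φ, Ψ, hρC]
  have hΦ : Φ q ≠ 0 := fun h => hq (by
    have := RingHom.congr_fun hΨ q
    simpa [h] using this.symm)
  obtain ⟨z, hz, hzq⟩ : ∃ z : μ ⊕ μ' → B, (∀ l, ∃ N, 2 ≤ N ∧ z l = Polynomial.X ^ N) ∧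
      eval z (Φ q) ≠ 0 := by
    by_contra! hcon
    refine hΦ (MvPolynomial.funext_set (fun _ => {b | ∃ N, 2 ≤ N ∧ b = Polynomial.X ^ N})
      (fun _ => ?_) fun z hz => ?_)
    · refine Set.infinite_of_injective_forall_mem (f := fun N : ℕ => (Polynomial.X ^ (N + 2) : B))
        (fun a b h => ?_) fun N => ⟨N + 2, by omega, rfl⟩
      have := congrArg Polynomial.natDegree h
      simpa using this
    · rw [map_zero]
      exact hcon z fun l => hz l (Set.mem_univ _)
  choose N hN2 hN using hz
  refine ⟨N, hN2, fun h => hzq ?_⟩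
  have : (eval z).comp Φ.toRingHom = (powSubst k N).toRingHom := by
    refine MvPolynomial.ringHom_ext (fun r => ?_) ?_
    · simp [Φ, powSubst, MvPolynomial.algebraMap_apply, Polynomial.algebraMap_apply,
        algebraMap_eq, B]
    · rintro (l | ((_ | l) | i)) <;> simp [Φ, powSubst, hN]
  exact (RingHom.congr_fun this q).trans h

theorem MvPolynomial.exists_eq_C_X_pow_mul {R ι : Type*} [CommRing R] [IsDomain R]
    (P : MvPolynomial ι (Polynomial R)) (hP : P ≠ 0) :
    ∃ (j : ℕ) (Q : MvPolynomial ι (Polynomial R)), P = C (Polynomial.X ^ j) * Q ∧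
      Q.totalDegree ≤ P.totalDegree ∧ ∃ s, (coeff s Q).coeff 0 ≠ 0 := by
  classical
  obtain ⟨s₀, hs₀⟩ := support_nonempty.2 hP
  rw [mem_support_iff] at hs₀
  let S : Set ℕ := {j | C (Polynomial.X ^ j) ∣ P}
  have hS : ∀ j ∈ S, j ≤ (coeff s₀ P).natDegree := by
    rintro j ⟨Q, hQ⟩
    rw [hQ, coeff_C_mul] at hs₀ ⊢
    rw [Polynomial.natDegree_X_pow_mul _ (right_ne_zero_of_mul hs₀)]
    exact Nat.le_add_left _ _
  have hfin : S.Finite := (Set.finite_Iic _).subset hS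
  obtain ⟨j, hj⟩ := hfin.exists_maximal ⟨0, by simp [S]⟩
  obtain ⟨Q, hQ⟩ := hj.prop
  refine ⟨j, Q, hQ, ?_, ?_⟩
  · refine Finset.sup_mono fun s hs => ?_
    rw [mem_support_iff] at hs ⊢
    rw [hQ, coeff_C_mul]
    exact mul_ne_zero (pow_ne_zero _ Polynomial.X_ne_zero) hs
  · by_contra! h
    obtain ⟨Q', hQ'⟩ : C Polynomial.X ∣ Q := by
      rw [C_dvd_iff_dvd_coeff]
      exact fun s => Polynomial.X_dvd_iff.2 (h s)
    have h1 : j + 1 ∈ S := ⟨Q', by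
      rw [hQ, hQ', pow_succ, C_mul, mul_assoc]⟩
    have := hj.le_of_ge h1 (Nat.le_succ j)
    omega

theorem exists_specialized_relation {k ι μ μ' κ : Type*} [Field k] [Infinite k] [Finite μ]
    [Finite μ'] (P : MvPolynomial ι (MvPolynomial (μ ⊕ (Option μ' ⊕ κ)) k)) (hP : P ≠ 0) :
    ∃ (N : μ ⊕ μ' → ℕ) (g : MvPolynomial ι k), (∀ l, 2 ≤ N l) ∧ g ≠ 0 ∧
      g.totalDegree ≤ P.totalDegree ∧
      ∀ {A : Type u} [CommRing A] [Algebra k A] (𝔮 𝔭 : Ideal A) [𝔮.IsPrime] [𝔭.IsPrime]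
        (w : A) (y : μ ⊕ μ' → A) (r : κ → A) (f : ι → A) (c : ι → k), 𝔮 ≤ 𝔭 → w ∉ 𝔮 → w ∈ 𝔭 →
        (∀ l, y l - w ^ N l ∈ 𝔮) → (∀ i, f i - algebraMap k A (c i) ∈ 𝔭) →
        AlgebraicIndependent k (fun i => Ideal.Quotient.mk 𝔭 (r i)) →
        P.eval₂ (aeval (Sum.elim (fun l => y (Sum.inl l)) (Sum.elim (fun o => o.elim w
          fun l => y (Sum.inr l)) r)) : _ →ₐ[k] A).toRingHom f = 0 → eval c g = 0 := by
  classical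
  obtain ⟨s₀, hs₀⟩ := support_nonempty.2 hP
  rw [mem_support_iff] at hs₀
  obtain ⟨N, hN2, hN⟩ := exists_powSubst_ne_zero _ hs₀
  let P' := MvPolynomial.map (powSubst k N).toRingHom P
  have hP' : P' ≠ 0 := fun h => hN (by
    have := congrArg (coeff s₀) h
    rwa [coeff_map, coeff_zero] at this)
  obtain ⟨j, Q, hPQ, hQd, s₁, hs₁⟩ := P'.exists_eq_C_X_pow_mul hP'
  obtain ⟨z, hz⟩ : ∃ z : κ → k, eval z ((coeff s₁ Q).coeff 0) ≠ 0 := by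
    by_contra! h
    exact hs₁ (MvPolynomial.funext fun z => by rw [h z, map_zero])
  let σ : Polynomial (MvPolynomial κ k) →+* MvPolynomial κ k := Polynomial.constantCoeff
  refine ⟨N, MvPolynomial.map (eval z) (MvPolynomial.map σ Q), hN2, fun h => hz ?_, ?_, ?_⟩
  · have := congrArg (coeff s₁) h
    rwa [coeff_map, coeff_map, coeff_zero] at this
  · refine le_trans (Finset.sup_mono ((support_map_subset _ _).trans (support_map_subset _ _)))
      (hQd.trans (Finset.sup_mono (support_map_subset _ _)))
  intro A _ _ 𝔮 𝔭 _ _ w y r f c hqp hwq hwp hy hf hr hrel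
  let τ : Polynomial (MvPolynomial κ k) →+* A :=
    Polynomial.eval₂RingHom (aeval r : _ →ₐ[k] A).toRingHom w
  have hτX : τ Polynomial.X = w := Polynomial.eval₂_X _ _
  have hτC : ∀ b, τ (Polynomial.C b) = aeval r b := fun b => Polynomial.eval₂_C _ _
  have h1 : ((Ideal.Quotient.mk 𝔮).comp (aeval (Sum.elim (fun l => y (Sum.inl l))
      (Sum.elim (fun o => o.elim w fun l => y (Sum.inr l)) r)) : _ →ₐ[k] A).toRingHom) =
      ((Ideal.Quotient.mk 𝔮).comp τ).comp (powSubst k N).toRingHom := by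
    refine MvPolynomial.ringHom_ext (fun a => ?_) ?_
    · have : (powSubst k N) (C a) =
        Polynomial.C (C a : MvPolynomial κ k) := by
        rw [← algebraMap_eq, AlgHom.commutes]; rfl
      simp [this, hτC]
    · have hy' : ∀ l, Ideal.Quotient.mk 𝔮 (y l) = Ideal.Quotient.mk 𝔮 (w ^ N l) :=
        fun l => Ideal.Quotient.eq.2 (hy l)
      rintro (l | ((_ | l) | i)) <;> simp [powSubst, hτX, hτC, hy']
  have h2 : Ideal.Quotient.mk 𝔮 (eval₂ τ f Q) = 0 := by
    have h3 : Ideal.Quotient.mk 𝔮 (eval₂ τ f P') = 0 := by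
      rw [← map_zero (Ideal.Quotient.mk 𝔮), ← hrel, eval₂_comp_left, eval₂_comp_left, h1,
        eval₂_map]
    rw [hPQ, eval₂_mul, eval₂_C, map_pow, hτX, map_mul, map_pow] at h3
    refine (mul_eq_zero.1 h3).resolve_left (pow_ne_zero _ ?_)
    rwa [Ne, Ideal.Quotient.eq_zero_iff_mem]
  have h4 : Ideal.Quotient.mk 𝔭 (eval₂ τ f Q) = 0 := by
    rw [Ideal.Quotient.eq_zero_iff_mem] at h2 ⊢
    exact hqp h2
  have h5 : (Ideal.Quotient.mk 𝔭).comp τ =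
      (aeval fun i => Ideal.Quotient.mk 𝔭 (r i) : _ →ₐ[k] A ⧸ 𝔭).toRingHom.comp σ := by
    refine Polynomial.ringHom_ext (fun b => ?_) ?_
    · have : (Ideal.Quotient.mk 𝔭) (aeval r b) = aeval (fun i => Ideal.Quotient.mk 𝔭 (r i)) b := by
        rw [← Ideal.Quotient.mkₐ_eq_mk k, MvPolynomial.comp_aeval_apply]
      simp [hτC, this, σ, Polynomial.constantCoeff]
    · simpa [hτX, σ, Ideal.Quotient.eq_zero_iff_mem] using hwp
  have h6 : eval (fun i => C (c i)) (MvPolynomial.map σ Q) = 0 := by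
    apply hr
    rw [map_zero, ← h4, eval₂_comp_left, h5, ← AlgHom.coe_toRingHom, eval_map, eval₂_comp_left]
    congr 1
    funext i
    have : Ideal.Quotient.mk 𝔭 (f i) = Ideal.Quotient.mk 𝔭 (algebraMap k A (c i)) :=
      Ideal.Quotient.eq.2 (hf i)
    simp [this]
  have h7 := congrArg (eval z) h6
  rw [map_zero, eval_map, eval₂_comp_left] at h7
  rw [eval_map, eval₂_map, ← h7]
  congr 1
  funext i
  simp

theorem AlgebraicIndependent.isTranscendenceBasis_adjoin {k K σ : Type*} [Field k] [Field K]
    [Algebra k K] {x : σ → K} (hx : AlgebraicIndependent k x) :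
    IsTranscendenceBasis k fun i =>
      (⟨x i, IntermediateField.subset_adjoin k _ ⟨i, rfl⟩⟩ :
        IntermediateField.adjoin k (Set.range x)) := by
  let L := IntermediateField.adjoin k (Set.range x)
  let x' : σ → L := fun i => ⟨x i, IntermediateField.subset_adjoin k _ ⟨i, rfl⟩⟩
  have hx' : AlgebraicIndependent k x' :=
    (AlgHom.algebraicIndependent_iff L.val L.val.injective).1 hx
  refine hx'.isTranscendenceBasis_iff_isAlgebraic.2 ⟨fun z => ?_⟩
  obtain ⟨r, s, hrs⟩ := (IntermediateField.mem_adjoin_range_iff k x z.1).1 z.2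
  have hz : z = aeval x' r * (aeval x' s)⁻¹ := by
    apply Subtype.ext
    have h : ∀ q : MvPolynomial σ k, ((aeval x' q : L) : K) = aeval x q := fun q =>
      MvPolynomial.comp_aeval_apply x' L.val q
    rw [hrs, div_eq_mul_inv]
    push_cast
    rw [h, h]
  have hmem : ∀ q : MvPolynomial σ k, IsAlgebraic (Algebra.adjoin k (Set.range x')) (aeval x' q) :=
    fun q => isAlgebraic_algebraMap (⟨aeval x' q, by
      rw [Algebra.adjoin_range_eq_range_aeval]; exact ⟨q, rfl⟩⟩ :
        Algebra.adjoin k (Set.range x'))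
  rw [hz]
  exact (hmem r).mul (hmem s).inv

theorem AlgebraicIndependent.exists_relation_of_card_eq {k K σ α ι : Type*} [Field k]
    [CharZero k] [Field K] [Algebra k K] [Fintype σ] [Fintype α] [Fintype ι] {x : σ → K}
    (hx : AlgebraicIndependent k x) {φ : α → K} (hφ : AlgebraicIndependent k φ)
    (a b : α → MvPolynomial σ k) (hb : ∀ l, aeval x (b l) ≠ 0)
    (hab : ∀ l, φ l * aeval x (b l) = aeval x (a l)) (w : α → ℕ)
    (hw : ∀ l, 1 ≤ w l) (haw : ∀ l, (a l).totalDegree ≤ w l) (hbw : ∀ l, (b l).totalDegree ≤ w l)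
    (F : ι → MvPolynomial σ k) (d : ℕ) (hd : 1 ≤ d) (hF : ∀ o, (F o).totalDegree ≤ d)
    (hcard : Fintype.card α + Fintype.card ι = Fintype.card σ + 1) :
    ∃ P : MvPolynomial ι (MvPolynomial α k), P ≠ 0 ∧
      P.totalDegree ≤ (∏ l, w l) * d ^ (Fintype.card ι - 1) ∧
      P.eval₂ (aeval φ : MvPolynomial α k →ₐ[k] K).toRingHom (fun o => aeval x (F o)) = 0 := by
  let L := IntermediateField.adjoin k (Set.range x)
  let x' : σ → L := fun i => ⟨x i, IntermediateField.subset_adjoin k _ ⟨i, rfl⟩⟩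
  have h : ∀ q : MvPolynomial σ k, ((aeval x' q : L) : K) = aeval x q := fun q =>
      MvPolynomial.comp_aeval_apply x' L.val q
  have hφL : ∀ l, φ l ∈ L := fun l => by
    rw [eq_div_of_mul_eq (hb l) (hab l), ← h, ← h]
    exact L.div_mem (aeval x' (a l) : L).2 (aeval x' (b l) : L).2
  let φ' : α → L := fun l => ⟨φ l, hφL l⟩
  have hφ' : AlgebraicIndependent k φ' :=
    (AlgHom.algebraicIndependent_iff L.val L.val.injective).1 hφ
  obtain ⟨P, hP0, hPd, hP⟩ := _root_.exists_relation_of_card_eq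
    hx.isTranscendenceBasis_adjoin hφ' a b
    (fun l hl => hb l (by rw [← h]; exact congrArg Subtype.val hl))
    (fun l => Subtype.ext (by
      rw [MulMemClass.coe_mul]
      exact ((congrArg (φ l * ·) (h (b l))).trans (hab l)).trans (h (a l)).symm))
    w hw haw hbw F d hd hF hcard
  refine ⟨P, hP0, hPd, ?_⟩
  have h1 := congrArg L.val hP
  have h2 : (L.val.toRingHom).comp (aeval φ' : MvPolynomial α k →ₐ[k] L).toRingHom =
      (aeval φ : MvPolynomial α k →ₐ[k] K).toRingHom := by
    refine RingHom.ext fun q => MvPolynomial.comp_aeval_apply φ' L.val q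
  rw [map_zero, ← AlgHom.coe_toRingHom, eval₂_comp_left] at h1
  rw [← h2]
  have h3 : (fun o => aeval x (F o)) = L.val ∘ fun o => aeval x' (F o) :=
    funext fun o => (h _).symm
  rw [h3]
  exact h1

theorem AlgebraicIndependent.of_sumElim_over_mvPolynomial {k K μ τ : Type*} [Field k] [Field K]
    [Algebra k K] {s : μ → K} {y : τ → K} [Algebra (MvPolynomial μ k) K]
    (hy : AlgebraicIndependent k (Sum.elim s y))
    (h : ∀ q, algebraMap (MvPolynomial μ k) K q = aeval s q) :
    AlgebraicIndependent (MvPolynomial μ k) y := by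
  have hs : AlgebraicIndependent k s := by
    have h := hy.comp Sum.inl Sum.inl_injective
    rwa [Sum.elim_comp_inl] at h
  have h1 : AlgebraicIndependent k (Sum.elim y s) :=
    (algebraicIndependent_equiv' (Equiv.sumComm τ μ)
      (by funext i; rcases i with i | i <;> rfl)).2 hy
  refine (AlgebraicIndependent.sumElim_iff.1 h1).2.of_ringHom_of_comp_eq
    (hs.aevalEquiv : MvPolynomial μ k →+* Algebra.adjoin k (Set.range s)) (RingHom.id K)
    hs.aevalEquiv.injective ?_
  exact RingHom.ext fun r => (hs.algebraMap_aevalEquiv r).trans (h r).symm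

attribute [local instance] MvPolynomial.algebraMvPolynomial in
theorem exists_relation_over_base {k K μ σ α ι : Type*} [Field k]
    [CharZero k] [Field K] [Algebra k K] [Fintype σ] [Fintype α] [Fintype ι] {s : μ → K}
    {x : σ → K} (hx : AlgebraicIndependent k (Sum.elim s x)) {φ : α → K}
    (hφ : AlgebraicIndependent k (Sum.elim s φ))
    (a b : α → MvPolynomial σ (MvPolynomial μ k))
    (hb : ∀ l, (b l).eval₂ (aeval s : MvPolynomial μ k →ₐ[k] K).toRingHom x ≠ 0)
    (hab : ∀ l, φ l * (b l).eval₂ (aeval s : MvPolynomial μ k →ₐ[k] K).toRingHom x =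
      (a l).eval₂ (aeval s : MvPolynomial μ k →ₐ[k] K).toRingHom x) (w : α → ℕ)
    (hw : ∀ l, 1 ≤ w l) (haw : ∀ l, (a l).totalDegree ≤ w l) (hbw : ∀ l, (b l).totalDegree ≤ w l)
    (F : ι → MvPolynomial σ k) (d : ℕ) (hd : 1 ≤ d) (hF : ∀ o, (F o).totalDegree ≤ d)
    (hcard : Fintype.card α + Fintype.card ι = Fintype.card σ + 1) :
    ∃ P : MvPolynomial ι (MvPolynomial (μ ⊕ α) k), P ≠ 0 ∧
      P.totalDegree ≤ (∏ l, w l) * d ^ (Fintype.card ι - 1) ∧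
      P.eval₂ (aeval (Sum.elim s φ) : MvPolynomial (μ ⊕ α) k →ₐ[k] K).toRingHom
        (fun o => aeval x (F o)) = 0 := by
  have hs : AlgebraicIndependent k s := by
    have h := hx.comp Sum.inl Sum.inl_injective
    rwa [Sum.elim_comp_inl] at h
  let R := MvPolynomial μ k
  let E := FractionRing R
  let : Algebra R K := (aeval s : MvPolynomial μ k →ₐ[k] K).toRingHom.toAlgebra
  have : FaithfulSMul R K := (faithfulSMul_iff_algebraMap_injective R K).2 hs
  have : IsScalarTower k R K := IsScalarTower.of_algebraMap_eq fun r => (aeval_C s r).symm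
  let : Algebra E K := FractionRing.liftAlgebra R K
  have : IsScalarTower R E K := FractionRing.isScalarTower_liftAlgebra R K
  have : IsScalarTower k E K := IsScalarTower.of_algebraMap_eq fun r => by
    rw [IsScalarTower.algebraMap_apply k R E, ← IsScalarTower.algebraMap_apply R E K,
      ← IsScalarTower.algebraMap_apply k R K]
  have : Algebra.IsAlgebraic R E := IsLocalization.isAlgebraic _ (nonZeroDivisors R)
  have hxE := (hx.of_sumElim_over_mvPolynomial fun _ => rfl).extendScalars E
  have hφE := (hφ.of_sumElim_over_mvPolynomial fun _ => rfl).extendScalars E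
  have hev : ∀ q : MvPolynomial σ R, aeval x (MvPolynomial.map (algebraMap R E) q) =
      q.eval₂ (aeval s : MvPolynomial μ k →ₐ[k] K).toRingHom x := fun q => by
    rw [aeval_map_algebraMap]; rfl
  have hdeg : ∀ q : MvPolynomial σ R,
      (MvPolynomial.map (algebraMap R E) q).totalDegree ≤ q.totalDegree := fun q =>
    Finset.sup_mono (support_map_subset _ _)
  obtain ⟨P, hP0, hPd, hP⟩ := hxE.exists_relation_of_card_eq hφE
    (fun l => MvPolynomial.map (algebraMap R E) (a l))
    (fun l => MvPolynomial.map (algebraMap R E) (b l)) (fun l => by rw [hev]; exact hb l)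
    (fun l => by rw [hev, hev]; exact hab l) w hw (fun l => (hdeg _).trans (haw l))
    (fun l => (hdeg _).trans (hbw l)) (fun o => MvPolynomial.map (algebraMap k E) (F o)) d hd
    (fun o => (Finset.sup_mono (support_map_subset _ _)).trans (hF o)) hcard
  simp only [aeval_map_algebraMap] at hP
  obtain ⟨Q, e, hQ0, hQd, hQ⟩ := MvPolynomial.exists_map_eq_C_mul
    ((nonZeroDivisors R).map (C : R →+* MvPolynomial α R))
    (by
      rintro _ ⟨r, hr, rfl⟩
      exact mem_nonZeroDivisors_of_ne_zero
        ((map_ne_zero_iff _ (C_injective _ _)).2 (nonZeroDivisors.ne_zero hr))) P hP0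
  let θ : MvPolynomial α R ≃+* MvPolynomial (μ ⊕ α) k :=
    (sumRingEquiv k α μ).symm.trans
      (renameEquiv k (Equiv.sumComm α μ)).toRingEquiv
  refine ⟨MvPolynomial.map θ.toRingHom Q, ?_, ?_, ?_⟩
  · rw [Ne, map_eq_zero_iff _ (map_injective _ θ.injective)]
    exact hQ0
  · exact (Finset.sup_mono (support_map_subset _ _)).trans (hQd.trans hPd)
  have h1 : (aeval (Sum.elim s φ) : MvPolynomial (μ ⊕ α) k →ₐ[k] K).toRingHom.comp θ.toRingHom =
      (aeval φ : MvPolynomial α E →ₐ[E] K).toRingHom.comp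
        (MvPolynomial.map (algebraMap R E)) := by
    refine MvPolynomial.ringHom_ext (fun r => ?_) fun i => ?_
    · have h3 : θ (C r) = rename Sum.inl r := by
        have : (θ.toRingHom).comp C =
            (rename Sum.inl : MvPolynomial μ k →ₐ[k] MvPolynomial (μ ⊕ α) k).toRingHom :=
          MvPolynomial.ringHom_ext (fun q => by simp [θ, R]) fun i => by simp [θ, R]
        exact RingHom.congr_fun this r
      have h4 : aeval (Sum.elim s φ) (θ (C r)) = aeval s r := by
        rw [h3, aeval_rename, Sum.elim_comp_inl]
      refine h4.trans ?_
      simp only [RingHom.comp_apply, map_C, AlgHom.toRingHom_eq_coe, RingHom.coe_coe, aeval_C]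
      rw [← IsScalarTower.algebraMap_apply R E K]
      rfl
    · have h3 : θ (X i) = X (Sum.inr i) := by
        simp [θ, R]
      have h4 : aeval (Sum.elim s φ) (θ (X i)) = φ i := by
        rw [h3, aeval_X, Sum.elim_inr]
      refine h4.trans ?_
      simp
  rw [eval₂_map, h1, ← eval₂_map]
  have h2 := congrArg (eval₂ (aeval φ : MvPolynomial α E →ₐ[E] K).toRingHom
    fun o => aeval x (F o)) hQ
  rw [eval₂_mul] at h2
  refine h2.trans ?_
  rw [show eval₂ (aeval φ : MvPolynomial α E →ₐ[E] K).toRingHom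
    (fun o => aeval x (F o)) P = 0 from hP, mul_zero]

theorem IsIntegral.exists_algebraMap_eq {k R : Type*} [Field k] [IsAlgClosed k] [CommRing R]
    [IsDomain R] [Algebra k R] {z : R} (hz : IsIntegral k z) : ∃ c, algebraMap k R c = z := by
  obtain ⟨c, hc⟩ := (IsAlgClosed.algebraMap_bijective_of_isIntegral
    (k := k) (K := integralClosure k R)).2 ⟨z, hz⟩
  exact ⟨c, congrArg Subtype.val hc⟩

/-- If the residue classes of `f` modulo `𝔮` are algebraically dependent, then a component of a
fibre of `f` on the variety of `𝔮` has codimension less than the number of entries of `f`. -/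
theorem trd_quotient_lt_of_not_algebraicIndependent {k A ι : Type*} [Field k] [IsAlgClosed k]
    [CommRing A] [Algebra k A] [Algebra.FiniteType k A] [Finite ι] (𝔮 𝔭 : Ideal A) [𝔮.IsPrime]
    [𝔭.IsPrime] (f : ι → A) (c : ι → k)
    (h : 𝔭 ∈ (𝔮 ⊔ Ideal.span (Set.range fun i => f i - algebraMap k A (c i))).minimalPrimes)
    (hdep : ¬ AlgebraicIndependent k fun i => Ideal.Quotient.mk 𝔮 (f i)) :
    trd k (A ⧸ 𝔮) < trd k (A ⧸ 𝔭) + Nat.card ι := by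
  classical
  let F : MvPolynomial ι k →ₐ[k] A ⧸ 𝔮 := aeval fun i => Ideal.Quotient.mk 𝔮 (f i)
  let B := F.range
  have : Algebra.FiniteType k B := .of_surjective F.rangeRestrict F.rangeRestrict_surjective
  obtain ⟨s, g, hgi, hgf⟩ := exists_finite_inj_algHom_of_fg k B
  have hs : s < Nat.card ι := by
    have h1 : s ≤ trd k B := by
      simpa using ((MvPolynomial.algebraicIndependent_X (Fin s) k).map' hgi).card_le_trd
    obtain ⟨t, ht0, ht⟩ : ∃ t, t ≠ 0 ∧ F t = 0 := by
      by_contra! hcon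
      exact hdep ((injective_iff_map_eq_zero F).2 fun t ht => by
        by_contra h0
        exact hcon t h0 ht)
    have h2 := trd_lt_of_surjective F.rangeRestrict F.rangeRestrict_surjective
      (t := t) ht0 (Subtype.ext ht)
    rw [MvPolynomial.trd_eq] at h2
    exact h1.trans_lt h2
  choose z hz using fun i => F.rangeRestrict_surjective (g (X i))
  let Z : Fin s → A := fun i => aeval f (z i) - algebraMap k A (eval c (z i))
  have hFmk : ∀ q : MvPolynomial ι k, F q = Ideal.Quotient.mk 𝔮 (aeval f q) := fun q =>
    (MvPolynomial.comp_aeval_apply f (Ideal.Quotient.mkₐ k 𝔮) q).symm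
  have hfp : ∀ i, f i - algebraMap k A (c i) ∈ 𝔭 := fun i =>
    h.1.2 (Ideal.mem_sup_right (Ideal.subset_span ⟨i, rfl⟩))
  have hZp : ∀ i, Z i ∈ 𝔭 := fun i => by
    rw [← Ideal.Quotient.eq]
    have h1 : Ideal.Quotient.mk 𝔭 (aeval f (z i)) =
        aeval (fun j => Ideal.Quotient.mk 𝔭 (f j)) (z i) :=
      MvPolynomial.comp_aeval_apply f (Ideal.Quotient.mkₐ k 𝔭) (z i)
    have h2 : (fun j => Ideal.Quotient.mk 𝔭 (f j)) = fun j => algebraMap k (A ⧸ 𝔭) (c j) :=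
      funext fun j => Ideal.Quotient.eq.2 (hfp j)
    rw [h1, h2]
    exact (MvPolynomial.aeval_algebraMap_apply (A ⧸ 𝔭) c (z i))
  obtain ⟨𝔭', h𝔭', hle⟩ := Ideal.exists_minimalPrimes_le
    (I := 𝔮 ⊔ Ideal.span ((Finset.univ.image Z : Finset A) : Set A)) (J := 𝔭)
    (sup_le (le_sup_left.trans h.1.2) (Ideal.span_le.2 (by
      rw [Finset.coe_image]
      rintro _ ⟨i, -, rfl⟩
      exact hZp i)))
  have hpr : 𝔭'.IsPrime := h𝔭'.1.1
  have hq' : 𝔮 ≤ 𝔭' := le_sup_left.trans h𝔭'.1.2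
  let ψ : B →ₐ[k] A ⧸ 𝔭' := (Ideal.Quotient.factorₐ k hq').comp B.val
  have hψg : (ψ.comp g).toRingHom = (algebraMap k (A ⧸ 𝔭')).comp
      (eval fun i => eval c (z i)) := by
    refine MvPolynomial.ringHom_ext (fun r => ?_) fun i => ?_
    · refine ((ψ.comp g).commutes r).trans ?_
      simp
    · have h1 : ((g (X i) : B) : A ⧸ 𝔮) = Ideal.Quotient.mk 𝔮 (aeval f (z i)) := by
        rw [← hz, ← hFmk]; rfl
      have h2 : ψ (g (X i)) = Ideal.Quotient.mk 𝔭' (aeval f (z i)) := by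
        show Ideal.Quotient.factorₐ k hq' (g (X i) : B) = _
        rw [h1]; rfl
      have h3 : Z i ∈ 𝔭' := h𝔭'.1.2 (Ideal.mem_sup_right (Ideal.subset_span (by simp)))
      have h4 : Ideal.Quotient.mk 𝔭' (aeval f (z i)) =
        Ideal.Quotient.mk 𝔭' (algebraMap k A (eval c (z i))) := Ideal.Quotient.eq.2 h3
      simpa using h2.trans h4
  have hf' : ∀ i, f i - algebraMap k A (c i) ∈ 𝔭' := fun i => by
    let b : B := F.rangeRestrict (X i)
    have hb : ψ b = Ideal.Quotient.mk 𝔭' (f i) := by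
      show Ideal.Quotient.factorₐ k hq' (F (X i)) = _
      rw [hFmk, aeval_X]; rfl
    obtain ⟨P, hPm, hP⟩ := hgf.to_isIntegral b
    have hInt : IsIntegral k (ψ b) := by
      refine ⟨P.map (eval fun i => eval c (z i)), hPm.map _, ?_⟩
      rw [Polynomial.eval₂_map, ← hψg]
      have h1 := congrArg ψ hP
      rw [map_zero] at h1
      rw [← h1]
      exact (Polynomial.hom_eval₂ P g.toRingHom ψ.toRingHom b).symm
    obtain ⟨c', hc'⟩ := hInt.exists_algebraMap_eq
    have h1 : f i - algebraMap k A c' ∈ 𝔭' := by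
      rw [← Ideal.Quotient.eq, ← hb, ← hc']; rfl
    have h2 : algebraMap k A (c' - c i) ∈ 𝔭 := by
      have := 𝔭.sub_mem (hfp i) (hle h1)
      rw [map_sub]
      convert this using 1
      ring
    have h3 : c' - c i = 0 := by
      by_contra h0
      exact (inferInstance : 𝔭.IsPrime).ne_top (Ideal.eq_top_of_isUnit_mem _ h2
        ((IsUnit.mk0 _ h0).map (algebraMap k A)))
    rwa [sub_eq_zero.1 h3] at h1
  have heq : 𝔭 = 𝔭' := le_antisymm (h.2 ⟨hpr, sup_le hq' (Ideal.span_le.2 (by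
    rintro _ ⟨i, rfl⟩; exact hf' i))⟩ hle) hle
  subst heq
  have h5 := trd_quotient_le_of_mem_minimalPrimes (k := k) _ _ _ h𝔭'
  have h6 : (Finset.univ.image Z).card ≤ s := by
    simpa using Finset.card_image_le (s := Finset.univ) (f := Z)
  omega

theorem trd_quotient_bot (k A : Type*) [Field k] [CommRing A] [IsDomain A] [Algebra k A]
    [Algebra.FiniteType k A] : trd k (A ⧸ (⊥ : Ideal A)) = trd k A :=
  le_antisymm
    (trd_le_of_injective (AlgEquiv.quotientBot k A).toAlgHom (AlgEquiv.quotientBot k A).injective)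
    (trd_le_of_injective (AlgEquiv.quotientBot k A).symm.toAlgHom
      (AlgEquiv.quotientBot k A).symm.injective)

/-- Genericity of `ua`: no `ua i` lies in a minimal prime over `w, ua 0, …, ua (i - 1)` that does
not contain `U`. -/
def IsGenericSeq {A : Type*} [CommRing A] (w : A) (U : Set A) (ua : ℕ → A) : Prop :=
  ∀ i, ∀ Q ∈ (Ideal.span (insert w (ua '' Set.Iio i))).minimalPrimes, ¬ U ⊆ Q → ua i ∉ Q

theorem IsGenericSeq.trd_quotient_lt {k A : Type*} [Field k] [CommRing A] [IsDomain A]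
    [Algebra k A] [Algebra.FiniteType k A] {w : A} {U : Set A} {ua : ℕ → A}
    (h : IsGenericSeq w U ua) (hw : w ≠ 0) (i : ℕ) (𝔮 : Ideal A) [𝔮.IsPrime]
    (hle : Ideal.span (insert w (ua '' Set.Iio i)) ≤ 𝔮) (hU : ¬ U ⊆ 𝔮) :
    trd k (A ⧸ 𝔮) + i < trd k A := by
  induction i generalizing 𝔮 with
  | zero =>
    rw [← trd_quotient_bot k A]
    refine _root_.trd_quotient_lt (bot_lt_iff_ne_bot.2 fun h0 => hw ?_)
    rw [← Ideal.mem_bot, ← h0]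
    exact hle (Ideal.subset_span (Set.mem_insert _ _))
  | succ i ih =>
    obtain ⟨Q, hQ, hQq⟩ := Ideal.exists_minimalPrimes_le
      (I := Ideal.span (insert w (ua '' Set.Iio i))) (J := 𝔮) ((Ideal.span_mono
        (Set.insert_subset_insert (Set.image_mono (Set.Iio_subset_Iio (Nat.le_succ i))))).trans hle)
    have : Q.IsPrime := hQ.1.1
    have hUQ : ¬ U ⊆ Q := fun h => hU (h.trans hQq)
    have h1 := ih Q hQ.1.2 hUQ
    have hmem : ua i ∈ 𝔮 := hle (Ideal.subset_span (Set.mem_insert_of_mem _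
      ⟨i, Nat.lt_succ_self i, rfl⟩))
    have hlt : Q < 𝔮 := lt_of_le_of_ne hQq fun he => h i Q hQ hUQ (he ▸ hmem)
    have := _root_.trd_quotient_lt (k := k) hlt
    omega

/-- Through a component of the common zero locus of `w`, `U` and `f - c` there passes a subvariety
on which `w` does not vanish and `ua` is prescribed by powers of `w`. -/
theorem IsGenericSeq.exists_prime_le {k A ι : Type*} [Field k] [IsAlgClosed k] [CommRing A]
    [IsDomain A] [Algebra k A] [Algebra.FiniteType k A] [Finite ι] {w : A} {U : Set A}
    {ua : ℕ → A} (h : IsGenericSeq w U ua) (hw : w ≠ 0) (hua : ∀ i, ua i ∈ Ideal.span U)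
    (f : ι → A) (c : ι → k)
    (hdep : ∀ 𝔮 : Ideal A, 𝔮.IsPrime → w ∈ 𝔮 → U ⊆ 𝔮 →
      ¬ AlgebraicIndependent k fun i => Ideal.Quotient.mk 𝔮 (f i))
    (𝔭 : Ideal A) (h𝔭 : 𝔭 ∈ (Ideal.span (insert w U ∪
      Set.range fun i => f i - algebraMap k A (c i))).minimalPrimes) (M : ℕ)
    (hM : M + trd k (A ⧸ 𝔭) + Nat.card ι = trd k A) (N : Fin M → ℕ) (hN : ∀ l, 1 ≤ N l) :
    ∃ 𝔮 : Ideal A, 𝔮.IsPrime ∧ 𝔮 ≤ 𝔭 ∧ w ∉ 𝔮 ∧ ∀ l : Fin M, ua l - w ^ N l ∈ 𝔮 := by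
  classical
  have hpr : 𝔭.IsPrime := h𝔭.1.1
  have hp1 : ∀ z ∈ insert w U ∪ Set.range (fun i => f i - algebraMap k A (c i)), z ∈ 𝔭 :=
    fun z hz => h𝔭.1.2 (Ideal.subset_span hz)
  have hwp : w ∈ 𝔭 := hp1 w (Or.inl (Set.mem_insert _ _))
  have hUp : U ⊆ 𝔭 := fun z hz => hp1 z (Or.inl (Set.mem_insert_of_mem _ hz))
  let S : Finset A := Finset.univ.image fun l : Fin M => ua l - w ^ N l
  obtain ⟨𝔮, h𝔮, hle⟩ := Ideal.exists_minimalPrimes_le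
    (I := (⊥ : Ideal A) ⊔ Ideal.span (S : Set A)) (J := 𝔭) (by
      rw [bot_sup_eq, Ideal.span_le, Finset.coe_image]
      rintro _ ⟨l, -, rfl⟩
      exact 𝔭.sub_mem (Ideal.span_le.2 hUp (hua l))
        (𝔭.pow_mem_of_mem hwp _ (hN l)))
  have hpr' : 𝔮.IsPrime := h𝔮.1.1
  have hmem : ∀ l : Fin M, ua l - w ^ N l ∈ 𝔮 := fun l =>
    h𝔮.1.2 (Ideal.mem_sup_right (Ideal.subset_span (by simp [S])))
  have htr : trd k A ≤ trd k (A ⧸ 𝔮) + M := by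
    rw [← trd_quotient_bot k A]
    refine (trd_quotient_le_of_mem_minimalPrimes (k := k) _ _ _ h𝔮).trans ?_
    have : S.card ≤ M := by
      simpa using Finset.card_image_le (s := Finset.univ) (f := fun l : Fin M => ua l - w ^ N l)
    omega
  refine ⟨𝔮, hpr', hle, fun hwq => ?_, hmem⟩
  by_cases hUq : U ⊆ 𝔮
  · have hmin : 𝔭 ∈ (𝔮 ⊔ Ideal.span (Set.range fun i =>
        f i - algebraMap k A (c i))).minimalPrimes := by
      refine ⟨⟨hpr, sup_le hle (Ideal.span_le.2 fun z hz => hp1 z (Or.inr hz))⟩, ?_⟩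
      rintro 𝔭' ⟨hpr', hle'⟩ hlep
      refine h𝔭.2 ⟨hpr', Ideal.span_le.2 ?_⟩ hlep
      refine Set.union_subset (Set.insert_subset ?_ ?_) ?_
      · exact hle' (Ideal.mem_sup_left hwq)
      · exact fun z hz => hle' (Ideal.mem_sup_left (hUq hz))
      · exact fun z hz => hle' (Ideal.mem_sup_right (Ideal.subset_span hz))
    have := trd_quotient_lt_of_not_algebraicIndependent (k := k) 𝔮 𝔭 f c hmin
      (hdep 𝔮 hpr' hwq hUq)
    omega
  · have := h.trd_quotient_lt (k := k) hw M 𝔮 (Ideal.span_le.2 (Set.insert_subset hwq (by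
      rintro _ ⟨l, hl, rfl⟩
      have h1 := 𝔮.add_mem (hmem ⟨l, hl⟩) (𝔮.pow_mem_of_mem hwq _ (hN ⟨l, hl⟩))
      simpa using h1))) hUq
    have h0 : trd k (A ⧸ 𝔮) + M < trd k A := this
    omega

/-- Modulo a prime containing `w` and the multiples `u = y / w` of the components of
`y = d(F none) - ∑ i, l i • d(F i)`, the polynomials `F` become algebraically dependent. -/
theorem not_algebraicIndependent_quotient_of_mem {k A K σ τ : Type*} [Field k] [CharZero k]
    [CommRing A] [IsDomain A] [Algebra k A] [Algebra.FiniteType k A] [Field K] [Algebra A K]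
    [Algebra k K] [IsScalarTower k A K] (hinj : Function.Injective (algebraMap A K)) [Fintype σ]
    [Fintype τ] (F : Option τ → MvPolynomial σ k) (x : σ → K) (l : τ → K) (w : A) (r u : σ → A)
    (f : Option τ → A) (hw : w ≠ 0) (hr : ∀ i, algebraMap A K (r i) = x i * algebraMap A K w)
    (hu : ∀ i, algebraMap A K (u i) * algebraMap A K w =
      aeval x (pderiv i (F none)) - ∑ t, l t * aeval x (pderiv i (F (some t))))
    (hf : ∀ o, algebraMap A K (f o) = aeval x (F o)) (𝔮 : Ideal A) [𝔮.IsPrime] (hwq : w ∈ 𝔮)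
    (huq : ∀ i, u i ∈ 𝔮) : ¬ AlgebraicIndependent k fun o => Ideal.Quotient.mk 𝔮 (f o) := by
  classical
  intro hind
  let L := FractionRing A
  have : FaithfulSMul A K := (faithfulSMul_iff_algebraMap_injective A K).2 hinj
  let : Algebra L K := FractionRing.liftAlgebra A K
  have : IsScalarTower A L K := FractionRing.isScalarTower_liftAlgebra A K
  have : IsScalarTower k L K := IsScalarTower.of_algebraMap_eq fun r => by
    rw [IsScalarTower.algebraMap_apply k A L, ← IsScalarTower.algebraMap_apply A L K,
      ← IsScalarTower.algebraMap_apply k A K]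
  let ι : L →+* K := algebraMap L K
  have hι : ∀ a, ι (algebraMap A L a) = algebraMap A K a := fun a =>
    (IsScalarTower.algebraMap_apply A L K a).symm
  have hwL : algebraMap A L w ≠ 0 :=
    (map_ne_zero_iff _ (IsFractionRing.injective A L)).2 hw
  have hwK : algebraMap A K w ≠ 0 := (map_ne_zero_iff _ hinj).2 hw
  obtain ⟨D, O, M, hD, hAO, hsM, hOM, h1M, hlog⟩ := Ideal.exists_log_derivation (K := L) 𝔮 f hind
    (insert w (Finset.univ.image u)) (by
      intro a ha
      rw [Finset.mem_insert, Finset.mem_image] at ha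
      rcases ha with rfl | ⟨i, -, rfl⟩
      exacts [hwq, huq i]) ⟨w, Finset.mem_insert_self _ _, hw⟩ (fun o => o.elim 1 fun _ => 0)
  let z : σ → L := fun i => algebraMap A L (r i) * (algebraMap A L w)⁻¹
  have hz : ∀ i, ι (z i) = x i := fun i => by
    rw [map_mul, map_inv₀, hι, hι, hr, mul_inv_cancel_right₀ hwK]
  have hzF : ∀ q : MvPolynomial σ k, ι (aeval z q) = aeval x q := fun q => by
    have h1 := MvPolynomial.comp_aeval_apply z (IsScalarTower.toAlgHom k L K) q
    have h2 : (fun i => (IsScalarTower.toAlgHom k L K) (z i)) = x := funext hz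
    rw [h2] at h1
    exact h1
  have hDf : ∀ o, ∑ i, aeval x (pderiv i (F o)) * ι (D (z i)) = o.elim 1 fun _ => 0 := fun o => by
    have h1 : aeval z (F o) = algebraMap A L (f o) :=
      ι.injective (by rw [hzF, hι, hf])
    have h2 := hD o
    rw [← h1, Derivation.map_mvPolynomial_aeval] at h2
    have h3 := congrArg ι h2
    rw [map_sum] at h3
    simp only [map_mul, hzF] at h3
    rw [h3]
    cases o <;> simp
  have hone : ∑ i, algebraMap A L (w * u i) * D (z i) = 1 := by
    refine ι.injective ?_
    rw [map_sum, map_one]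
    simp only [map_mul, hι]
    have h1 : ∀ i, algebraMap A K w * algebraMap A K (u i) * ι (D (z i)) =
        aeval x (pderiv i (F none)) * ι (D (z i)) -
          ∑ t, l t * (aeval x (pderiv i (F (some t))) * ι (D (z i))) := fun i => by
      rw [mul_comm (algebraMap A K w), hu, sub_mul, Finset.sum_mul]
      simp only [mul_assoc]
    rw [Finset.sum_congr rfl fun i _ => h1 i, Finset.sum_sub_distrib, Finset.sum_comm]
    simp only [← Finset.mul_sum, hDf]
    simp
  refine h1M (hone ▸ M.sum_mem fun i _ => ?_)
  obtain ⟨b, hb, hb'⟩ := hlog _ (hAO w)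
  obtain ⟨e, he, he'⟩ := hlog _ (hAO (r i))
  have h1 : algebraMap A L (w * u i) * D (z i) =
      algebraMap A L (r i) * (e - b) * algebraMap A L (u i) := by
    have h2 : D (z i * algebraMap A L w) = D (algebraMap A L (r i)) := by
      simp only [z]
      rw [inv_mul_cancel_right₀ hwL]
    rw [Derivation.leibniz, hb', he', smul_eq_mul, smul_eq_mul] at h2
    have h3 : z i * algebraMap A L w = algebraMap A L (r i) := by
      simp only [z]
      rw [inv_mul_cancel_right₀ hwL]
    rw [map_mul]
    linear_combination algebraMap A L (u i) * h2 + algebraMap A L (u i) * b * (-h3)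
  rw [h1]
  exact hOM _ (O.mul_mem (hAO _) (O.sub_mem he hb)) _ (hsM _ (by simp))

/-- A sequence of vectors avoiding, step by step, finitely many proper subspaces that may depend on
the previous vectors. -/
theorem exists_seq_notMem {k V : Type*} [Field k] [Infinite k] [AddCommGroup V] [Module k V]
    (Bad : Set V → Set (Submodule k V)) (hfin : ∀ S, (Bad S).Finite)
    (hproper : ∀ S, ⊤ ∉ Bad S) :
    ∃ a : ℕ → V, ∀ i, ∀ W ∈ Bad (a '' Set.Iio i), a i ∉ W := by
  have hpick : ∀ S, ∃ v, ∀ W ∈ Bad S, v ∉ W := fun S => by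
    have h := Subspace.biUnion_ne_univ_of_top_notMem (s := (hfin S).toFinset)
      (by simpa using hproper S)
    obtain ⟨v, hv⟩ := (Set.ne_univ_iff_exists_notMem _).1 h
    refine ⟨v, fun W hW hvW => hv ?_⟩
    simp only [Set.mem_iUnion]
    exact ⟨W, (hfin S).mem_toFinset.2 hW, hvW⟩
  choose pick hpick using hpick
  let T : ℕ → Set V := fun i => Nat.rec ∅ (fun _ S => insert (pick S) S) i
  have hT : ∀ i, T i = (fun i => pick (T i)) '' Set.Iio i := fun i => by
    induction i with
    | zero => simp [T]
    | succ i ih =>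
      show insert (pick (T i)) (T i) = _
      have : Set.Iio (i + 1) = insert i (Set.Iio i) := by
        ext j
        simp only [Set.mem_Iio, Set.mem_insert_iff]
        omega
      rw [this, Set.image_insert_eq, ← ih]
  refine ⟨fun i => pick (T i), fun i W hW => ?_⟩
  rw [← hT] at hW
  exact hpick _ W hW

theorem linearIndependent_of_notMem_span {K V : Type*} [Field K] [AddCommGroup V] [Module K V]
    (v : ℕ → V) (m : ℕ) (h : ∀ i < m, v i ∉ Submodule.span K (v '' Set.Iio i)) :
    LinearIndependent K fun l : Fin m => v l := by
  induction m with
  | zero => exact linearIndependent_empty_type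
  | succ m ih =>
    rw [linearIndependent_finSucc']
    refine ⟨ih fun i hi => h i (by omega), fun hmem => h m (by omega) ?_⟩
    refine Submodule.span_mono ?_ hmem
    rintro _ ⟨l, rfl⟩
    exact ⟨l, l.2, rfl⟩

theorem algebraicIndependent_of_not_isAlgebraic {k R : Type*} [Field k] [CommRing R] [IsDomain R]
    [Algebra k R] (v : ℕ → R) (m : ℕ)
    (h : ∀ i < m, ¬ IsAlgebraic (Algebra.adjoin k (v '' Set.Iio i)) (v i)) :
    AlgebraicIndependent k fun l : Fin m => v l := by
  induction m with
  | zero =>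
    exact algebraicIndependent_empty_type_iff.2 (algebraMap k R).injective
  | succ m ih =>
    have h1 := ih fun i hi => h i (by omega)
    have h2 := h m (by omega)
    have h3 : v '' Set.Iio m = Set.range fun l : Fin m => v l := by
      ext z
      constructor
      · rintro ⟨l, hl, rfl⟩
        exact ⟨⟨l, hl⟩, rfl⟩
      · rintro ⟨l, rfl⟩
        exact ⟨l, l.2, rfl⟩
    rw [h3] at h2
    have h4 := (AlgebraicIndependent.option_iff_transcendental h1 (v m)).2 h2
    refine (algebraicIndependent_equiv' (f := fun o : Option (Fin m) => o.elim (v m) fun l => v l)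
      finSuccEquivLast ?_).2 h4
    funext i
    refine Fin.lastCases ?_ (fun i => ?_) i <;> simp

/-- The Jacobian matrix of algebraically independent polynomials has full rank. -/
theorem span_range_pderiv_eq_top {k K σ τ : Type*} [Field k] [CharZero k] [Field K] [Algebra k K]
    [Fintype σ] [Fintype τ] (x : σ → K) (F : τ → MvPolynomial σ k)
    (hF : AlgebraicIndependent k fun t => aeval x (F t)) :
    Submodule.span K (Set.range fun i t => aeval x (pderiv i (F t))) = ⊤ := by
  classical
  by_contra hne
  obtain ⟨φ, hφ0, hφ⟩ := Submodule.exists_le_ker_of_lt_top _ (lt_top_iff_ne_top.2 hne)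
  obtain ⟨t₀, ht₀⟩ : ∃ t, φ (Pi.single t 1) ≠ 0 := by
    by_contra! h
    refine hφ0 ((Pi.basisFun K τ).ext fun t => ?_)
    simpa using h t
  obtain ⟨D, hD⟩ := hF.exists_derivation (Pi.single t₀ 1)
  have hsum : ∀ v : τ → K, φ v = ∑ t, v t * φ (Pi.single t 1) := fun v => by
    conv_lhs => rw [pi_eq_sum_univ' v]
    rw [map_sum]
    simp only [map_smul, smul_eq_mul]
  have h1 : ∀ i, ∑ t, aeval x (pderiv i (F t)) * φ (Pi.single t 1) = 0 := fun i => by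
    rw [← hsum fun t => aeval x (pderiv i (F t))]
    exact hφ (Submodule.subset_span ⟨i, rfl⟩)
  have h2 : ∑ t, D (aeval x (F t)) * φ (Pi.single t 1) = 0 := by
    simp only [Derivation.map_mvPolynomial_aeval, Finset.sum_mul]
    rw [Finset.sum_comm]
    refine Finset.sum_eq_zero fun i _ => ?_
    have h3 := congrArg (D (x i) * ·) (h1 i)
    simp only [mul_zero, Finset.mul_sum] at h3
    rw [← h3]
    exact Finset.sum_congr rfl fun t _ => by ring
  simp only [hD] at h2
  rw [Finset.sum_eq_single t₀ (fun t _ ht => by simp [ht]) (by simp)] at h2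
  simp at h2
  exact ht₀ h2

theorem exists_isGenericSeq_linearIndependent {k A K σ τ : Type*} [Field k] [CharZero k]
    [CommRing A] [Algebra k A] [Algebra.FiniteType k A] [Field K] [Algebra k K] [Fintype σ]
    [Fintype τ] (w : A) (u : σ → A) (x : σ → K) (F : τ → MvPolynomial σ k)
    (hF : AlgebraicIndependent k fun t => aeval x (F t)) :
    ∃ a : ℕ → σ → k, IsGenericSeq w (Set.range u) (fun i => ∑ s, a i s • u s) ∧
      LinearIndependent K fun (l : Fin (Fintype.card τ)) (t : τ) =>
        ∑ s, a l s • aeval x (pderiv s (F t)) := by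
  classical
  have : IsNoetherianRing A := Algebra.FiniteType.isNoetherianRing k A
  let Lu := Fintype.linearCombination k u
  let J : σ → τ → K := fun s t => aeval x (pderiv s (F t))
  let LJ := Fintype.linearCombination k J
  let W1 : Set (σ → k) → Submodule k (σ → k) := fun S =>
    ((Submodule.span K (LJ '' S)).restrictScalars k).comap LJ
  let W2 : Ideal A → Submodule k (σ → k) := fun Q => (Q.restrictScalars k).comap Lu
  obtain ⟨a, ha⟩ := exists_seq_notMem (k := k) (V := σ → k)
    (fun S => {W | W ≠ ⊤ ∧ (W = W1 S ∨ ∃ Q ∈ (Ideal.span (insert w (Lu '' S))).minimalPrimes,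
      W = W2 Q)})
    (fun S => by
      refine Set.Finite.subset ((Set.finite_singleton (W1 S)).union
        ((Ideal.finite_minimalPrimes_of_isNoetherianRing A
          (Ideal.span (insert w (Lu '' S)))).image W2)) ?_
      rintro W ⟨-, rfl | ⟨Q, hQ, rfl⟩⟩
      · exact Or.inl rfl
      · exact Or.inr ⟨Q, hQ, rfl⟩)
    (fun S h => h.1 rfl)
  refine ⟨a, fun i Q hQ hU hmem => ?_, ?_⟩
  · have himg : (fun i => ∑ s, a i s • u s) '' Set.Iio i = Lu '' (a '' Set.Iio i) := by
      rw [Set.image_image]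
      rfl
    rw [himg] at hQ
    refine ha i (W2 Q) ⟨fun htop => hU ?_, Or.inr ⟨Q, hQ, rfl⟩⟩ hmem
    rintro _ ⟨s, rfl⟩
    have h1 : (Pi.single s 1 : σ → k) ∈ W2 Q := by rw [htop]; trivial
    have h2 : Lu (Pi.single s 1) ∈ Q := h1
    simpa [Lu, Fintype.linearCombination_apply_single] using h2
  · refine linearIndependent_of_notMem_span
      (fun i (t : τ) => ∑ s, a i s • aeval x (pderiv s (F t))) _ fun i hi hmem => ?_
    have hLJ : ∀ i, (fun t : τ => ∑ s, a i s • aeval x (pderiv s (F t))) = LJ (a i) := fun i => by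
      funext t
      simp [LJ, Fintype.linearCombination_apply, J]
    simp only [hLJ] at hmem
    rw [← Set.image_image LJ a] at hmem
    refine ha i (W1 _) ⟨fun htop => ?_, Or.inl rfl⟩ hmem
    have h1 : Submodule.span K (LJ '' (a '' Set.Iio i)) = ⊤ := by
      rw [eq_top_iff, ← span_range_pderiv_eq_top x F hF, Submodule.span_le]
      rintro _ ⟨s, rfl⟩
      have h1 : (Pi.single s 1 : σ → k) ∈ W1 (a '' Set.Iio i) := by rw [htop]; trivial
      have h2 : LJ (Pi.single s 1) ∈ Submodule.span K (LJ '' (a '' Set.Iio i)) := h1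
      simpa [LJ, Fintype.linearCombination_apply_single] using h2
    have h2 : Fintype.card τ ≤ i := by
      have h3 : LJ '' (a '' Set.Iio i) = ((Finset.range i).image fun i => LJ (a i) : Finset _) := by
        ext; simp
      have h4 := finrank_span_finset_le_card (R := K) ((Finset.range i).image fun i => LJ (a i))
      rw [← h3] at h4
      have h5 : Set.finrank K (LJ '' (a '' Set.Iio i)) = Fintype.card τ := by
        rw [Set.finrank, h1, finrank_top, Module.finrank_fintype_fun_eq_card]
      rw [h5] at h4
      exact h4.trans (Finset.card_image_le.trans (by simp))
    omega

/-- Finitely many finitely generated algebras whose generators are indexed by the same set have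
common generic linear projections. -/
theorem exists_seq_algebraicIndependent_linearCombination {k σ γ : Type*} [Field k] [Infinite k]
    [Fintype σ] [Finite γ] (B : γ → Type*) [∀ c, CommRing (B c)] [∀ c, IsDomain (B c)]
    [∀ c, Algebra k (B c)] [∀ c, Algebra.FiniteType k (B c)] (r : ∀ c, σ → B c)
    (hr : ∀ c, Algebra.adjoin k (Set.range (r c)) = ⊤) :
    ∃ a : ℕ → σ → k, ∀ c, ∀ m ≤ trd k (B c),
      AlgebraicIndependent k fun l : Fin m => ∑ s, a l s • r c s := by
  classical
  let L : ∀ c, (σ → k) →ₗ[k] B c := fun c => Fintype.linearCombination k (r c)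
  let C : ∀ c, Set (σ → k) → Submodule k (B c) := fun c S =>
    (Subalgebra.toSubmodule (Subalgebra.restrictScalars k
      (Subalgebra.algebraicClosure (Algebra.adjoin k (L c '' S)) (B c))))
  obtain ⟨a, ha⟩ := exists_seq_notMem (k := k) (V := σ → k)
    (fun S => {W | W ≠ ⊤ ∧ ∃ c, W = (C c S).comap (L c)})
    (fun S => by
      refine (Set.finite_range fun c => (C c S).comap (L c)).subset ?_
      rintro W ⟨-, c, rfl⟩
      exact ⟨c, rfl⟩)
    (fun S h => h.1 rfl)
  refine ⟨a, fun c m hm => ?_⟩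
  refine algebraicIndependent_of_not_isAlgebraic (fun l => ∑ s, a l s • r c s) m fun i hi halg => ?_
  have himg : (fun i => ∑ s, a i s • r c s) '' Set.Iio i = L c '' (a '' Set.Iio i) := by
    rw [Set.image_image]
    rfl
  rw [himg] at halg
  refine ha i _ ⟨fun htop => ?_, c, rfl⟩ halg
  have h1 : Algebra.IsAlgebraic (Algebra.adjoin k (L c '' (a '' Set.Iio i))) (B c) := by
    have h2 : (⊤ : Subalgebra k (B c)) ≤ Subalgebra.restrictScalars k
      (Subalgebra.algebraicClosure (Algebra.adjoin k (L c '' (a '' Set.Iio i))) (B c)) := by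
      rw [← hr c, Algebra.adjoin_le_iff]
      rintro _ ⟨s, rfl⟩
      have h3 : (Pi.single s 1 : σ → k) ∈ (C c (a '' Set.Iio i)).comap (L c) := by
        rw [htop]; trivial
      have h4 : L c (Pi.single s 1) ∈ C c (a '' Set.Iio i) := h3
      simpa [L, C, Fintype.linearCombination_apply_single] using h4
    exact ⟨fun z => h2 (Algebra.mem_top (x := z))⟩
  have h2 := Algebra.IsAlgebraic.trdeg_le_cardinalMk k (L c '' (a '' Set.Iio i))
  have h3 : trd k (B c) ≤ i := by
    have hfin : (L c '' (a '' Set.Iio i)).Finite := ((Set.finite_Iio i).image a).image _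
    have h4 := Cardinal.toNat_le_toNat h2 (by
      have := hfin.to_subtype
      exact Cardinal.lt_aleph0_of_finite _)
    refine h4.trans ?_
    change Set.ncard _ ≤ i
    refine (Set.ncard_image_le ((Set.finite_Iio i).image a)).trans
      ((Set.ncard_image_le (Set.finite_Iio i)).trans ?_)
    simp
  omega

theorem MvPolynomial.totalDegree_det_le {σ R ι : Type*} [CommRing R] [Fintype ι] [DecidableEq ι]
    (M : Matrix ι ι (MvPolynomial σ R)) (e : ℕ) (h : ∀ i j, (M i j).totalDegree ≤ e) :
    M.det.totalDegree ≤ Fintype.card ι * e := by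
  rw [Matrix.det_apply]
  refine totalDegree_finsetSum_le fun τ _ => ?_
  refine (totalDegree_smul_le _ _).trans ((totalDegree_finsetProd _ _).trans ?_)
  exact (Finset.sum_le_sum fun i _ => h _ _).trans (by simp)

theorem MvPolynomial.totalDegree_pderiv_le {σ R : Type*} [CommRing R] (i : σ)
    (p : MvPolynomial σ R) : (pderiv i p).totalDegree ≤ p.totalDegree - 1 := by
  classical
  conv_lhs => rw [p.as_sum, map_sum]
  refine totalDegree_finsetSum_le fun s hs => ?_
  rw [pderiv_monomial]
  by_cases hsi : s i = 0
  · simp [hsi]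
  refine (totalDegree_monomial_le _ _).trans ?_
  have h1 : (s.sum fun _ e => e) ≤ p.totalDegree := le_totalDegree hs
  have h2 : s = (s - Finsupp.single i 1) + Finsupp.single i 1 := by
    refine (tsub_add_cancel_of_le ?_).symm
    rw [Finsupp.single_le_iff]
    omega
  have h3 : (s.sum fun _ e => e) = ((s - Finsupp.single i 1).sum fun _ e => e) + 1 := by
    conv_lhs => rw [h2, Finsupp.sum_add_index' (fun _ => rfl) (fun _ _ _ => rfl)]
    rw [Finsupp.sum_single_index rfl]
  change ((s - Finsupp.single i 1).sum fun _ e => e) ≤ _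
  omega

theorem Matrix.isAlgebraic_of_mulVec_eq {R K τ : Type*} [CommRing R] [Field K] [Algebra R K]
    [IsDomain R] [Fintype τ] [DecidableEq τ] (M : Matrix τ τ R) (b : τ → R) (lam : τ → K)
    (hM : algebraMap R K M.det ≠ 0)
    (h : (M.map (algebraMap R K)).mulVec lam = fun t => algebraMap R K (b t)) (t : τ) :
    IsAlgebraic R (lam t) := by
  have h1 : algebraMap R K M.det * lam t = algebraMap R K ((M.adjugate.mulVec b) t) := by
    have h2 := congrArg (fun v => ((M.map (algebraMap R K)).adjugate.mulVec v) t) h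
    simp only [Matrix.mulVec_mulVec, Matrix.adjugate_mul, Matrix.smul_mulVec, Matrix.one_mulVec,
      Pi.smul_apply, smul_eq_mul] at h2
    rw [← RingHom.mapMatrix_apply, ← RingHom.map_det, ← RingHom.map_adjugate] at h2
    rw [h2]
    simp [Matrix.mulVec, dotProduct]
  have h3 : lam t = (algebraMap R K M.det)⁻¹ * algebraMap R K ((M.adjugate.mulVec b) t) := by
    rw [← h1, inv_mul_cancel_left₀ hM]
  have : Nontrivial R := inferInstance
  rw [h3]
  exact (isAlgebraic_algebraMap _).inv.mul (isAlgebraic_algebraMap _)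

/-- If `lam` solves a nonsingular linear system with coefficients in `k[s, x]`, then `lam` may be
replaced by `s` in a transcendence basis. -/
theorem IsTranscendenceBasis.algebraicIndependent_of_mulVec_eq {k K σ τ : Type*} [Field k]
    [Field K] [Algebra k K] [Fintype σ] [Fintype τ] [DecidableEq τ] {x : σ → K} {lam : τ → K}
    (hx : IsTranscendenceBasis k (Sum.elim x lam)) (s : τ → K) (M : Matrix τ τ K) (b : τ → K)
    (hMs : ∀ i j, M i j ∈ Algebra.adjoin k (Set.range (Sum.elim s x)))
    (hbs : ∀ i, b i ∈ Algebra.adjoin k (Set.range (Sum.elim s x))) (hM : M.det ≠ 0)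
    (h : M.mulVec lam = b) : AlgebraicIndependent k (Sum.elim s x) := by
  let R := Algebra.adjoin k (Set.range (Sum.elim s x))
  let M' : Matrix τ τ R := fun i j => ⟨M i j, hMs i j⟩
  have hM' : M'.map (algebraMap R K) = M := rfl
  have hlam := Matrix.isAlgebraic_of_mulVec_eq M' (fun i => ⟨b i, hbs i⟩) lam (by
    rwa [RingHom.map_det, RingHom.mapMatrix_apply, hM']) (by rw [hM', h]; rfl)
  have halg : Algebra.IsAlgebraic R K := ⟨fun z => by
    refine IsAlgebraic.adjoin_of_forall_isAlgebraic ?_ (hx.isAlgebraic.isAlgebraic z)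
    rintro _ ⟨⟨i | t, rfl⟩, -⟩
    · exact isAlgebraic_algebraMap (⟨x i, Algebra.subset_adjoin ⟨Sum.inr i, rfl⟩⟩ : R)
    · exact hlam t⟩
  refine (Algebra.IsAlgebraic.isTranscendenceBasis_of_lift_le_trdeg_of_finite k (Sum.elim s x)
    ?_).1
  rw [← hx.lift_cardinalMk_eq_trdeg]
  simp [add_comm]

theorem Matrix.det_fromBlocks_mulVec {K τ : Type*} [Field K] [Fintype τ] [DecidableEq τ]
    (M : Matrix τ τ K) (hM : M.det ≠ 0) (lam row : τ → K) (z : K) :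
    (Matrix.fromBlocks M (fun l (_ : Unit) => M.mulVec lam l) (fun _ t => row t)
      (fun _ _ => z)).det = M.det * (z - ∑ t, row t * lam t) := by
  have hinv : Invertible M := Matrix.invertibleOfIsUnitDet _ (isUnit_iff_ne_zero.2 hM)
  have hv : (fun l (_ : Unit) => M.mulVec lam l) =
    M * (Matrix.of fun t (_ : Unit) => lam t) := rfl
  have h := Matrix.det_fromBlocks₁₁ M (M * (Matrix.of fun t (_ : Unit) => lam t))
    (Matrix.of fun (_ : Unit) t => row t) (Matrix.of fun (_ : Unit) (_ : Unit) => z)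
  rw [Matrix.mul_assoc, Matrix.invOf_mul_cancel_left, Matrix.det_unique (n := Unit)] at h
  rw [hv]
  exact h

set_option maxHeartbeats 1000000 in
/-- The relation between the values `f = F x` and the functions `w = 1 / ℓ(x)`, `y`, `L(x) / ℓ(x)`,
where `y` runs over linear combinations of the components of
`d(F none) - ∑ i, lam i • d(F i)`. -/
theorem exists_relation_of_multipliers {k K σ τ β κ : Type*} [Field k] [CharZero k] [Field K]
    [Algebra k K] [Fintype σ] [Fintype τ] [Fintype β] [Fintype κ] {x : σ → K} {lam : τ → K}
    (hx : IsTranscendenceBasis k (Sum.elim x lam)) (F : Option τ → MvPolynomial σ k) (d q : ℕ)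
    (hd : 1 ≤ d) (hF : ∀ o, (F o).totalDegree ≤ d) (hq : 1 ≤ q)
    (hdq : (Fintype.card τ + 1) * (d - 1) ≤ q) (Y : (σ → k) → K)
    (hY : ∀ a, Y a = ∑ s, a s • (aeval x (pderiv s (F none)) -
      ∑ t, lam t * aeval x (pderiv s (F (some t)))))
    (a : τ → σ → k) (ha : LinearIndependent K fun (l : τ) (t : τ) =>
        ∑ s, a l s • aeval x (pderiv s (F (some t)))) (a' : β → σ → k) (ell : σ → k)
    (hell : ∑ s, ell s • x s ≠ 0) (L : κ → σ → k)
    (hind : AlgebraicIndependent k (Sum.elim (fun l => Y (a l)) (Sum.elim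
      (fun o : Option β => o.elim (∑ s, ell s • x s)⁻¹ fun b => Y (a' b))
      (fun i => (∑ s, L i s • x s) * (∑ s, ell s • x s)⁻¹))))
    (hcard : Fintype.card β + Fintype.card κ + Fintype.card τ + 1 = Fintype.card σ) :
    ∃ P : MvPolynomial (Option τ) (MvPolynomial (τ ⊕ (Option β ⊕ κ)) k), P ≠ 0 ∧
      P.totalDegree ≤ q ^ Fintype.card β * d ^ Fintype.card τ ∧
      P.eval₂ (aeval (Sum.elim (fun l => Y (a l)) (Sum.elim
        (fun o : Option β => o.elim (∑ s, ell s • x s)⁻¹ fun b => Y (a' b))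
        (fun i => (∑ s, L i s • x s) * (∑ s, ell s • x s)⁻¹))) : _ →ₐ[k] K).toRingHom
        (fun o => aeval x (F o)) = 0 := by
  classical
  let R := MvPolynomial τ k
  let s : τ → K := fun l => Y (a l)
  let e : MvPolynomial σ R →+* K := eval₂Hom (aeval s : R →ₐ[k] K).toRingHom x
  let ι : MvPolynomial σ k →+* MvPolynomial σ R := MvPolynomial.map C
  have hι : ∀ p, e (ι p) = aeval x p := fun p => by
    simp only [e, ι, coe_eval₂Hom, eval₂_map]
    rw [aeval_def]
    congr 1
    ext z
    exact (aeval s).commutes z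
  have hιd : ∀ p, (ι p).totalDegree ≤ p.totalDegree := fun p =>
    Finset.sup_mono (support_map_subset _ _)
  let G : (σ → k) → Option τ → MvPolynomial σ k := fun a o => ∑ s, a s • pderiv s (F o)
  have hGd : ∀ a o, (G a o).totalDegree ≤ d - 1 := fun a o =>
    totalDegree_finsetSum_le fun i _ => (totalDegree_smul_le _ _).trans
      ((totalDegree_pderiv_le _ _).trans (Nat.sub_le_sub_right (hF o) 1))
  have hGx : ∀ a o, aeval x (G a o) = ∑ s, a s • aeval x (pderiv s (F o)) := fun a o => by
    simp [G, map_sum]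
  have hYG : ∀ a, Y a = aeval x (G a none) - ∑ t, aeval x (G a (some t)) * lam t := fun a => by
    rw [hY, hGx]
    simp only [hGx, smul_sub, Finset.sum_sub_distrib, Finset.sum_mul, Finset.smul_sum]
    rw [Finset.sum_comm]
    refine congrArg _ (Finset.sum_congr rfl fun t _ => Finset.sum_congr rfl fun i _ => ?_)
    rw [smul_mul_assoc, mul_comm]
  let M : Matrix τ τ (MvPolynomial σ R) := fun l t => ι (G (a l) (some t))
  let v : Matrix τ Unit (MvPolynomial σ R) := fun l _ => ι (G (a l) none) - C (X l)
  have hMK : ∀ l t, (e.mapMatrix M) l t = ∑ s, a l s • aeval x (pderiv s (F (some t))) :=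
    fun l t => by
      change e (ι _) = _
      rw [hι, hGx]
  have hdet : (e.mapMatrix M).det ≠ 0 := by
    rw [← isUnit_iff_ne_zero, ← Matrix.isUnit_iff_isUnit_det,
      ← Matrix.linearIndependent_rows_iff_isUnit]
    convert ha using 1
    funext l t
    exact hMK l t
  have heC : ∀ l, e (C (X l)) = s l := fun l =>
    (eval₂_C _ _ _).trans (aeval_X s l)
  have hsys : (e.mapMatrix M).mulVec lam = fun l => e (v l ()) := by
    funext l
    simp only [v, map_sub, heC, hι, s, hYG, sub_sub_cancel]
    refine Finset.sum_congr rfl fun t _ => ?_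
    change e (ι _) * _ = _
    rw [hι]
  have hmem : ∀ p : MvPolynomial σ k, aeval x p ∈ Algebra.adjoin k (Set.range (Sum.elim s x)) :=
    fun p => by
      refine Algebra.adjoin_mono (s := Set.range x) ?_ ?_
      · rintro _ ⟨i, rfl⟩
        exact ⟨Sum.inr i, rfl⟩
      · rw [Algebra.adjoin_range_eq_range_aeval]
        exact ⟨p, rfl⟩
  have hsx : AlgebraicIndependent k (Sum.elim s x) :=
    hx.algebraicIndependent_of_mulVec_eq s (e.mapMatrix M) _
      (fun l t => by change e (ι _) ∈ _; rw [hι]; exact hmem _)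
      (fun l => by
        simp only [v, map_sub, heC, hι]
        exact sub_mem (hmem _) (Algebra.subset_adjoin ⟨Sum.inl l, rfl⟩)) hdet hsys
  have hedet : e M.det ≠ 0 := by rwa [RingHom.map_det]
  let N : β → Matrix (τ ⊕ Unit) (τ ⊕ Unit) (MvPolynomial σ R) := fun b =>
    Matrix.fromBlocks M v (fun _ t => ι (G (a' b) (some t))) (fun _ _ => ι (G (a' b) none))
  have hN : ∀ b, Y (a' b) * e M.det = e (N b).det := fun b => by
    have hNe : e.mapMatrix (N b) = Matrix.fromBlocks (e.mapMatrix M)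
        (fun l _ => (e.mapMatrix M).mulVec lam l) (fun _ t => aeval x (G (a' b) (some t)))
        (fun _ _ => aeval x (G (a' b) none)) := by
      refine Matrix.ext ?_
      rintro (i | i) (j | j)
      · rfl
      · exact (congrFun hsys i).symm
      · exact hι _
      · exact hι _
    rw [RingHom.map_det, RingHom.map_det, hNe, Matrix.det_fromBlocks_mulVec _ hdet, mul_comm, hYG]
  have hMd : M.det.totalDegree ≤ q := by
    refine (totalDegree_det_le M (d - 1) fun i j => (hιd _).trans (hGd _ _)).trans
      (le_trans ?_ hdq)
    exact Nat.mul_le_mul_right _ (Nat.le_succ _)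
  have hNd : ∀ b, (N b).det.totalDegree ≤ q := fun b => by
    refine (totalDegree_det_le (N b) (d - 1) ?_).trans (le_trans (by simp) hdq)
    rintro (i | i) (j | j)
    · exact (hιd _).trans (hGd _ _)
    · refine (totalDegree_sub _ _).trans (max_le ((hιd _).trans (hGd _ _)) ?_)
      simp
    · exact (hιd _).trans (hGd _ _)
    · exact (hιd _).trans (hGd _ _)
  let lin : (σ → k) → MvPolynomial σ R := fun a => ι (∑ s, a s • X s)
  have hlin : ∀ a, e (lin a) = ∑ s, a s • x s := fun a => by simp [lin, hι]
  have hlind : ∀ a, (lin a).totalDegree ≤ 1 := fun a =>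
    (hιd _).trans (totalDegree_finsetSum_le fun i _ => (totalDegree_smul_le _ _).trans
      (by simp))
  obtain ⟨P, hP0, hPd, hP⟩ := exists_relation_over_base hsx hind
    (Sum.elim (fun o : Option β => o.elim 1 fun b => (N b).det) fun i => lin (L i))
    (Sum.elim (fun o : Option β => o.elim (lin ell) fun _ => M.det) fun _ => lin ell)
    (by
      rintro ((_ | b) | i)
      · exact (hlin ell).trans_ne hell
      · exact hedet
      · exact (hlin ell).trans_ne hell)
    (by
      rintro ((_ | b) | i)
      · change _ * e (lin ell) = e 1
        rw [hlin, map_one]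
        exact inv_mul_cancel₀ hell
      · exact hN b
      · change _ * e (lin ell) = e (lin (L i))
        rw [hlin, hlin]
        exact inv_mul_cancel_right₀ hell _)
    (Sum.elim (fun o : Option β => o.elim 1 fun _ => q) fun _ => 1)
    (by rintro ((_ | b) | i); exacts [le_rfl, hq, le_rfl])
    (by
      rintro ((_ | b) | i)
      · simp
      · exact hNd b
      · exact hlind _)
    (by
      rintro ((_ | b) | i)
      · exact hlind _
      · exact hMd
      · exact hlind _)
    F d hd hF (by simp only [Fintype.card_sum, Fintype.card_option]; omega)
  refine ⟨P, hP0, hPd.trans (le_of_eq ?_), hP⟩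
  simp

/-- The point `c` is approached along `f` by integral schemes on which `y` is prescribed by powers
of the nonvanishing function `w`, and `r` is generic at the limit. -/
def IsApproached {k A μ κ ι : Type*} [Field k] [CommRing A] [Algebra k A] (w : A) (y : μ → A)
    (r : κ → A) (f : ι → A) (c : ι → k) : Prop :=
  ∀ N : μ → ℕ, (∀ l, 2 ≤ N l) → ∃ 𝔮 𝔭 : Ideal A, 𝔮.IsPrime ∧ 𝔭.IsPrime ∧ 𝔮 ≤ 𝔭 ∧ w ∉ 𝔮 ∧ w ∈ 𝔭 ∧
    (∀ l, y l - w ^ N l ∈ 𝔮) ∧ (∀ i, f i - algebraMap k A (c i) ∈ 𝔭) ∧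
    AlgebraicIndependent k fun i => Ideal.Quotient.mk 𝔭 (r i)

theorem IsApproached.exists_eval_eq_zero {k ι μ μ' κ : Type*} {A : Type u} [Field k] [Infinite k]
    [Finite μ] [Finite μ'] [CommRing A] [Algebra k A] (w : A) (y : μ ⊕ μ' → A) (r : κ → A)
    (f : ι → A) (P : MvPolynomial ι (MvPolynomial (μ ⊕ (Option μ' ⊕ κ)) k)) (hP : P ≠ 0)
    (hrel : P.eval₂ (aeval (Sum.elim (fun l => y (Sum.inl l)) (Sum.elim (fun o : Option _ => o.elim w
          fun l => y (Sum.inr l)) r)) : _ →ₐ[k] A).toRingHom f = 0) :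
    ∃ g : MvPolynomial ι k, g ≠ 0 ∧ g.totalDegree ≤ P.totalDegree ∧
      ∀ c, IsApproached w y r f c → eval c g = 0 := by
  obtain ⟨N, g, hN, hg0, hgd, hg⟩ := exists_specialized_relation.{u} P hP
  refine ⟨g, hg0, hgd, fun c hc => ?_⟩
  obtain ⟨𝔮, 𝔭, h𝔮, h𝔭, hle, hwq, hwp, hy, hf, hr⟩ := hc N hN
  exact hg 𝔮 𝔭 w y r f c hle hwq hwp hy hf hr hrel

theorem IsApproached.algebraicIndependent {k ι μ μ' κ : Type*} {A : Type u} [Field k] [Infinite k]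
    [Finite μ] [Finite μ'] [CommRing A] [Algebra k A] {w : A} {y : μ ⊕ μ' → A} {r : κ → A}
    {f : ι → A} {c : ι → k} (hc : IsApproached w y r f c) :
    AlgebraicIndependent k (Sum.elim (fun l => y (Sum.inl l)) (Sum.elim (fun o : Option μ' => o.elim w
      fun l => y (Sum.inr l)) r)) := by
  rw [algebraicIndependent_iff]
  intro q hq
  by_contra hq0
  obtain ⟨g, hg0, hgd, hg⟩ := exists_eval_eq_zero w y r f (C q : MvPolynomial ι _)
    (by rwa [Ne, C_eq_zero]) (by rw [eval₂_C]; exact hq)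
  rw [totalDegree_C, Nat.le_zero, totalDegree_eq_zero_iff_eq_C] at hgd
  have h := hg c hc
  rw [hgd, eval_C] at h
  rw [h, C_0] at hgd
  exact hg0 hgd

theorem MvPolynomial.algebraMap_eval₂_aeval {k A K ι ν : Type*} [Field k] [CommRing A] [Field K]
    [Algebra k A] [Algebra k K] [Algebra A K] [IsScalarTower k A K] (z : ν → A) (f : ι → A)
    (P : MvPolynomial ι (MvPolynomial ν k)) :
    algebraMap A K (P.eval₂ (aeval z : _ →ₐ[k] A).toRingHom f) =
      P.eval₂ (aeval (fun i => algebraMap A K (z i)) : _ →ₐ[k] K).toRingHom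
        (fun i => algebraMap A K (f i)) := by
  rw [hom_eval₂]
  congr 1
  refine MvPolynomial.ringHom_ext (fun a => ?_) fun i => ?_
  · simp [IsScalarTower.algebraMap_apply k A K a]
  · simp

/-- Bound for the points approached in families where all multipliers are prescribed. -/
theorem exists_vanishing_of_multipliers {k K σ τ β κ : Type*} {A : Type u} [Field k] [CharZero k]
    [Field K] [Algebra k K] [CommRing A] [Algebra k A] [Algebra A K] [IsScalarTower k A K]
    (hinj : Function.Injective (algebraMap A K)) [Fintype σ] [Fintype τ] [Fintype β] [Fintype κ]
    {x : σ → K} {lam : τ → K} (hx : IsTranscendenceBasis k (Sum.elim x lam))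
    (F : Option τ → MvPolynomial σ k) (d q : ℕ) (hd : 1 ≤ d) (hF : ∀ o, (F o).totalDegree ≤ d)
    (hq : 1 ≤ q) (hdq : (Fintype.card τ + 1) * (d - 1) ≤ q) (ell : σ → k)
    (hell : ∑ s, ell s • x s ≠ 0) (w : A) (r u : σ → A) (f : Option τ → A)
    (hw : algebraMap A K w = (∑ s, ell s • x s)⁻¹)
    (hr : ∀ i, algebraMap A K (r i) = x i * (∑ s, ell s • x s)⁻¹)
    (hu : ∀ i, algebraMap A K (u i) * (∑ s, ell s • x s)⁻¹ =
      aeval x (pderiv i (F none)) - ∑ t, lam t * aeval x (pderiv i (F (some t))))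
    (hf : ∀ o, algebraMap A K (f o) = aeval x (F o))
    (a : τ → σ → k) (ha : LinearIndependent K fun (l : τ) (t : τ) =>
        ∑ s, a l s • aeval x (pderiv s (F (some t)))) (a' : β → σ → k) (L : κ → σ → k)
    (hcard : Fintype.card β + Fintype.card κ + Fintype.card τ + 1 = Fintype.card σ) :
    ∃ g : MvPolynomial (Option τ) k, g ≠ 0 ∧
      g.totalDegree ≤ q ^ Fintype.card β * d ^ Fintype.card τ ∧
      ∀ c, IsApproached w (fun l : τ ⊕ β => (∑ s, (Sum.elim a a' l) s • u s) * w)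
        (fun i => ∑ s, L i s • r s) f c → eval c g = 0 := by
  by_cases hex : ∃ c : Option τ → k,
      IsApproached w (fun l : τ ⊕ β => (∑ s, (Sum.elim a a' l) s • u s) * w)
        (fun i => ∑ s, L i s • r s) f c
  swap
  · exact ⟨1, one_ne_zero, by simp, fun c hc => (hex ⟨c, hc⟩).elim⟩
  obtain ⟨c, hc⟩ := hex
  have hk : ∀ (z : k) (b : A), algebraMap A K (z • b) = z • algebraMap A K b := fun z b =>
    map_smul (IsScalarTower.toAlgHom k A K) z b
  let Y : (σ → k) → K := fun a => ∑ s, a s • (aeval x (pderiv s (F none)) -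
      ∑ t, lam t * aeval x (pderiv s (F (some t))))
  have hY : ∀ a : σ → k, algebraMap A K ((∑ s, a s • u s) * w) = Y a := fun a => by
    simp only [map_mul, map_sum, hk, hw, Y, ← hu, Finset.sum_mul, smul_mul_assoc]
  have hfun : (fun j => algebraMap A K (Sum.elim
      (fun l => (fun l : τ ⊕ β => (∑ s, (Sum.elim a a' l) s • u s) * w) (Sum.inl l))
      (Sum.elim (fun o : Option _ => o.elim w
        fun l => (fun l : τ ⊕ β => (∑ s, (Sum.elim a a' l) s • u s) * w) (Sum.inr l))
        (fun i => ∑ s, L i s • r s)) j)) =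
      Sum.elim (fun l => Y (a l)) (Sum.elim
      (fun o : Option β => o.elim (∑ s, ell s • x s)⁻¹ fun b => Y (a' b))
      (fun i => (∑ s, L i s • x s) * (∑ s, ell s • x s)⁻¹)) := by
    funext j
    rcases j with l | (_ | b) | i
    · exact hY _
    · exact hw
    · exact hY _
    · simp only [Sum.elim_inr, map_sum, hk, hr, Finset.sum_mul, smul_mul_assoc]
  have hind := hc.algebraicIndependent.map' (f := IsScalarTower.toAlgHom k A K) hinj
  have hind' : AlgebraicIndependent k (Sum.elim (fun l => Y (a l)) (Sum.elim
      (fun o : Option β => o.elim (∑ s, ell s • x s)⁻¹ fun b => Y (a' b))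
      (fun i => (∑ s, L i s • x s) * (∑ s, ell s • x s)⁻¹))) := by
    rw [← hfun]
    exact hind
  obtain ⟨P, hP0, hPd, hP⟩ := exists_relation_of_multipliers hx F d q hd hF hq hdq Y (fun _ => rfl)
    a ha a' ell hell L hind' hcard
  obtain ⟨g, hg0, hgd, hg⟩ := IsApproached.exists_eval_eq_zero w
    (fun l : τ ⊕ β => (∑ s, (Sum.elim a a' l) s • u s) * w) (fun i => ∑ s, L i s • r s) f P hP0
    (hinj (by
      rw [MvPolynomial.algebraMap_eval₂_aeval, map_zero, hfun, ← hP]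
      simp only [hf]))
  exact ⟨g, hg0, hgd.trans hPd, hg⟩

/-- Bound for the points approached in families where nothing is prescribed. -/
theorem exists_vanishing_of_generic {k K σ ι κ : Type*} {A : Type u} [Field k] [CharZero k]
    [Field K] [Algebra k K] [CommRing A] [Algebra k A] [Algebra A K] [IsScalarTower k A K]
    (hinj : Function.Injective (algebraMap A K)) [Fintype σ] [Fintype ι] [Fintype κ]
    {x : σ → K} (hx : AlgebraicIndependent k x)
    (F : ι → MvPolynomial σ k) (d : ℕ) (hd : 1 ≤ d) (hF : ∀ o, (F o).totalDegree ≤ d)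
    (ell : σ → k) (hell : ∑ s, ell s • x s ≠ 0) (w : A) (r : σ → A) (f : ι → A)
    (hw : algebraMap A K w = (∑ s, ell s • x s)⁻¹)
    (hr : ∀ i, algebraMap A K (r i) = x i * (∑ s, ell s • x s)⁻¹)
    (hf : ∀ o, algebraMap A K (f o) = aeval x (F o)) (L : κ → σ → k)
    (hcard : Fintype.card κ + Fintype.card ι = Fintype.card σ) :
    ∃ g : MvPolynomial ι k, g ≠ 0 ∧ g.totalDegree ≤ d ^ (Fintype.card ι - 1) ∧
      ∀ c, IsApproached w (Empty.elim : Empty → A) (fun i => ∑ s, L i s • r s) f c →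
        eval c g = 0 := by
  classical
  by_cases hex : ∃ c : ι → k,
      IsApproached w (Empty.elim : Empty → A) (fun i => ∑ s, L i s • r s) f c
  swap
  · exact ⟨1, one_ne_zero, by simp, fun c hc => (hex ⟨c, hc⟩).elim⟩
  have happ : ∀ c : ι → k, IsApproached w (Empty.elim : Empty → A) (fun i => ∑ s, L i s • r s) f c →
      IsApproached w (Sum.elim Empty.elim Empty.elim : Empty ⊕ Empty → A)
        (fun i => ∑ s, L i s • r s) f c := fun c hc N hN => by
    obtain ⟨𝔮, 𝔭, h⟩ := hc (fun l => N (Sum.inl l)) fun l => hN _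
    refine ⟨𝔮, 𝔭, h.1, h.2.1, h.2.2.1, h.2.2.2.1, h.2.2.2.2.1, ?_, h.2.2.2.2.2.2⟩
    rintro (l | l) <;> exact l.elim
  obtain ⟨c, hc⟩ := hex
  have hk : ∀ (z : k) (b : A), algebraMap A K (z • b) = z • algebraMap A K b := fun z b =>
    map_smul (IsScalarTower.toAlgHom k A K) z b
  have hfun : (fun j => algebraMap A K (Sum.elim
      (fun l => (Sum.elim Empty.elim Empty.elim : Empty ⊕ Empty → A) (Sum.inl l))
      (Sum.elim (fun o : Option _ => o.elim w
        fun l => (Sum.elim Empty.elim Empty.elim : Empty ⊕ Empty → A) (Sum.inr l))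
        (fun i => ∑ s, L i s • r s)) j)) =
      Sum.elim (Empty.elim : Empty → K) (Sum.elim
      (fun o : Option Empty => o.elim (∑ s, ell s • x s)⁻¹ Empty.elim)
      (fun i => (∑ s, L i s • x s) * (∑ s, ell s • x s)⁻¹)) := by
    funext j
    rcases j with l | (_ | b) | i
    · exact l.elim
    · exact hw
    · exact b.elim
    · simp only [Sum.elim_inr, map_sum, hk, hr, Finset.sum_mul, smul_mul_assoc]
  have hind := (happ c hc).algebraicIndependent.map' (f := IsScalarTower.toAlgHom k A K) hinj
  have hind' : AlgebraicIndependent k (Sum.elim (Empty.elim : Empty → K) (Sum.elim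
      (fun o : Option Empty => o.elim (∑ s, ell s • x s)⁻¹ Empty.elim)
      (fun i => (∑ s, L i s • x s) * (∑ s, ell s • x s)⁻¹))) := by
    rw [← hfun]
    exact hind
  have hx' : AlgebraicIndependent k (Sum.elim (Empty.elim : Empty → K) x) := by
    refine (algebraicIndependent_equiv' (Equiv.emptySum Empty σ).symm ?_).1 hx
    funext i
    simp
  let lin : (σ → k) → MvPolynomial σ (MvPolynomial Empty k) := fun a => ∑ s, C (C (a s)) * X s
  have hlin : ∀ a, (lin a).eval₂ (aeval (Empty.elim : Empty → K) :
      MvPolynomial Empty k →ₐ[k] K).toRingHom x = ∑ s, a s • x s := fun a => by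
    simp only [lin, eval₂_sum, eval₂_mul, eval₂_C, eval₂_X]
    refine Finset.sum_congr rfl fun i _ => ?_
    rw [Algebra.smul_def]
    congr 1
    exact (aeval (Empty.elim : Empty → K)).commutes (a i)
  have hlind : ∀ a, (lin a).totalDegree ≤ 1 := fun a =>
    totalDegree_finsetSum_le fun i _ => (totalDegree_mul _ _).trans (by simp)
  obtain ⟨P, hP0, hPd, hP⟩ := exists_relation_over_base hx' hind'
    (Sum.elim (fun _ => 1) fun i => lin (L i)) (fun _ => lin ell)
    (fun _ => (hlin ell).trans_ne hell)
    (by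
      rintro ((_ | b) | i)
      · rw [hlin]
        simp only [Sum.elim_inl, eval₂_one]
        exact inv_mul_cancel₀ hell
      · exact b.elim
      · rw [hlin]
        simp only [Sum.elim_inr, hlin]
        exact inv_mul_cancel_right₀ hell _)
    (fun _ => 1) (fun _ => le_rfl)
    (by
      rintro (o | i)
      · simp
      · exact hlind _)
    (fun _ => hlind _)
    F d hd hF (by simp only [Fintype.card_sum, Fintype.card_option, Fintype.card_empty]; omega)
  obtain ⟨g, hg0, hgd, hg⟩ := IsApproached.exists_eval_eq_zero w
    (Sum.elim Empty.elim Empty.elim : Empty ⊕ Empty → A) (fun i => ∑ s, L i s • r s) f P hP0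
    (hinj (by
      rw [MvPolynomial.algebraMap_eval₂_aeval, map_zero, hfun, ← hP]
      simp only [hf]))
  exact ⟨g, hg0, hgd.trans (hPd.trans (by simp)), fun c hc => hg c (happ c hc)⟩

theorem Ideal.Quotient.adjoin_range_mk_eq_top {k A σ : Type*} [CommRing k] [CommRing A]
    [Algebra k A] (I : Ideal A) (S : Set A) (hS : Algebra.adjoin k S = ⊤) (r : σ → A)
    (h : ∀ z ∈ S, z ∈ Set.range r ∨ ∃ a : k, z - algebraMap k A a ∈ I) :
    Algebra.adjoin k (Set.range fun s => Ideal.Quotient.mk I (r s)) = ⊤ := by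
  have h1 : (Algebra.adjoin k S).map (Ideal.Quotient.mkₐ k I) = ⊤ := by
    rw [hS, Algebra.map_top, AlgHom.range_eq_top]
    exact Ideal.Quotient.mkₐ_surjective k I
  rw [AlgHom.map_adjoin] at h1
  rw [eq_top_iff, ← h1, Algebra.adjoin_le_iff]
  rintro _ ⟨z, hz, rfl⟩
  rcases h z hz with ⟨s, rfl⟩ | ⟨a, ha⟩
  · exact Algebra.subset_adjoin ⟨s, rfl⟩
  · have h2 : Ideal.Quotient.mkₐ k I z = algebraMap k (A ⧸ I) a := Ideal.Quotient.eq.2 ha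
    rw [h2]
    exact Subalgebra.algebraMap_mem _ a

/-- The finitely many values `c` at infinity, i.e. at `w = 0`, of `f` along the closure of the
locus `u = 0` lie on a hypersurface of explicitly bounded degree. -/
theorem exists_vanishing_of_span_ne_top {k K σ γ : Type*} {A : Type u} {m : ℕ} [Field k]
    [IsAlgClosed k] [CharZero k] [Field K] [Algebra k K] [CommRing A] [Algebra k A]
    [Algebra.FiniteType k A] [Algebra A K] [IsScalarTower k A K]
    (hinj : Function.Injective (algebraMap A K)) [Fintype σ] [Finite γ]
    {x : σ → K} {lam : Fin m → K} (hx : IsTranscendenceBasis k (Sum.elim x lam))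
    (F : Option (Fin m) → MvPolynomial σ k) (hind : AlgebraicIndependent k F) (d q : ℕ)
    (hd : 1 ≤ d) (hF : ∀ o, (F o).totalDegree ≤ d) (hq : 1 ≤ q) (hdq : (m + 1) * (d - 1) ≤ q)
    (ell : σ → k) (hell : ∑ s, ell s • x s ≠ 0) (w : A) (r u : σ → A) (f : Option (Fin m) → A)
    (hw : algebraMap A K w = (∑ s, ell s • x s)⁻¹)
    (hr : ∀ i, algebraMap A K (r i) = x i * (∑ s, ell s • x s)⁻¹)
    (hu : ∀ i, algebraMap A K (u i) * (∑ s, ell s • x s)⁻¹ =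
      aeval x (pderiv i (F none)) - ∑ t, lam t * aeval x (pderiv i (F (some t))))
    (hf : ∀ o, algebraMap A K (f o) = aeval x (F o)) (htrd : trd k A = Fintype.card σ + m)
    (hgen : Algebra.adjoin k (insert w (Set.range r ∪ Set.range u ∪ Set.range f)) = ⊤)
    (hm : m + 1 ≤ Fintype.card σ) (c : γ → Option (Fin m) → k)
    (hc : ∀ i, Ideal.span (insert w (Set.range u) ∪
      Set.range fun o => f o - algebraMap k A (c i o)) ≠ ⊤) :
    ∃ g : MvPolynomial (Option (Fin m)) k, g ≠ 0 ∧
      g.totalDegree ≤ ∑ j ∈ Finset.range (Fintype.card σ - m),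
        q ^ (Fintype.card σ - m - 1 - j) * d ^ m ∧ ∀ i, eval (c i) g = 0 := by
  classical
  have hdom : IsDomain A := hinj.isDomain (algebraMap A K)
  have hx1 : AlgebraicIndependent k x := by
    have h := hx.1.comp Sum.inl Sum.inl_injective
    rwa [Sum.elim_comp_inl] at h
  have hw0 : w ≠ 0 := fun h => by
    rw [h, map_zero] at hw
    exact inv_ne_zero hell hw.symm
  have hpr : ∀ i, ∃ 𝔭 : Ideal A, 𝔭 ∈ (Ideal.span (insert w (Set.range u) ∪
      Set.range fun o => f o - algebraMap k A (c i o))).minimalPrimes := fun i => by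
    obtain ⟨M, hM, hle⟩ := Ideal.exists_le_maximal _ (hc i)
    obtain ⟨𝔭, h𝔭, -⟩ := Ideal.exists_minimalPrimes_le (J := M) hle
    exact ⟨𝔭, h𝔭⟩
  choose 𝔭 h𝔭 using hpr
  have hprime : ∀ i, (𝔭 i).IsPrime := fun i => (h𝔭 i).1.1
  have hp1 : ∀ i, ∀ z ∈ insert w (Set.range u) ∪
      Set.range (fun o => f o - algebraMap k A (c i o)), z ∈ 𝔭 i :=
    fun i z hz => (h𝔭 i).1.2 (Ideal.subset_span hz)
  have hwp : ∀ i, w ∈ 𝔭 i := fun i => hp1 i w (Or.inl (Set.mem_insert _ _))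
  have hfp : ∀ i o, f o - algebraMap k A (c i o) ∈ 𝔭 i := fun i o => hp1 i _ (Or.inr ⟨o, rfl⟩)
  obtain ⟨L, hL⟩ := exists_seq_algebraicIndependent_linearCombination (k := k)
    (fun i => A ⧸ 𝔭 i) (fun i s => Ideal.Quotient.mk (𝔭 i) (r s)) (fun i => by
      refine Ideal.Quotient.adjoin_range_mk_eq_top _ _ hgen r ?_
      rintro z (rfl | (hz | hz) | ⟨o, rfl⟩)
      · exact Or.inr ⟨0, by rw [map_zero, sub_zero]; exact hwp i⟩
      · exact Or.inl hz
      · refine Or.inr ⟨0, ?_⟩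
        rw [map_zero, sub_zero]
        exact hp1 i z (Or.inl (Set.mem_insert_of_mem _ hz))
      · exact Or.inr ⟨c i o, hfp i o⟩)
  have hLr : ∀ i, ∀ j ≤ trd k (A ⧸ 𝔭 i), AlgebraicIndependent k fun l : Fin j =>
      Ideal.Quotient.mk (𝔭 i) (∑ s, L l s • r s) := fun i j hj => by
    convert hL i j hj using 2 with l
    rw [← Ideal.Quotient.mkₐ_eq_mk k, map_sum]
    exact Finset.sum_congr rfl fun s _ => map_smul _ _ _
  have hFx : AlgebraicIndependent k fun o => aeval x (F o) := hind.map' hx1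
  obtain ⟨a, hag, ha⟩ := exists_isGenericSeq_linearIndependent w u x (fun t => F (some t))
    (hFx.comp some (Option.some_injective _))
  rw [Fintype.card_fin] at ha
  have hua : ∀ i, ∑ s, a i s • u s ∈ Ideal.span (Set.range u) := fun i =>
    sum_mem fun s _ => Submodule.smul_of_tower_mem _ _ (Ideal.subset_span ⟨s, rfl⟩)
  have hdep : ∀ 𝔮 : Ideal A, 𝔮.IsPrime → w ∈ 𝔮 → Set.range u ⊆ 𝔮 →
      ¬ AlgebraicIndependent k fun o => Ideal.Quotient.mk 𝔮 (f o) := fun 𝔮 _ hwq huq =>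
    not_algebraicIndependent_quotient_of_mem hinj F x lam w r u f hw0
      (fun i => by rw [hr, hw]) (fun i => by rw [hw]; exact hu i) hf 𝔮 hwq fun i => huq ⟨i, rfl⟩
  have key : ∀ j < Fintype.card σ - m, ∃ g : MvPolynomial (Option (Fin m)) k, g ≠ 0 ∧
      g.totalDegree ≤ q ^ (Fintype.card σ - m - 1 - j) * d ^ m ∧
      ∀ i, min (trd k (A ⧸ 𝔭 i)) (Fintype.card σ - m - 1) = j → eval (c i) g = 0 := fun j hj => by
    by_cases hjm : j + 1 = Fintype.card σ - m
    · obtain ⟨g, hg0, hgd, hg⟩ := exists_vanishing_of_generic hinj hx1 F d hd hF ell hell w r f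
        hw hr hf (fun l : Fin j => L l) (by simp; omega)
      refine ⟨g, hg0, hgd.trans ?_, fun i hi => hg _ fun N hN => ⟨⊥, 𝔭 i, Ideal.isPrime_bot,
        hprime i, bot_le, hw0, hwp i, fun l => l.elim, hfp i, hLr i j (by omega)⟩⟩
      simp only [Fintype.card_option, Fintype.card_fin, Nat.add_sub_cancel]
      exact Nat.le_mul_of_pos_left _ (Nat.pow_pos hq)
    · obtain ⟨b, hb⟩ : ∃ b, Fintype.card σ - 1 - j = m + b :=
        ⟨Fintype.card σ - 1 - j - m, by omega⟩
      obtain ⟨g, hg0, hgd, hg⟩ := exists_vanishing_of_multipliers hinj hx F d q hd hF hq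
        (by simpa using hdq) ell hell w r u f hw hr hu hf (fun l => a l) ha
        (fun l : Fin b => a (m + l)) (fun l : Fin j => L l) (by simp; omega)
      refine ⟨g, hg0, hgd.trans (le_of_eq ?_), fun i hi => hg _ fun N hN => ?_⟩
      · simp only [Fintype.card_fin]
        congr 2
        omega
      obtain ⟨𝔮, h𝔮, hle, hwq, hy⟩ := hag.exists_prime_le hw0 hua f (c i) hdep (𝔭 i) (h𝔭 i) (m + b)
        (by simp only [Nat.card_eq_fintype_card, Fintype.card_option, Fintype.card_fin]; omega)
        (fun l => N (finSumFinEquiv.symm l) - 1) (fun l => by have := hN (finSumFinEquiv.symm l); omega)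
      refine ⟨𝔮, 𝔭 i, h𝔮, hprime i, hle, hwq, hwp i, fun l => ?_, hfp i, hLr i j (by omega)⟩
      have h1 := hy (finSumFinEquiv l)
      rw [Equiv.symm_apply_apply] at h1
      have h2 : (Sum.elim (fun l : Fin m => a l) (fun l : Fin b => a (m + l)) l) =
          a (finSumFinEquiv l : Fin (m + b)) := by
        rcases l with l | l <;> simp
      simp only [h2]
      have h3 : w ^ N l = w ^ (N l - 1) * w := by
        rw [← pow_succ]
        congr 1
        have := hN l
        omega
      rw [h3, ← sub_mul]
      exact 𝔮.mul_mem_right _ h1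
  choose! g hg0 hgd hg using key
  refine ⟨∏ j ∈ Finset.range (Fintype.card σ - m), g j, Finset.prod_ne_zero_iff.2 fun j hj =>
    hg0 j (Finset.mem_range.1 hj), (totalDegree_finsetProd _ _).trans
    (Finset.sum_le_sum fun j hj => hgd j (Finset.mem_range.1 hj)), fun i => ?_⟩
  rw [map_prod]
  have h1 : min (trd k (A ⧸ 𝔭 i)) (Fintype.card σ - m - 1) < Fintype.card σ - m := by omega
  exact Finset.prod_eq_zero (Finset.mem_range.2 h1) (hg _ h1 i rfl)

theorem trd_eq_of_generators {k σ : Type*} {A K : Type u} {m : ℕ} [Field k] [CharZero k] [Field K]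
    [Algebra k K] [CommRing A] [Algebra k A] [Algebra A K] [IsScalarTower k A K]
    (hinj : Function.Injective (algebraMap A K)) [Fintype σ] {x : σ → K} {lam : Fin m → K}
    (hx : IsTranscendenceBasis k (Sum.elim x lam)) (F : Option (Fin m) → MvPolynomial σ k)
    (hind : AlgebraicIndependent k F) (w : A) (r u : σ → A) (hw : w ≠ 0)
    (hr : ∀ i, algebraMap A K (r i) = x i * algebraMap A K w)
    (hu : ∀ i, algebraMap A K (u i) * algebraMap A K w =
      aeval x (pderiv i (F none)) - ∑ t, lam t * aeval x (pderiv i (F (some t)))) :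
    trd k A = Fintype.card σ + m := by
  classical
  have hdom : IsDomain A := hinj.isDomain (algebraMap A K)
  have : FaithfulSMul A K := (faithfulSMul_iff_algebraMap_injective A K).2 hinj
  have hx1 : AlgebraicIndependent k x := by
    have h := hx.1.comp Sum.inl Sum.inl_injective
    rwa [Sum.elim_comp_inl] at h
  have hwK : algebraMap A K w ≠ 0 := (map_ne_zero_iff _ hinj).2 hw
  let S : Subalgebra A K := Subalgebra.algebraicClosure A K
  have hxS : ∀ i, x i ∈ S := fun i => by
    have h : x i = algebraMap A K (r i) * (algebraMap A K w)⁻¹ := by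
      rw [hr, mul_inv_cancel_right₀ hwK]
    rw [h]
    exact (isAlgebraic_algebraMap _).mul (isAlgebraic_algebraMap _).inv
  have hpS : ∀ p : MvPolynomial σ k, aeval x p ∈ S := fun p => by
    have h1 : Algebra.adjoin k (Set.range x) ≤ S.restrictScalars k := Algebra.adjoin_le (by
      rintro _ ⟨i, rfl⟩
      exact hxS i)
    exact h1 (by rw [Algebra.adjoin_range_eq_range_aeval]; exact ⟨p, rfl⟩)
  have hFx : AlgebraicIndependent k fun o => aeval x (F o) := hind.map' hx1
  obtain ⟨a, -, ha⟩ := exists_isGenericSeq_linearIndependent (k := k) (0 : k) (fun _ => 0) x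
    (fun t => F (some t)) (hFx.comp some (Option.some_injective _))
  rw [Fintype.card_fin] at ha
  have hksm : ∀ (z : k) {y : K}, y ∈ S → z • y ∈ S := fun z y hy =>
    (S.restrictScalars k).smul_mem hy z
  let M : Matrix (Fin m) (Fin m) S := fun l t =>
    ⟨∑ s, a l s • aeval x (pderiv s (F (some t))), sum_mem fun s _ => hksm _ (hpS _)⟩
  let b : Fin m → S := fun l => ⟨∑ s, a l s • (aeval x (pderiv s (F none)) -
      algebraMap A K (u s) * algebraMap A K w), sum_mem fun s _ =>
        hksm _ (sub_mem (hpS _) (mul_mem (S.algebraMap_mem _) (S.algebraMap_mem _)))⟩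
  have hlam : ∀ t, IsAlgebraic S (lam t) := Matrix.isAlgebraic_of_mulVec_eq M b lam (by
    rw [RingHom.map_det, ← isUnit_iff_ne_zero, ← Matrix.isUnit_iff_isUnit_det,
      ← Matrix.linearIndependent_rows_iff_isUnit]
    exact ha) (by
    funext l
    change ∑ t, (∑ s, a l s • aeval x (pderiv s (F (some t)))) * lam t = ∑ s, a l s • _
    simp only [hu, sub_sub_cancel, Finset.smul_sum, Finset.sum_mul]
    rw [Finset.sum_comm]
    exact Finset.sum_congr rfl fun t _ => Finset.sum_congr rfl fun i _ => by
      rw [smul_mul_assoc, mul_comm])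
  have halgS : Algebra.IsAlgebraic A S := ⟨fun z => by
    have h : IsAlgebraic A (z : K) := z.2
    exact (isAlgebraic_algHom_iff S.val Subtype.val_injective).1 h⟩
  have hlamS : ∀ t, lam t ∈ S := fun t => (hlam t).restrictScalars A
  have halg : Algebra.IsAlgebraic A K := by
    refine ⟨fun z => ?_⟩
    have h1 : Algebra.adjoin k (Set.range (Sum.elim x lam)) ≤ S.restrictScalars k := by
      refine Algebra.adjoin_le ?_
      rintro _ ⟨i | t, rfl⟩
      · exact hxS i
      · exact hlamS t
    have h2 : IsAlgebraic S z := by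
      obtain ⟨p, hp0, hp⟩ := hx.isAlgebraic.isAlgebraic z
      let j : Algebra.adjoin k (Set.range (Sum.elim x lam)) →+* S :=
        (Subalgebra.inclusion h1).toRingHom
      have hj : Function.Injective j := Subalgebra.inclusion_injective h1
      refine ⟨p.map j, (Polynomial.map_ne_zero_iff hj).2 hp0, ?_⟩
      rw [Polynomial.aeval_def, Polynomial.eval₂_map]
      exact hp
    exact h2.restrictScalars A
  have h1 := trdeg_add_eq k A (A := K)
  rw [trdeg_eq_zero (R := A) (A := K), add_zero] at h1
  have h2 := hx.card_eq_trd
  rw [trd, h1]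
  rw [trd] at h2
  rw [← h2]
  simp

theorem RingHom.exists_of_surjective_of_ker_le {R S T : Type*} [CommRing R] [CommRing S]
    [CommRing T] (φ : R →+* S) (hφ : Function.Surjective φ) (ψ : R →+* T)
    (h : ∀ a, φ a = 0 → ψ a = 0) : ∃ χ : S →+* T, ∀ a, χ (φ a) = ψ a :=
  ⟨RingHom.liftOfSurjective φ hφ ⟨ψ, h⟩, fun a => RingHom.liftOfRightInverse_comp_apply _ _ _ _ a⟩

theorem exists_ringHom_of_tendsto {ν B : Type*} [CommRing B] [Algebra ℂ B] (gens : ν → B)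
    (hgen : Algebra.adjoin ℂ (Set.range gens) = ⊤) (ev : ℕ → B →ₐ[ℂ] ℂ) (z : ν → ℂ)
    (hz : ∀ i, Tendsto (fun t => ev t (gens i)) atTop (nhds (z i))) :
    ∃ χ : B →+* ℂ, (∀ i, χ (gens i) = z i) ∧ ∀ a : ℂ, χ (algebraMap ℂ B a) = a := by
  have hker : ∀ P : MvPolynomial ν ℂ, aeval gens P = 0 → eval z P = 0 := fun P hP => by
    have h1 : Tendsto (fun t => eval (fun i => ev t (gens i)) P) atTop (nhds (eval z P)) :=
      ((MvPolynomial.continuous_eval P).tendsto z).comp (tendsto_pi_nhds.2 hz)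
    have h2 : ∀ t, eval (fun i => ev t (gens i)) P = 0 := fun t => by
      have := MvPolynomial.comp_aeval_apply gens (ev t) P
      rw [hP, map_zero] at this
      rw [← coe_aeval_eq_eval]
      exact this.symm
    simp only [h2] at h1
    exact (tendsto_nhds_unique h1 tendsto_const_nhds)
  have hsurj : Function.Surjective (aeval gens : MvPolynomial ν ℂ →ₐ[ℂ] B) := by
    rw [← AlgHom.range_eq_top, ← Algebra.adjoin_range_eq_range_aeval, hgen]
  obtain ⟨χ, hχ⟩ := RingHom.exists_of_surjective_of_ker_le
    (aeval gens : MvPolynomial ν ℂ →ₐ[ℂ] B).toRingHom hsurj (eval z) hker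
  exact ⟨χ, fun i => (congrArg χ (aeval_X _ _).symm).trans ((hχ (X i)).trans (eval_X i)),
    fun a => (congrArg χ (aeval_C _ _).symm).trans ((hχ (C a)).trans (eval_C a))⟩

theorem exists_vanishing_of_tendsto {σ γ : Type*} {A K : Type u} {m : ℕ}
    [Field K] [Algebra ℂ K] [CommRing A] [Algebra ℂ A] [Algebra A K] [IsScalarTower ℂ A K]
    (hinj : Function.Injective (algebraMap A K)) [Fintype σ] [Finite γ]
    {x : σ → K} {lam : Fin m → K} (hx : IsTranscendenceBasis ℂ (Sum.elim x lam))
    (F : Option (Fin m) → MvPolynomial σ ℂ) (hind : AlgebraicIndependent ℂ F) (d q : ℕ)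
    (hd : 1 ≤ d) (hF : ∀ o, (F o).totalDegree ≤ d) (hq : 1 ≤ q) (hdq : (m + 1) * (d - 1) ≤ q)
    (ell : σ → ℂ) (hell : ∑ s, ell s • x s ≠ 0) (w : A) (r u : σ → A) (f : Option (Fin m) → A)
    (hw : algebraMap A K w = (∑ s, ell s • x s)⁻¹)
    (hr : ∀ i, algebraMap A K (r i) = x i * (∑ s, ell s • x s)⁻¹)
    (hu : ∀ i, algebraMap A K (u i) * (∑ s, ell s • x s)⁻¹ =
      aeval x (pderiv i (F none)) - ∑ t, lam t * aeval x (pderiv i (F (some t))))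
    (hf : ∀ o, algebraMap A K (f o) = aeval x (F o))
    (hgen : Algebra.adjoin ℂ (insert w (Set.range r ∪ Set.range u ∪ Set.range f)) = ⊤)
    (hm : m + 1 ≤ Fintype.card σ) (c : γ → Option (Fin m) → ℂ) (ev : γ → ℕ → A →ₐ[ℂ] ℂ)
    (rlim : γ → σ → ℂ) (hevw : ∀ i, Tendsto (fun t => ev i t w) atTop (nhds 0))
    (hevr : ∀ i s, Tendsto (fun t => ev i t (r s)) atTop (nhds (rlim i s)))
    (hevu : ∀ i s, Tendsto (fun t => ev i t (u s)) atTop (nhds 0))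
    (hevf : ∀ i o, Tendsto (fun t => ev i t (f o)) atTop (nhds (c i o))) :
    ∃ g : MvPolynomial (Option (Fin m)) ℂ, g ≠ 0 ∧
      g.totalDegree ≤ ∑ j ∈ Finset.range (Fintype.card σ - m),
        q ^ (Fintype.card σ - m - 1 - j) * d ^ m ∧ ∀ i, eval (c i) g = 0 := by
  classical
  have hw0 : w ≠ 0 := fun h => by
    rw [h, map_zero] at hw
    exact inv_ne_zero hell hw.symm
  have hrange : Set.range (fun o : Option (σ ⊕ σ ⊕ Option (Fin m)) =>
      o.elim w (Sum.elim r (Sum.elim u f))) =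
        insert w (Set.range r ∪ Set.range u ∪ Set.range f) := by
    ext z
    constructor
    · rintro ⟨_ | i | i | i, rfl⟩ <;> simp
    · rintro (rfl | (⟨i, rfl⟩ | ⟨i, rfl⟩) | ⟨i, rfl⟩)
      · exact ⟨none, rfl⟩
      · exact ⟨some (Sum.inl i), rfl⟩
      · exact ⟨some (Sum.inr (Sum.inl i)), rfl⟩
      · exact ⟨some (Sum.inr (Sum.inr i)), rfl⟩
  have hft : Algebra.FiniteType ℂ A := ⟨Subalgebra.fg_def.2
    ⟨_, hrange ▸ Set.finite_range _, hgen⟩⟩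
  refine exists_vanishing_of_span_ne_top hinj hx F hind d q hd hF hq hdq ell hell w r u f hw hr
    hu hf ?_ hgen hm c fun i htop => ?_
  · exact trd_eq_of_generators hinj hx F hind w r u hw0 (fun i => by rw [hr, hw])
      fun i => by rw [hw, hu]
  · obtain ⟨χ, hχ, hχC⟩ := exists_ringHom_of_tendsto
      (fun o : Option (σ ⊕ σ ⊕ Option (Fin m)) => o.elim w (Sum.elim r (Sum.elim u f)))
      (by rw [hrange, hgen]) (ev i)
      (fun o : Option (σ ⊕ σ ⊕ Option (Fin m)) => o.elim 0 (Sum.elim (rlim i)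
        (Sum.elim (fun _ => 0) (c i)))) (by
        rintro (_ | s | s | o)
        · exact hevw i
        · exact hevr i s
        · exact hevu i s
        · exact hevf i o)
    have hle : Ideal.span (insert w (Set.range u) ∪
        Set.range fun o => f o - algebraMap ℂ A (c i o)) ≤ RingHom.ker χ := by
      refine Ideal.span_le.2 ?_
      rintro _ ((rfl | ⟨s, rfl⟩) | ⟨o, rfl⟩)
      · exact hχ none
      · exact hχ (some (Sum.inr (Sum.inl s)))
      · have h := hχ (some (Sum.inr (Sum.inr o)))
        change χ (f o) = c i o at h
        simp [RingHom.mem_ker, h, hχC]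
    rw [htop] at hle
    have h1 : (1 : A) ∈ RingHom.ker χ := hle trivial
    rw [RingHom.mem_ker, map_one] at h1
    exact one_ne_zero h1

theorem exists_vanishing_of_localization {σ γ : Type*} {m : ℕ} [Fintype σ] [Finite γ] {Λ K : Type u}
    [CommRing Λ] [IsDomain Λ] [Algebra ℂ Λ] [Algebra (MvPolynomial (σ ⊕ Fin m) ℂ) Λ]
    [IsScalarTower ℂ (MvPolynomial (σ ⊕ Fin m) ℂ) Λ] [Field K] [Algebra ℂ K] [Algebra Λ K]
    [Algebra (MvPolynomial (σ ⊕ Fin m) ℂ) K] [IsScalarTower ℂ Λ K]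
    [IsScalarTower ℂ (MvPolynomial (σ ⊕ Fin m) ℂ) K]
    [IsScalarTower (MvPolynomial (σ ⊕ Fin m) ℂ) Λ K] [IsFractionRing Λ K]
    (ell : σ → ℂ) (hD : (∑ s, ell s • X (Sum.inl s) : MvPolynomial (σ ⊕ Fin m) ℂ) ≠ 0)
    [hΛ : IsLocalization.Away (∑ s, ell s • X (Sum.inl s) : MvPolynomial (σ ⊕ Fin m) ℂ) Λ]
    (F : Option (Fin m) → MvPolynomial σ ℂ) (hind : AlgebraicIndependent ℂ F) (d q : ℕ)
    (hd : 1 ≤ d) (hF : ∀ o, (F o).totalDegree ≤ d) (hq : 1 ≤ q) (hdq : (m + 1) * (d - 1) ≤ q)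
    (hm : m + 1 ≤ Fintype.card σ) (c : γ → Option (Fin m) → ℂ)
    (x : γ → ℕ → σ → ℂ) (lam : γ → ℕ → Fin m → ℂ) (rlim : γ → σ → ℂ)
    (hne : ∀ i t, ∑ s, ell s * x i t s ≠ 0)
    (hw : ∀ i, Tendsto (fun t => (∑ s, ell s * x i t s)⁻¹) atTop (nhds 0))
    (hr : ∀ i s, Tendsto (fun t => x i t s * (∑ s, ell s * x i t s)⁻¹) atTop (nhds (rlim i s)))
    (hu : ∀ i s, Tendsto (fun t => (∑ s, ell s * x i t s) * (eval (x i t) (pderiv s (F none)) -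
      ∑ l, lam i t l * eval (x i t) (pderiv s (F (some l))))) atTop (nhds 0))
    (hf : ∀ i o, Tendsto (fun t => eval (x i t) (F o)) atTop (nhds (c i o))) :
    ∃ g : MvPolynomial (Option (Fin m)) ℂ, g ≠ 0 ∧
      g.totalDegree ≤ ∑ j ∈ Finset.range (Fintype.card σ - m),
        q ^ (Fintype.card σ - m - 1 - j) * d ^ m ∧ ∀ i, eval (c i) g = 0 := by
  classical
  let R := MvPolynomial (σ ⊕ Fin m) ℂ
  let D : R := ∑ s, ell s • X (Sum.inl s)
  have hRΛ : Function.Injective (algebraMap R Λ) :=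
    IsLocalization.injective Λ (powers_le_nonZeroDivisors_of_noZeroDivisors hD)
  have hΛK : Function.Injective (algebraMap Λ K) := IsFractionRing.injective Λ K
  have hRK : Function.Injective (algebraMap R K) := by
    rw [IsScalarTower.algebraMap_eq R Λ K]
    exact hΛK.comp hRΛ
  have hfs : FaithfulSMul R K := (faithfulSMul_iff_algebraMap_injective R K).2 hRK
  have halg1 : Algebra.IsAlgebraic R Λ := IsLocalization.isAlgebraic Λ (Submonoid.powers D)
  have halg2 : Algebra.IsAlgebraic Λ K := IsLocalization.isAlgebraic K (nonZeroDivisors Λ)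
  have halg : Algebra.IsAlgebraic R K := Algebra.IsAlgebraic.trans R Λ K
  have hX : IsTranscendenceBasis ℂ (algebraMap R K ∘ X) :=
    (IsTranscendenceBasis.mvPolynomial (σ ⊕ Fin m) ℂ).algebraMap_comp (A := K)
  let D' : Λ := algebraMap R Λ D
  let w : Λ := IsLocalization.Away.invSelf D
  have hDw : D' * w = 1 := IsLocalization.Away.mul_invSelf D
  let incl : MvPolynomial σ ℂ →ₐ[ℂ] Λ :=
    (IsScalarTower.toAlgHom ℂ R Λ).comp (rename Sum.inl)
  let r : σ → Λ := fun s => algebraMap R Λ (X (Sum.inl s)) * w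
  let u : σ → Λ := fun s => D' * (incl (pderiv s (F none)) -
    ∑ l, algebraMap R Λ (X (Sum.inr l)) * incl (pderiv s (F (some l))))
  let f : Option (Fin m) → Λ := fun o => incl (F o)
  let G : Set Λ := insert w (Set.range r ∪ Set.range u ∪ Set.range f)
  let A : Subalgebra ℂ Λ := Algebra.adjoin ℂ G
  have hGA : ∀ z ∈ G, z ∈ A := fun z hz => Algebra.subset_adjoin hz
  let w' : A := ⟨w, hGA _ (Or.inl rfl)⟩
  let r' : σ → A := fun s => ⟨r s, hGA _ (Or.inr (Or.inl (Or.inl ⟨s, rfl⟩)))⟩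
  let u' : σ → A := fun s => ⟨u s, hGA _ (Or.inr (Or.inl (Or.inr ⟨s, rfl⟩)))⟩
  let f' : Option (Fin m) → A := fun o => ⟨f o, hGA _ (Or.inr (Or.inr ⟨o, rfl⟩))⟩
  have hev : ∀ i t, ∃ e : Λ →ₐ[ℂ] ℂ, ∀ P : R,
      e (algebraMap R Λ P) = aeval (Sum.elim (x i t) (lam i t)) P := fun i t => by
    have hun : ∀ y : Submonoid.powers D, IsUnit (aeval (Sum.elim (x i t) (lam i t)) (y : R)) := by
      rintro ⟨_, j, rfl⟩
      have h1 : aeval (Sum.elim (x i t) (lam i t)) D = ∑ s, ell s * x i t s := by simp [D]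
      simp only [map_pow, h1]
      exact (isUnit_iff_ne_zero.2 (hne i t)).pow j
    exact ⟨IsLocalization.liftAlgHom (M := Submonoid.powers D) (S := Λ) hun, fun P =>
      IsLocalization.lift_eq (M := Submonoid.powers D) (S := Λ)
        (g := (aeval (Sum.elim (x i t) (lam i t)) : R →ₐ[ℂ] ℂ).toRingHom) hun P⟩
  choose e he using hev
  have heD : ∀ i t, e i t D' = ∑ s, ell s * x i t s := fun i t => by
    rw [he]
    simp [D]
  have hew : ∀ i t, e i t w = (∑ s, ell s * x i t s)⁻¹ := fun i t => by
    rw [← heD]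
    refine eq_inv_of_mul_eq_one_right ?_
    rw [← map_mul, hDw, map_one]
  have heincl : ∀ i t P, e i t (incl P) = eval (x i t) P := fun i t P => by
    change e i t (algebraMap R Λ (rename Sum.inl P)) = _
    rw [he, aeval_rename, Sum.elim_comp_inl]
    exact RingHom.congr_fun (coe_aeval_eq_eval (x i t)) P
  have hKincl : ∀ P, algebraMap Λ K (incl P) = aeval (fun s => algebraMap R K (X (Sum.inl s))) P :=
    DFunLike.congr_fun (algHom_ext (f := (IsScalarTower.toAlgHom ℂ Λ K).comp incl)
      (g := aeval fun s => algebraMap R K (X (Sum.inl s))) fun s => by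
        simp [incl, R, IsScalarTower.algebraMap_apply R Λ K])
  have hKD : algebraMap Λ K D' = ∑ s, ell s • algebraMap R K (X (Sum.inl s)) := by
    rw [← IsScalarTower.algebraMap_apply, map_sum]
    exact Finset.sum_congr rfl fun s _ => algebraMap.coe_smul ..
  have hKD0 : algebraMap Λ K D' ≠ 0 := by
    rw [← IsScalarTower.algebraMap_apply]
    exact (map_ne_zero_iff _ hRK).2 hD
  have hKw : algebraMap Λ K w = (algebraMap Λ K D')⁻¹ := by
    refine eq_inv_of_mul_eq_one_right ?_
    rw [← map_mul, hDw, map_one]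
  refine exists_vanishing_of_tendsto (A := A) (K := K) (hΛK.comp Subtype.val_injective)
    (x := fun s => algebraMap R K (X (Sum.inl s))) (lam := fun l => algebraMap R K (X (Sum.inr l)))
    ?_ F hind d q hd hF hq hdq ell ?_ w' r' u' f' ?_ ?_ ?_ ?_ ?_ hm c
    (fun i t => (e i t).comp A.val) rlim ?_ ?_ ?_ ?_
  · convert hX using 1
    ext (s | l) <;> rfl
  · rw [← hKD]
    exact hKD0
  · rw [← hKD, ← hKw]
    rfl
  · intro i
    rw [← hKD, ← hKw, IsScalarTower.algebraMap_apply R Λ K, ← map_mul]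
    rfl
  · intro i
    change algebraMap Λ K (D' * _) * _ = _
    rw [← hKD, map_mul, mul_right_comm, mul_inv_cancel₀ hKD0, one_mul]
    simp only [map_mul, map_sub, map_sum, hKincl, ← IsScalarTower.algebraMap_apply]
  · exact fun o => hKincl (F o)
  · rw [← Algebra.adjoin_adjoin_coe_preimage (R := ℂ) (s := G)]
    congr 1
    ext z
    simp only [G, Set.mem_preimage, Set.mem_insert_iff, Set.mem_union, Set.mem_range,
      Subtype.ext_iff, w', r', u', f']
  · intro i
    refine (hw i).congr fun t => ?_
    exact (hew i t).symm
  · intro i s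
    refine (hr i s).congr fun t => ?_
    change _ = e i t (_ * w)
    rw [map_mul, hew, he, aeval_X, Sum.elim_inl]
  · intro i s
    refine (hu i s).congr fun t => ?_
    change _ = e i t (D' * _)
    simp only [map_mul, map_sub, map_sum, heD, heincl, he, aeval_X, Sum.elim_inr]
  · intro i o
    refine (hf i o).congr fun t => ?_
    exact (heincl i t _).symm

theorem exists_vanishing_of_multiplier_sequences {σ γ : Type*} {m : ℕ} [Fintype σ] [Finite γ]
    (ell : σ → ℂ) (hell : ell ≠ 0)
    (F : Option (Fin m) → MvPolynomial σ ℂ) (hind : AlgebraicIndependent ℂ F) (d q : ℕ)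
    (hd : 1 ≤ d) (hF : ∀ o, (F o).totalDegree ≤ d) (hq : 1 ≤ q) (hdq : (m + 1) * (d - 1) ≤ q)
    (hm : m + 1 ≤ Fintype.card σ) (c : γ → Option (Fin m) → ℂ)
    (x : γ → ℕ → σ → ℂ) (lam : γ → ℕ → Fin m → ℂ) (rlim : γ → σ → ℂ)
    (hne : ∀ i t, ∑ s, ell s * x i t s ≠ 0)
    (hw : ∀ i, Tendsto (fun t => (∑ s, ell s * x i t s)⁻¹) atTop (nhds 0))
    (hr : ∀ i s, Tendsto (fun t => x i t s * (∑ s, ell s * x i t s)⁻¹) atTop (nhds (rlim i s)))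
    (hu : ∀ i s, Tendsto (fun t => (∑ s, ell s * x i t s) * (eval (x i t) (pderiv s (F none)) -
      ∑ l, lam i t l * eval (x i t) (pderiv s (F (some l))))) atTop (nhds 0))
    (hf : ∀ i o, Tendsto (fun t => eval (x i t) (F o)) atTop (nhds (c i o))) :
    ∃ g : MvPolynomial (Option (Fin m)) ℂ, g ≠ 0 ∧
      g.totalDegree ≤ ∑ j ∈ Finset.range (Fintype.card σ - m),
        q ^ (Fintype.card σ - m - 1 - j) * d ^ m ∧ ∀ i, eval (c i) g = 0 := by
  classical
  let D : MvPolynomial (σ ⊕ Fin m) ℂ := ∑ s, ell s • X (Sum.inl s)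
  have hD : D ≠ 0 := fun h => hell (funext fun s => by
    have h1 : aeval (Sum.elim (Pi.single s (1 : ℂ)) (0 : Fin m → ℂ)) D = 0 := by rw [h, map_zero]
    simpa [D, Pi.single_apply] using h1)
  have hdom : IsDomain (Localization.Away D) :=
    IsLocalization.isDomain_of_le_nonZeroDivisors _
      (powers_le_nonZeroDivisors_of_noZeroDivisors hD)
  exact exists_vanishing_of_localization (Λ := Localization.Away D)
    (K := FractionRing (Localization.Away D)) ell hD F hind d q hd hF hq hdq hm c x lam rlim
    hne hw hr hu hf

theorem eucNorm_eq_norm {n : ℕ} (v : Fin n → ℂ) : eucNorm v = ‖WithLp.toLp 2 v‖ := by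
  rw [EuclideanSpace.norm_eq]
  rfl

theorem eucNorm_star {n : ℕ} (v : Fin n → ℂ) : eucNorm (star v) = eucNorm v := by
  simp [eucNorm]

theorem eucNorm_smul {n : ℕ} (a : ℂ) (v : Fin n → ℂ) : eucNorm (a • v) = ‖a‖ * eucNorm v := by
  rw [eucNorm_eq_norm, eucNorm_eq_norm, WithLp.toLp_smul, norm_smul]

theorem eucNorm_nonneg {n : ℕ} (v : Fin n → ℂ) : 0 ≤ eucNorm v := Real.sqrt_nonneg _

theorem norm_le_eucNorm {n : ℕ} (v : Fin n → ℂ) (s : Fin n) : ‖v s‖ ≤ eucNorm v := by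
  rw [eucNorm_eq_norm]
  exact PiLp.norm_apply_le (WithLp.toLp 2 v) s

theorem norm_sum_mul_le_eucNorm {n : ℕ} (a v : Fin n → ℂ) :
    ‖∑ s, a s * v s‖ ≤ eucNorm a * eucNorm v := by
  have h := norm_inner_le_norm (𝕜 := ℂ) (WithLp.toLp 2 (star a)) (WithLp.toLp 2 v)
  rw [← eucNorm_eq_norm, ← eucNorm_eq_norm, eucNorm_star, EuclideanSpace.inner_toLp_toLp] at h
  simpa [dotProduct, mul_comm] using h

theorem exists_eucNorm_sub_le {n m : ℕ} (a : Fin n → ℂ) (b : Fin m → Fin n → ℂ) :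
    ∃ lam : Fin m → ℂ, ∃ v : Fin n → ℂ, (∀ l, ∑ s, b l s * v s = 0) ∧ eucNorm v ≤ 1 ∧
      ‖∑ s, a s * v s‖ = eucNorm (a - ∑ l, lam l • b l) := by
  let β : Fin m → EuclideanSpace ℂ (Fin n) := fun l => WithLp.toLp 2 (star (b l))
  let W := Submodule.span ℂ (Set.range β)
  obtain ⟨y, hy, z, hz, hyz⟩ := W.exists_add_mem_mem_orthogonal (WithLp.toLp 2 (star a))
  obtain ⟨μ, hμ⟩ := (Submodule.mem_span_range_iff_exists_fun ℂ).1 hy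
  have hinner : ∀ (e : Fin n → ℂ) (v : EuclideanSpace ℂ (Fin n)),
      ∑ s, e s * v s = inner ℂ (WithLp.toLp 2 (star e)) v := fun e v => by
    simp [PiLp.inner_apply, mul_comm]
  have ha : a - ∑ l, star (μ l) • b l = star (z : Fin n → ℂ) := by
    have h1 : star a - ∑ l, μ l • star (b l) = (z : Fin n → ℂ) := by
      have := congrArg WithLp.ofLp hyz
      rw [← hμ] at this
      simp only [WithLp.ofLp_add, WithLp.ofLp_sum, WithLp.ofLp_smul, β] at this
      rw [this, add_sub_cancel_left]
    rw [← h1]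
    simp [star_sum]
  have hbz : ∀ l, ∑ s, b l s * z s = 0 := fun l => by
    rw [hinner]
    exact hz _ (Submodule.subset_span ⟨l, rfl⟩)
  have haz : ∑ s, a s * z s = (‖z‖ : ℂ) ^ 2 := by
    rw [hinner, hyz, inner_add_left, hz _ hy, zero_add, inner_self_eq_norm_sq_to_K]
    rfl
  refine ⟨fun l => star (μ l), (‖z‖ : ℂ)⁻¹ • (z : Fin n → ℂ), fun l => ?_, ?_, ?_⟩
  · simp only [Pi.smul_apply, smul_eq_mul, mul_left_comm _ (‖z‖ : ℂ)⁻¹, ← Finset.mul_sum, hbz,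
      mul_zero]
  · rw [eucNorm_smul, eucNorm_eq_norm]
    simp only [norm_inv, Complex.norm_real, norm_norm, WithLp.toLp_ofLp]
    exact inv_mul_le_one
  · rw [ha, eucNorm_star, eucNorm_eq_norm, WithLp.toLp_ofLp]
    simp only [Pi.smul_apply, smul_eq_mul, mul_left_comm _ (‖z‖ : ℂ)⁻¹, ← Finset.mul_sum, haz]
    rcases eq_or_ne ‖z‖ 0 with h | h
    · simp [h]
    · rw [pow_two, ← mul_assoc, inv_mul_cancel₀ (by exact_mod_cast h), one_mul]
      simp

theorem exists_eucNorm_le_wNorm {n m : ℕ} (f : Fin (m + 1) → MvPolynomial (Fin n) ℂ)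
    (x : Fin n → ℂ) (j : Fin (m + 1)) : ∃ lam : Fin m → ℂ,
      eucNorm (fun s => eval x (pderiv s (f j)) -
        ∑ l, lam l * eval x (pderiv s (f (j.succAbove l)))) ≤ wNorm f x j := by
  obtain ⟨lam, v, hv, hv1, hva⟩ := exists_eucNorm_sub_le (fun s => eval x (pderiv s (f j)))
    fun l s => eval x (pderiv s (f (j.succAbove l)))
  refine ⟨lam, ?_⟩
  have h : (fun s => eval x (pderiv s (f j)) -
        ∑ l, lam l * eval x (pderiv s (f (j.succAbove l)))) =
      (fun s => eval x (pderiv s (f j))) -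
        ∑ l, lam l • fun s => eval x (pderiv s (f (j.succAbove l))) := by
    ext s
    simp
  rw [h, ← hva]
  refine le_csSup ⟨eucNorm fun s => eval x (pderiv s (f j)), ?_⟩ ⟨v, fun i hi => ?_, hv1, rfl⟩
  · rintro _ ⟨v', -, hv', rfl⟩
    exact (norm_sum_mul_le_eucNorm _ _).trans (mul_le_of_le_one_right (eucNorm_nonneg _) hv')
  · obtain ⟨l, rfl⟩ := Fin.exists_succAbove_eq hi
    exact hv l

/-- A point of `Kinf f` is approached along multiplier sequences for a single component of `f`,
whose points converge in direction. -/
theorem exists_multiplier_sequence_of_mem_Kinf {n m : ℕ}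
    {f : Fin (m + 1) → MvPolynomial (Fin n) ℂ} {c : Fin (m + 1) → ℂ} (hc : c ∈ Kinf f) :
    ∃ (j : Fin (m + 1)) (xh : Fin n → ℂ) (x : ℕ → Fin n → ℂ) (lam : ℕ → Fin m → ℂ), xh ≠ 0 ∧
      Tendsto (fun t => eucNorm (x t)) atTop atTop ∧
      (∀ s, Tendsto (fun t => (eucNorm (x t) : ℂ)⁻¹ * x t s) atTop (nhds (xh s))) ∧
      (∀ i, Tendsto (fun t => eval (x t) (f i)) atTop (nhds (c i))) ∧
      ∀ s, Tendsto (fun t => (eucNorm (x t) : ℂ) * (eval (x t) (pderiv s (f j)) -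
        ∑ l, lam t l * eval (x t) (pderiv s (f (j.succAbove l))))) atTop (nhds 0) := by
  obtain ⟨x, hx, hxc, hxk⟩ := hc
  choose J hJ using fun t => exists_eq_ciInf_of_finite (f := fun j => wNorm f (x t) j)
  obtain ⟨j, hj⟩ : ∃ j, ∃ᶠ t in atTop, J t = j := by
    by_contra! h
    obtain ⟨t, ht⟩ := (eventually_all.2 h).exists
    exact ht _ rfl
  obtain ⟨φ, hφ, hφj⟩ := extraction_of_frequently_atTop hj
  let y : ℕ → EuclideanSpace ℂ (Fin n) := fun t =>
    WithLp.toLp 2 ((eucNorm (x (φ t)) : ℂ)⁻¹ • x (φ t))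
  have hy : ∀ t, ‖y t‖ = (eucNorm (x (φ t)))⁻¹ * eucNorm (x (φ t)) := fun t => by
    rw [← eucNorm_eq_norm, eucNorm_smul, norm_inv, Complex.norm_real,
      Real.norm_of_nonneg (eucNorm_nonneg _)]
  obtain ⟨xh, -, ψ, hψ, hyψ⟩ := tendsto_subseq_of_bounded
    (Metric.isBounded_closedBall (x := (0 : EuclideanSpace ℂ (Fin n))) (r := 1)) (x := y)
    fun t => by rw [mem_closedBall_zero_iff, hy]; exact inv_mul_le_one
  have hφψ : Tendsto (φ ∘ ψ) atTop atTop := (hφ.comp hψ).tendsto_atTop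
  have hx' : Tendsto (fun t => eucNorm (x (φ (ψ t)))) atTop atTop := hx.comp hφψ
  choose lam hlam using fun t => exists_eucNorm_le_wNorm f (x (φ (ψ t))) j
  refine ⟨j, xh, fun t => x (φ (ψ t)), lam, ?_, hx', fun s => ?_, fun i => ?_, fun s => ?_⟩
  · intro h0
    have h1 : Tendsto (fun t => ‖y (ψ t)‖) atTop (nhds ‖xh‖) := hyψ.norm
    have h2 : Tendsto (fun t => ‖y (ψ t)‖) atTop (nhds 1) := by
      refine tendsto_const_nhds.congr' ?_
      filter_upwards [hx'.eventually_gt_atTop 0] with t ht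
      rw [hy, inv_mul_cancel₀ ht.ne']
    have h3 := tendsto_nhds_unique h1 h2
    have h4 : xh = 0 := by
      ext s
      exact congrFun h0 s
    rw [h4, norm_zero] at h3
    exact zero_ne_one h3
  · exact ((EuclideanSpace.proj (𝕜 := ℂ) s).continuous.tendsto xh).comp hyψ
  · exact (tendsto_pi_nhds.1 hxc i).comp hφψ
  · refine squeeze_zero_norm (fun t => ?_) (hxk.comp hφψ)
    rw [norm_mul, Complex.norm_real, Real.norm_of_nonneg (eucNorm_nonneg _)]
    have h1 : kuoDist f (x (φ (ψ t))) = wNorm f (x (φ (ψ t))) j := by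
      rw [← hφj (ψ t)]
      exact (hJ _).symm
    simp only [Function.comp_apply, h1]
    exact mul_le_mul_of_nonneg_left ((norm_le_eucNorm _ s).trans (hlam t)) (eucNorm_nonneg _)

theorem exists_vanishing_of_directions {n m : ℕ} {γ : Type*} [Finite γ]
    (f : Fin (m + 1) → MvPolynomial (Fin n) ℂ) (hind : AlgebraicIndependent ℂ f) (d q : ℕ)
    (hd : 1 ≤ d) (hf : ∀ i, (f i).totalDegree ≤ d) (hq : 1 ≤ q) (hdq : (m + 1) * (d - 1) ≤ q)
    (hm : m + 1 ≤ n) (j : Fin (m + 1)) (c : γ → Fin (m + 1) → ℂ) (xh : γ → Fin n → ℂ)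
    (x : γ → ℕ → Fin n → ℂ) (lam : γ → ℕ → Fin m → ℂ) (hxh : ∀ i, xh i ≠ 0)
    (hx : ∀ i, Tendsto (fun t => eucNorm (x i t)) atTop atTop)
    (hdir : ∀ i s, Tendsto (fun t => (eucNorm (x i t) : ℂ)⁻¹ * x i t s) atTop (nhds (xh i s)))
    (hc : ∀ i o, Tendsto (fun t => eval (x i t) (f o)) atTop (nhds (c i o)))
    (hlam : ∀ i s, Tendsto (fun t => (eucNorm (x i t) : ℂ) * (eval (x i t) (pderiv s (f j)) -
        ∑ l, lam i t l * eval (x i t) (pderiv s (f (j.succAbove l))))) atTop (nhds 0)) :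
    ∃ g : MvPolynomial (Fin (m + 1)) ℂ, g ≠ 0 ∧
      g.totalDegree ≤ ∑ k ∈ Finset.range (n - m), q ^ (n - m - 1 - k) * d ^ m ∧
      ∀ i, eval (c i) g = 0 := by
  rcases isEmpty_or_nonempty γ with hγ | ⟨⟨i₀⟩⟩
  · exact ⟨1, one_ne_zero, by simp, fun i => hγ.elim i⟩
  obtain ⟨φ, hφ⟩ := Module.exists_dual_forall_apply_ne_zero (K := ℂ) xh hxh
  let ell : Fin n → ℂ := fun s => φ fun l => if s = l then 1 else 0
  have hell : ∀ v, φ v = ∑ s, ell s * v s := fun v => by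
    rw [LinearMap.pi_apply_eq_sum_univ φ v]
    exact Finset.sum_congr rfl fun s _ => mul_comm _ _
  have hlim : ∀ i, Tendsto (fun t => (eucNorm (x i t) : ℂ)⁻¹ * ∑ s, ell s * x i t s) atTop
      (nhds (φ (xh i))) := fun i => by
    rw [hell]
    refine (tendsto_finsetSum _ fun s _ => (hdir i s).const_mul (ell s)).congr fun t => ?_
    rw [Finset.mul_sum]
    exact Finset.sum_congr rfl fun s _ => mul_left_comm _ _ _
  have hinv : ∀ i, Tendsto (fun t => (eucNorm (x i t) : ℂ)⁻¹) atTop (nhds 0) := fun i => by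
    have h := (Complex.continuous_ofReal.tendsto 0).comp (hx i).inv_tendsto_atTop
    refine (Complex.ofReal_zero ▸ h).congr fun t => ?_
    simp
  have hlinv := fun i => (hlim i).inv₀ (hφ i)
  have hpos : ∀ i, ∀ᶠ t in atTop, (eucNorm (x i t) : ℂ) ≠ 0 := fun i => by
    filter_upwards [(hx i).eventually_gt_atTop 0] with t ht
    exact_mod_cast ht.ne'
  have hev : ∀ i, ∀ᶠ t in atTop, ∑ s, ell s * x i t s ≠ 0 := fun i => by
    filter_upwards [(hlim i).eventually_ne (hφ i)] with t ht h
    exact ht (by rw [h, mul_zero])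
  choose N hN using fun i => eventually_atTop.1 (hev i)
  let e : Option (Fin m) ≃ Fin (m + 1) := (finSuccEquiv' j).symm
  have hshift : ∀ (i : γ) {u : ℕ → ℂ} {a : ℂ}, Tendsto u atTop (nhds a) →
      Tendsto (fun t => u (t + N i)) atTop (nhds a) := fun i u a h =>
    h.comp (tendsto_add_atTop_nat (N i))
  have hell0 : ell ≠ 0 := fun h => hφ i₀ (by rw [hell, h]; simp)
  have hw : ∀ i, Tendsto (fun t => (∑ s, ell s * x i t s)⁻¹) atTop (nhds 0) := fun i => by
    have h := (hinv i).mul (hlinv i)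
    rw [zero_mul] at h
    refine h.congr' ?_
    filter_upwards [hpos i] with t ht
    rw [mul_inv, inv_inv, inv_mul_cancel_left₀ ht]
  have hr : ∀ i s, Tendsto (fun t => x i t s * (∑ s, ell s * x i t s)⁻¹) atTop
      (nhds (xh i s * (φ (xh i))⁻¹)) := fun i s => by
    refine ((hdir i s).mul (hlinv i)).congr' ?_
    filter_upwards [hpos i] with t ht
    rw [mul_inv, inv_inv, mul_mul_mul_comm, inv_mul_cancel₀ ht, one_mul]
  have hu : ∀ i s, Tendsto (fun t => (∑ s, ell s * x i t s) *
      (eval (x i t) (pderiv s (f (e none))) -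
        ∑ l, lam i t l * eval (x i t) (pderiv s (f (e (some l)))))) atTop (nhds 0) := fun i s => by
    have h := (hlim i).mul (hlam i s)
    rw [mul_zero] at h
    refine h.congr' ?_
    filter_upwards [hpos i] with t ht
    rw [mul_mul_mul_comm, inv_mul_cancel₀ ht, one_mul]
    simp [e, finSuccEquiv'_symm_none, finSuccEquiv'_symm_some]
  obtain ⟨g, hg, hgd, hgc⟩ := exists_vanishing_of_multiplier_sequences ell
    hell0 (fun o => f (e o)) (hind.comp e e.injective) d q hd (fun o => hf _) hq hdq
    (by simpa using hm) (fun i o => c i (e o)) (fun i t => x i (t + N i))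
    (fun i t => lam i (t + N i)) (fun i s => xh i s * (φ (xh i))⁻¹)
    (fun i t => hN i _ (Nat.le_add_left _ _)) (fun i => hshift i (hw i))
    (fun i s => hshift i (hr i s)) (fun i s => hshift i (hu i s))
    (fun i o => hshift i (hc i (e o)))
  refine ⟨rename e g, fun h => hg (rename_injective e e.injective (by rw [h, map_zero])),
    (totalDegree_rename_le _ _).trans (by simpa using hgd), fun i => ?_⟩
  rw [eval_rename]
  exact hgc i

theorem MvPolynomial.eq_C_of_pderiv_eq_zero {σ k : Type*} [Field k] [CharZero k]
    {P : MvPolynomial σ k} (h : ∀ i, pderiv i P = 0) : P = C (coeff 0 P) := by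
  classical
  ext e
  rw [coeff_C]
  split_ifs with he
  · rw [he]
  · obtain ⟨i, hi⟩ := Finsupp.ne_iff.1 (Ne.symm he)
    have h1 := coeff_pderiv (i := i) P (e - Finsupp.single i 1)
    rw [h, coeff_zero, tsub_add_cancel_of_le
      (Finsupp.single_le_iff.2 (Nat.one_le_iff_ne_zero.2 hi))] at h1
    exact (mul_eq_zero.1 h1.symm).resolve_right (Nat.cast_add_one_ne_zero _)

theorem MvPolynomial.pderiv_eq_C_of_totalDegree_le_one {σ R : Type*} [CommRing R]
    {P : MvPolynomial σ R} (h : P.totalDegree ≤ 1) (i : σ) :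
    pderiv i P = C (coeff 0 (pderiv i P)) :=
  totalDegree_eq_zero_iff_eq_C.1
    (Nat.le_zero.1 ((totalDegree_pderiv_le i P).trans (Nat.sub_le_of_le_add h)))

theorem MvPolynomial.eval_eq_of_totalDegree_le_one {σ k : Type*} [Field k] [CharZero k]
    [Fintype σ] {P : MvPolynomial σ k} (h : P.totalDegree ≤ 1) (x z : σ → k) :
    eval x P = eval z P + ∑ s, (x s - z s) * eval z (pderiv s P) := by
  classical
  have hC := fun s => pderiv_eq_C_of_totalDegree_le_one h s
  let Q : MvPolynomial σ k := P - ∑ s, (X s - C (z s)) * C (coeff 0 (pderiv s P))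
  have hQ : ∀ i, pderiv i Q = 0 := fun i => by
    simp only [Q, map_sub, map_sum, Derivation.leibniz, pderiv_C, pderiv_X,
      sub_zero, smul_eq_mul, Pi.single_apply]
    rw [hC i]
    simp
  have hx := eq_C_of_pderiv_eq_zero hQ
  have h1 : eval x Q = eval z Q := by rw [hx, eval_C, eval_C]
  have h2 : ∀ s, eval z (pderiv s P) = coeff 0 (pderiv s P) := fun s => by
    conv_lhs => rw [hC s, eval_C]
  simp only [Q, map_sub, map_sum, map_mul, eval_X, eval_C, sub_self, zero_mul,
    Finset.sum_const_zero, sub_zero] at h1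
  simp only [h2]
  linear_combination h1

theorem MvPolynomial.pderiv_comm {σ R : Type*} [CommRing R] (i j : σ) (P : MvPolynomial σ R) :
    pderiv i (pderiv j P) = pderiv j (pderiv i P) := by
  classical
  ext e
  simp only [coeff_pderiv, Finsupp.add_apply, add_right_comm e (Finsupp.single j 1)]
  rcases eq_or_ne i j with rfl | h
  · rfl
  · simp only [Finsupp.single_eq_of_ne h, Finsupp.single_eq_of_ne h.symm]
    ring_nf

theorem MvPolynomial.eval_sub_eq_of_totalDegree_le_two {σ k : Type*} [Field k] [CharZero k]
    [Fintype σ] {P : MvPolynomial σ k} (h : P.totalDegree ≤ 2) (z : σ → k)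
    (hz : ∀ s, eval z (pderiv s P) = 0) (x : σ → k) :
    2 * (eval x P - eval z P) = ∑ s, (x s - z s) * eval x (pderiv s P) := by
  classical
  have hd : ∀ s, (pderiv s P).totalDegree ≤ 1 := fun s =>
    (totalDegree_pderiv_le s P).trans (Nat.sub_le_of_le_add h)
  let Q : MvPolynomial σ k := C 2 * P - ∑ s, (X s - C (z s)) * pderiv s P
  have hQ : ∀ i, pderiv i Q = 0 := fun i => by
    refine MvPolynomial.funext fun y => ?_
    have h1 := eval_eq_of_totalDegree_le_one (hd i) y z
    have h2 : ∀ s, eval z (pderiv i (pderiv s P)) = eval y (pderiv i (pderiv s P)) := fun s => by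
      rw [pderiv_eq_C_of_totalDegree_le_one (hd s) i, eval_C, eval_C]
    simp only [Q, map_sub, map_sum, Derivation.leibniz, pderiv_C, pderiv_X,
      sub_zero, smul_eq_mul, Pi.single_apply, map_add, map_mul, eval_C, eval_X, map_zero]
    simp only [hz, zero_add, pderiv_comm _ i, h2] at h1
    simp [Finset.sum_add_distrib, ← h1]
    ring
  have hx := eq_C_of_pderiv_eq_zero hQ
  have h1 : eval x Q = eval z Q := by rw [hx, eval_C, eval_C]
  simp only [Q, map_sub, map_sum, map_mul, eval_X, eval_C, sub_self, zero_mul,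
    Finset.sum_const_zero, sub_zero] at h1
  linear_combination h1

theorem tendsto_zero_of_eucNorm_mul {n : ℕ} {x : ℕ → Fin n → ℂ} {u : ℕ → ℂ}
    (hx : Tendsto (fun t => eucNorm (x t)) atTop atTop)
    (hu : Tendsto (fun t => (eucNorm (x t) : ℂ) * u t) atTop (nhds 0)) :
    Tendsto u atTop (nhds 0) := by
  have h1 : Tendsto (fun t => (eucNorm (x t) : ℂ)⁻¹) atTop (nhds 0) := by
    have := (Complex.continuous_ofReal.tendsto 0).comp (tendsto_inv_atTop_zero.comp hx)
    simpa [Function.comp_def] using this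
  have h2 := h1.mul hu
  rw [zero_mul] at h2
  refine h2.congr' ?_
  filter_upwards [hx.eventually_gt_atTop 0] with t ht
  rw [inv_mul_cancel_left₀ (Complex.ofReal_ne_zero.2 (ne_of_gt ht))]

/-- A dominant affine map has no asymptotic critical values. -/
theorem Kinf_eq_empty_of_totalDegree_le_one {n m : ℕ} {f : Fin (m + 1) → MvPolynomial (Fin n) ℂ}
    (hind : AlgebraicIndependent ℂ f) (hf : ∀ i, (f i).totalDegree ≤ 1) : Kinf f = ∅ := by
  classical
  refine Set.eq_empty_iff_forall_notMem.2 fun c hc => ?_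
  obtain ⟨j, xh, x, lam, -, hx, -, -, hlam⟩ := exists_multiplier_sequence_of_mem_Kinf hc
  let a : Fin (m + 1) → Fin n → ℂ := fun i s => coeff 0 (pderiv s (f i))
  have ha : ∀ i s, pderiv s (f i) = C (a i s) := fun i s =>
    pderiv_eq_C_of_totalDegree_le_one (hf i) s
  have hlim : Tendsto (fun t => ∑ l, lam t l • a (j.succAbove l)) atTop (nhds (a j)) := by
    refine tendsto_pi_nhds.2 fun s => ?_
    have h := tendsto_zero_of_eucNorm_mul hx (hlam s)
    simp only [ha, eval_C] at h
    simpa using h.const_sub (a j s)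
  have hmem : a j ∈ Submodule.span ℂ (Set.range fun l => a (j.succAbove l)) :=
    (Submodule.closed_of_finiteDimensional _).mem_of_tendsto hlim <| Eventually.of_forall fun t =>
      Submodule.sum_mem _ fun l _ => Submodule.smul_mem _ _ (Submodule.subset_span ⟨l, rfl⟩)
  obtain ⟨mu, hmu⟩ := (Submodule.mem_span_range_iff_exists_fun ℂ).1 hmem
  have hC := eq_C_of_pderiv_eq_zero (P := f j - ∑ l, C (mu l) * f (j.succAbove l)) fun s => by
    simp [ha, ← hmu]
  set b := coeff 0 (f j - ∑ l, C (mu l) * f (j.succAbove l))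
  have h0 : (X j - ∑ l, C (mu l) * X (j.succAbove l) - C b : MvPolynomial (Fin (m + 1)) ℂ) = 0 :=
    hind.eq_zero_of_aeval_eq_zero _ (by simpa [sub_eq_zero, algebraMap_eq] using hC)
  have h1 := congrArg (eval (Pi.single j (1 + b))) h0
  simp at h1

/-- A polynomial function of degree at most two has at most one asymptotic critical value, the
value taken on its critical points. -/
theorem exists_vanishing_of_totalDegree_le_two {n : ℕ} {f : Fin 1 → MvPolynomial (Fin n) ℂ}
    (hf : (f 0).totalDegree ≤ 2) : ∃ a : ℂ, ∀ c ∈ Kinf f, c 0 = a := by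
  classical
  by_cases hz : ∃ z, ∀ s, eval z (pderiv s (f 0)) = 0
  · obtain ⟨z, hz⟩ := hz
    refine ⟨eval z (f 0), fun c hc => ?_⟩
    obtain ⟨j, xh, x, lam, -, hx, hdir, hfc, hlam⟩ := exists_multiplier_sequence_of_mem_Kinf hc
    obtain rfl : j = 0 := Subsingleton.elim (α := Fin 1) j 0
    simp only [Finset.univ_eq_empty, Finset.sum_empty, sub_zero] at hlam
    have h1 : Tendsto (fun t => ∑ s, (x t s - z s) * eval (x t) (pderiv s (f 0))) atTop
        (nhds (∑ s : Fin n, (xh s * 0 - z s * 0))) := by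
      refine tendsto_finsetSum _ fun s _ => ?_
      refine (((hdir s).mul (hlam s)).sub
        ((tendsto_zero_of_eucNorm_mul hx (hlam s)).const_mul (z s))).congr' ?_
      filter_upwards [hx.eventually_gt_atTop 0] with t ht
      have := Complex.ofReal_ne_zero.2 ht.ne'
      field_simp
    simp only [← eval_sub_eq_of_totalDegree_le_two hf z hz, mul_zero, sub_zero,
      Finset.sum_const_zero] at h1
    have h2 := tendsto_nhds_unique h1 (((hfc 0).sub_const _).const_mul 2)
    simp only [zero_eq_mul, two_ne_zero, false_or, sub_eq_zero] at h2
    exact h2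
  · refine ⟨0, fun c hc => (hz ?_).elim⟩
    obtain ⟨j, xh, x, lam, -, hx, hdir, hfc, hlam⟩ := exists_multiplier_sequence_of_mem_Kinf hc
    obtain rfl : j = 0 := Subsingleton.elim (α := Fin 1) j 0
    simp only [Finset.univ_eq_empty, Finset.sum_empty, sub_zero] at hlam
    have hd : ∀ s, (pderiv s (f 0)).totalDegree ≤ 1 := fun s =>
      (totalDegree_pderiv_le s (f 0)).trans (Nat.sub_le_of_le_add hf)
    let v : Fin n → Fin n → ℂ := fun r s => eval 0 (pderiv r (pderiv s (f 0)))
    have hv : ∀ y s, eval y (pderiv s (f 0)) =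
        eval 0 (pderiv s (f 0)) + (∑ r, y r • v r) s := fun y s => by
      simp [eval_eq_of_totalDegree_le_one (hd s) y 0, v]
    have hlim : Tendsto (fun t => ∑ r, x t r • v r) atTop
        (nhds fun s => - eval 0 (pderiv s (f 0))) := by
      refine tendsto_pi_nhds.2 fun s => ?_
      have h := (tendsto_zero_of_eucNorm_mul hx (hlam s)).sub_const (eval 0 (pderiv s (f 0)))
      rw [zero_sub] at h
      exact h.congr fun t => sub_eq_of_eq_add' (hv (x t) s)
    have hmem : (fun s => - eval 0 (pderiv s (f 0))) ∈ Submodule.span ℂ (Set.range v) :=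
      (Submodule.closed_of_finiteDimensional _).mem_of_tendsto hlim <|
        Eventually.of_forall fun t => Submodule.sum_mem _ fun l _ =>
          Submodule.smul_mem _ _ (Submodule.subset_span ⟨l, rfl⟩)
    obtain ⟨z, hz⟩ := (Submodule.mem_span_range_iff_exists_fun ℂ).1 hmem
    exact ⟨z, fun s => by rw [hv, hz, add_neg_cancel]⟩

/-- If every finite subset of `T` lies in a hypersurface of degree at most `D`, then so does `T`. -/
theorem MvPolynomial.exists_ne_zero_of_finite_subsets {σ k : Type*} [Finite σ] [Field k] (D : ℕ)
    (T : Set (σ → k)) (h : ∀ S : Finset (σ → k), ↑S ⊆ T →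
      ∃ g : MvPolynomial σ k, g ≠ 0 ∧ g.totalDegree ≤ D ∧ ∀ c ∈ S, eval c g = 0) :
    ∃ g : MvPolynomial σ k, g ≠ 0 ∧ g.totalDegree ≤ D ∧ ∀ c ∈ T, eval c g = 0 := by
  classical
  let V : Finset (σ → k) → Submodule k (restrictTotalDegree σ k D) := fun S =>
    ⨅ c ∈ S, LinearMap.ker ((aeval c).toLinearMap ∘ₗ (restrictTotalDegree σ k D).subtype)
  have hV : ∀ S g, g ∈ V S ↔ ∀ c ∈ S, eval c (g : MvPolynomial σ k) = 0 := fun S g => by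
    simp [V, Submodule.mem_iInf]
  obtain ⟨_, ⟨S, hS, rfl⟩, hmin⟩ := wellFounded_lt.has_min (V '' {S | ↑S ⊆ T})
    ⟨_, ∅, by simp, rfl⟩
  obtain ⟨g, hg, hgD, hgS⟩ := h S hS
  refine ⟨g, hg, hgD, fun c hc => ?_⟩
  have hle : V (insert c S) ≤ V S := fun x hx => (hV _ _).2 fun e he =>
    (hV _ _).1 hx e (Finset.mem_insert_of_mem he)
  have heq := eq_of_le_of_not_lt hle <|
    hmin _ ⟨insert c S, by simpa [Set.insert_subset_iff] using ⟨hc, hS⟩, rfl⟩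
  have hmem : (⟨g, (mem_restrictTotalDegree _ _ _).2 hgD⟩ : restrictTotalDegree σ k D) ∈ V S :=
    (hV _ _).2 hgS
  exact (hV _ _).1 (heq ▸ hmem) c (Finset.mem_insert_self _ _)

theorem exists_vanishing_of_finset {n m : ℕ}
    (f : Fin (m + 1) → MvPolynomial (Fin n) ℂ) (hind : AlgebraicIndependent ℂ f) (d q : ℕ)
    (hd : 1 ≤ d) (hf : ∀ i, (f i).totalDegree ≤ d) (hq : 1 ≤ q) (hdq : (m + 1) * (d - 1) ≤ q)
    (hm : m + 1 ≤ n) (S : Finset (Fin (m + 1) → ℂ)) (hS : ↑S ⊆ Kinf f) :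
    ∃ g : MvPolynomial (Fin (m + 1)) ℂ, g ≠ 0 ∧
      g.totalDegree ≤ (m + 1) * ∑ k ∈ Finset.range (n - m), q ^ (n - m - 1 - k) * d ^ m ∧
      ∀ c ∈ S, eval c g = 0 := by
  choose! j xh x lam hxh hx hdir hc hlam using
    fun c (hc : c ∈ Kinf f) => exists_multiplier_sequence_of_mem_Kinf hc
  have key : ∀ i : Fin (m + 1), ∃ g : MvPolynomial (Fin (m + 1)) ℂ, g ≠ 0 ∧
      g.totalDegree ≤ ∑ k ∈ Finset.range (n - m), q ^ (n - m - 1 - k) * d ^ m ∧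
      ∀ c ∈ S, j c = i → eval c g = 0 := fun i => by
    obtain ⟨g, hg, hgd, hgc⟩ := exists_vanishing_of_directions (γ := {c : S // j c = i}) f hind d q
      hd hf hq hdq hm i (fun c => c.1) (fun c => xh c.1) (fun c => x c.1) (fun c => lam c.1)
      (fun c => hxh _ (hS c.1.2)) (fun c => hx _ (hS c.1.2)) (fun c => hdir _ (hS c.1.2))
      (fun c => hc _ (hS c.1.2)) (fun c => by
        have h := hlam _ (hS c.1.2)
        rwa [c.2] at h)
    exact ⟨g, hg, hgd, fun c hc hj => hgc ⟨⟨c, hc⟩, hj⟩⟩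
  choose g hg hgd hgc using key
  refine ⟨∏ i, g i, Finset.prod_ne_zero_iff.2 fun i _ => hg i, ?_, fun c hc => ?_⟩
  · refine (totalDegree_finsetProd _ _).trans ((Finset.sum_le_card_nsmul _ _ _ fun i _ =>
      hgd i).trans ?_)
    simp
  · rw [map_prod]
    exact Finset.prod_eq_zero (Finset.mem_univ (j c)) (hgc _ c hc rfl)

theorem Nat.sum_range_succ_pow_le_two_mul {q : ℕ} (hq : 2 ≤ q) (N : ℕ) :
    ∑ k ∈ Finset.range (N + 1), q ^ k ≤ 2 * q ^ N := by
  induction N with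
  | zero => simp
  | succ N ih =>
    rw [Finset.sum_range_succ, pow_succ]
    nlinarith [Nat.mul_le_mul_left (q ^ N) hq]

theorem AlgebraicIndependent.le_of_fin {n p : ℕ} {f : Fin p → MvPolynomial (Fin n) ℂ}
    (hf : AlgebraicIndependent ℂ f) : p ≤ n := by
  simpa [trdeg_of_isDomain] using hf.cardinalMk_le_trdeg

/-- the asymptotic critical values of a dominant polynomial map
`f : ℂ^n → ℂ^p` with `d = max deg f_i` lie in a hypersurface of degree at most
`p^(n-p+1) * (d-1)^(n-p) * (d+1)^p`. -/
theorem asymptotic_critical_values_degree_bound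
    {n p d : ℕ} (hp : 1 ≤ p) (f : Fin p → MvPolynomial (Fin n) ℂ)
    (hdom : AlgebraicIndependent ℂ f)
    (hd : d = Finset.univ.sup fun i => (f i).totalDegree) :
    ∃ g : MvPolynomial (Fin p) ℂ, g ≠ 0 ∧
      g.totalDegree ≤ p ^ (n - p + 1) * (d - 1) ^ (n - p) * (d + 1) ^ p ∧
      ∀ c ∈ Kinf f, MvPolynomial.eval c g = 0 := by
  obtain ⟨m, rfl⟩ : ∃ m, p = m + 1 := ⟨p - 1, by omega⟩
  have hf : ∀ i, (f i).totalDegree ≤ d := fun i =>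
    hd ▸ Finset.le_sup (f := fun i => (f i).totalDegree) (Finset.mem_univ i)
  have hn := hdom.le_of_fin
  rcases Nat.lt_or_ge d 2 with hd2 | hd2
  · refine ⟨1, one_ne_zero, by simp, ?_⟩
    rw [Kinf_eq_empty_of_totalDegree_le_one hdom fun i => (hf i).trans (by omega)]
    simp
  obtain ⟨e, rfl⟩ : ∃ e, d = e + 1 := ⟨d - 1, by omega⟩
  obtain ⟨N, rfl⟩ : ∃ N, n = m + 1 + N := ⟨n - (m + 1), by omega⟩
  rw [Nat.add_sub_cancel_left, Nat.add_sub_cancel]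
  by_cases h1 : (m + 1) * e = 1
  · obtain ⟨hm, rfl⟩ := _root_.mul_eq_one.1 h1
    obtain rfl : m = 0 := by omega
    obtain ⟨a, ha⟩ := exists_vanishing_of_totalDegree_le_two (hf 0)
    refine ⟨X 0 - C a, fun h => ?_, ?_, fun c hc => ?_⟩
    · simpa using congrArg (eval fun _ => a + 1) h
    · exact (totalDegree_sub_C_le _ _).trans (by simp [totalDegree_X])
    · simp [ha c hc]
  have hq : 2 ≤ (m + 1) * e := by
    have : (m + 1) * e ≠ 0 := Nat.mul_ne_zero (by omega) (by omega)
    omega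
  refine exists_ne_zero_of_finite_subsets _ _ fun S hS => ?_
  obtain ⟨g, hg, hgd, hgc⟩ := exists_vanishing_of_finset f hdom (e + 1) ((m + 1) * e) (by omega) hf
    (by omega) (by simp) hn S hS
  refine ⟨g, hg, hgd.trans ?_, hgc⟩
  have hs : ∑ k ∈ Finset.range (m + 1 + N - m), ((m + 1) * e) ^ (m + 1 + N - m - 1 - k) *
      (e + 1) ^ m ≤ 2 * ((m + 1) * e) ^ N * (e + 1) ^ m := by
    rw [← Finset.sum_mul, show m + 1 + N - m = N + 1 by omega,
      Finset.sum_range_reflect (fun k => ((m + 1) * e) ^ k)]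
    exact Nat.mul_le_mul_right _ (Nat.sum_range_succ_pow_le_two_mul hq N)
  calc _ ≤ (m + 1) * (2 * ((m + 1) * e) ^ N * (e + 1) ^ m) := Nat.mul_le_mul_left _ hs
    _ = (m + 1) ^ (N + 1) * e ^ N * ((e + 1) ^ m * 2) := by rw [mul_pow]; ring
    _ ≤ _ := by
      rw [pow_succ (e + 1 + 1)]
      gcongr <;> omega
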